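/- arXiv:1307.1297 — 4 statements merged into one kernel-verified Lean document; each statement's English description precedes it below -/
import Mathlib

section
/- Let I be a compact interval of ℝ and let f: I → I be an interval map of class C^3 with non-flat critical points that is topologically exact. Let φ: I → ℝ be Hölder continuous, let t ≥ 0, and put ψ_t := φ − t ln|f'|. Let ν be an f-invariant ergodic Borel probability measure that is not supported on a periodic orbit and whose Lyapunov exponent ∫ ln|f'| dν is strictly positive. Then there exists a subset X of I of full ν-measure such that for every point x₀ in X the following holds: there exist D ∈ (0, +∞), a compact connected subset B₀ of I containing x₀, and a free IMFS (φ_l)_{l≥1} generated by f with time sequence (m_l)_{l≥1}, defined on B₀, such that for every l and every y in φ_l(B₀) one has S_{m_l}(ψ_t)(y) ≥ m_l ∫ ψ_t dν − D. -/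
open MeasureTheory Filter Set Metric

noncomputable section

/-- Shannon entropy of the law of a finitely-valued map `p` under the measure `μ`. -/
def partitionEntropy {X ι : Type*} [MeasurableSpace X] [Fintype ι]
    (μ : Measure X) (p : X → ι) : ℝ :=
  ∑ i, Real.negMulLog (μ (p ⁻¹' {i})).toReal

/-- Kolmogorov–Sinai (measure-theoretic) entropy of `f` with respect to `μ`:
the supremum over finite measurable partitions (coded by maps into `Fin k`) of the
limit (here: infimum, by subadditivity) of the normalized entropies of the joins. -/
def ksEntropy {X : Type*} [MeasurableSpace X] (μ : Measure X) (f : X → X) : ℝ :=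
  ⨆ k : ℕ, ⨆ p : { p : X → Fin k // Measurable p },
    ⨅ n : ℕ, partitionEntropy μ (fun x (i : Fin (n + 1)) => p.1 (f^[(i : ℕ)] x)) / (n + 1)

/-- `μ` is an `f`-invariant Borel probability measure giving full mass to `I`. -/
def InvariantProb (f : ℝ → ℝ) (I : Set ℝ) (μ : Measure ℝ) : Prop :=
  IsProbabilityMeasure μ ∧ μ I = 1 ∧ ∀ A : Set ℝ, MeasurableSet A → μ (f ⁻¹' A) = μ A

/-- Topological pressure of `f : I → I` for the potential `φ`, defined via the
variational principle. -/
def pressure (f : ℝ → ℝ) (I : Set ℝ) (φ : ℝ → ℝ) : ℝ :=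
  sSup { r : ℝ | ∃ μ : Measure ℝ, InvariantProb f I μ ∧ r = ksEntropy μ f + ∫ x, φ x ∂μ }

/-- An equilibrium state of `f` for the potential `φ`. -/
def IsEquilibriumState (f : ℝ → ℝ) (I : Set ℝ) (φ : ℝ → ℝ) (μ : Measure ℝ) : Prop :=
  InvariantProb f I μ ∧ ksEntropy μ f + ∫ x, φ x ∂μ = pressure f I φ

/-- `φ` is Hölder continuous on `I`. -/
def HolderOn (φ : ℝ → ℝ) (I : Set ℝ) : Prop :=
  ∃ C α : ℝ, 0 < α ∧ α ≤ 1 ∧ 0 ≤ C ∧ ∀ x ∈ I, ∀ y ∈ I, |φ x - φ y| ≤ C * |x - y| ^ α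

/-- `φ` is hyperbolic for `f`: for some `n ≥ 1`, `sup_I (1/n) Sₙ(φ) < P(f, φ)`. -/
def HyperbolicPotential (f : ℝ → ℝ) (I : Set ℝ) (φ : ℝ → ℝ) : Prop :=
  ∃ n : ℕ, 1 ≤ n ∧ sSup ((fun x => birkhoffSum f φ n x / n) '' I) < pressure f I φ

/-- `g` is a `C³` diffeomorphism of `ℝ`. -/
def IsC3Diffeo (g : ℝ → ℝ) : Prop :=
  ContDiff ℝ 3 g ∧ Function.Bijective g ∧ ∀ x, deriv g x ≠ 0

/-- `f` is an interval map of class `C³` with non-flat critical points on `I = [a, b]`. -/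
structure IsC3NonflatIntervalMap (f : ℝ → ℝ) (a b : ℝ) : Prop where
  lt : a < b
  mapsTo : MapsTo f (Icc a b) (Icc a b)
  diff : ∀ x ∈ Icc a b, DifferentiableAt ℝ f x
  critFinite : {x | x ∈ Icc a b ∧ deriv f x = 0}.Finite
  smooth : ContDiffOn ℝ 3 f ((Icc a b) \ {x | deriv f x = 0})
  nonflat : ∀ c ∈ Icc a b, deriv f c = 0 →
    ∃ ℓ : ℝ, 1 < ℓ ∧ ∃ φ ψ : ℝ → ℝ, IsC3Diffeo φ ∧ IsC3Diffeo ψ ∧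
      φ c = 0 ∧ ψ (f c) = 0 ∧
      ∀ᶠ x in nhdsWithin c (Icc a b), |ψ (f x)| = |φ x| ^ ℓ

/-- `f : I → I` is topologically exact. -/
def TopExact (f : ℝ → ℝ) (I : Set ℝ) : Prop :=
  ∀ U : Set ℝ, IsOpen U → (U ∩ I).Nonempty → ∃ n : ℕ, 1 ≤ n ∧ f^[n] '' (U ∩ I) = I

/-- `μ` is an `f`-invariant **ergodic** Borel probability measure on `I`. -/
def ErgodicProb (f : ℝ → ℝ) (I : Set ℝ) (μ : Measure ℝ) : Prop :=
  InvariantProb f I μ ∧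
    ∀ A : Set ℝ, MeasurableSet A → f ⁻¹' A = A → μ A = 0 ∨ μ A = 1

/-- An Iterated Multivalued Function System (IMFS) generated by `f : I → I`, defined on a
set `B₀ ⊆ I`: for each `l` there are an integer `m l ≥ 1` and a pull-back `W l` of `B₀`
by `f^[m l]` (i.e. a connected component of `f^[m l] ⁻¹' B₀ ∩ I`) contained in `B₀` with
`f^[m l] '' (W l) = B₀`; the `l`-th multivalued map is `A ↦ f^[m l] ⁻¹' A ∩ W l`. -/
structure IMFS (f : ℝ → ℝ) (I B₀ : Set ℝ) where
  /-- the time sequence -/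
  m : ℕ → ℕ
  /-- the pull-backs -/
  W : ℕ → Set ℝ
  one_le : ∀ l, 1 ≤ m l
  sub : ∀ l, W l ⊆ B₀
  pullback : ∀ l, ∃ x ∈ W l, W l = connectedComponentIn (f^[m l] ⁻¹' B₀ ∩ I) x
  onto : ∀ l, f^[m l] '' W l = B₀

/-- The `l`-th multivalued map of the IMFS, `φ_l(A) = f^{-m_l}(A) ∩ W_l`. -/
def IMFS.apply {f : ℝ → ℝ} {I B₀ : Set ℝ} (S : IMFS f I B₀) (l : ℕ) (A : Set ℝ) : Set ℝ :=
  f^[S.m l] ⁻¹' A ∩ S.W l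

/-- `φ_{l₁ ⋯ l_k} = φ_{l₁} ∘ ⋯ ∘ φ_{l_k}` applied to a set. -/
def IMFS.applyWord {f : ℝ → ℝ} {I B₀ : Set ℝ} (S : IMFS f I B₀) :
    List ℕ → Set ℝ → Set ℝ
  | [], A => A
  | l :: u, A => S.apply l (S.applyWord u A)

/-- `m_{l₁ ⋯ l_k} = m_{l₁} + ⋯ + m_{l_k}`. -/
def IMFS.time {f : ℝ → ℝ} {I B₀ : Set ℝ} (S : IMFS f I B₀) (u : List ℕ) : ℕ :=
  (u.map S.m).sum

/-- The IMFS is free at `x₀`: distinct nonempty words with the same total time have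
disjoint images of `{x₀}`. -/
def IMFS.FreeAt {f : ℝ → ℝ} {I B₀ : Set ℝ} (S : IMFS f I B₀) (x₀ : ℝ) : Prop :=
  ∀ u v : List ℕ, u ≠ [] → v ≠ [] → u ≠ v → S.time u = S.time v →
    Disjoint (S.applyWord u {x₀}) (S.applyWord v {x₀})

/-- The IMFS is free. -/
def IMFS.Free {f : ℝ → ℝ} {I B₀ : Set ℝ} (S : IMFS f I B₀) : Prop :=
  ∃ x₀ ∈ B₀, S.FreeAt x₀

/-- A topologically exact self-map `T` of `[a, b]` whose slopes are controlled by a Hölder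
function `d` (the absolute value of the derivative) with finitely many zeros. -/
structure ExactSlopeMap (T d : ℝ → ℝ) (a b : ℝ) : Prop where
  lt : a < b
  cont : Continuous T
  mem : ∀ x, T x ∈ Icc a b
  nonneg : ∀ x, 0 ≤ d x
  slope_cont : Continuous d
  exists_slope : ∀ x ∈ Icc a b, ∀ y ∈ Icc a b, ∃ w ∈ uIcc x y, |T x - T y| = d w * |x - y|
  holder : ∃ C β : ℝ, 0 < C ∧ 0 < β ∧
    ∀ x ∈ Icc a b, ∀ y ∈ Icc a b, |d x - d y| ≤ C * |x - y| ^ β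
  finite_crit : {x | x ∈ Icc a b ∧ d x = 0}.Finite
  exact : TopExact T (Icc a b)

namespace ExactSlopeMap

variable {T d : ℝ → ℝ} {a b : ℝ}

theorem iterate_mem (h : ExactSlopeMap T d a b) {x : ℝ} (hx : x ∈ Icc a b) (n : ℕ) :
    T^[n] x ∈ Icc a b := by
  cases n with
  | zero => exact hx
  | succ n => rw [Function.iterate_succ_apply']; exact h.mem _

theorem surjOn_iterate (h : ExactSlopeMap T d a b) (n : ℕ) :
    SurjOn T^[n] (Icc a b) (Icc a b) := by
  have hT : SurjOn T (Icc a b) (Icc a b) := by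
    obtain ⟨n, hn, hI⟩ := h.exact univ isOpen_univ ⟨a, mem_univ _, left_mem_Icc.2 h.lt.le⟩
    intro z hz
    rw [← hI] at hz
    obtain ⟨y, hy, rfl⟩ := hz
    obtain ⟨k, rfl⟩ := Nat.exists_eq_succ_of_ne_zero (by lia : n ≠ 0)
    exact ⟨T^[k] y, h.iterate_mem hy.2 k, (Function.iterate_succ_apply' ..).symm⟩
  exact hT.iterate n

/-- Every interval of length at least `δ` covers `[a, b]` after a uniform time. -/
theorem exists_uniform_time (h : ExactSlopeMap T d a b) {δ : ℝ} (hδ : 0 < δ) :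
    ∃ N : ℕ, ∀ n, N ≤ n → ∀ p ∈ Icc a b, ∀ q ∈ Icc a b, δ ≤ |p - q| →
      SurjOn T^[n] (uIcc p q) (Icc a b) := by
  have key : ∀ x ∈ Icc a b, ∃ N : ℕ, ∀ n, N ≤ n →
      SurjOn T^[n] (ball x (δ / 4) ∩ Icc a b) (Icc a b) := by
    intro x hx
    obtain ⟨N, -, hN⟩ := h.exact (ball x (δ / 4)) isOpen_ball
      ⟨x, mem_ball_self (by positivity), hx⟩
    refine ⟨N, fun n hn => ?_⟩
    obtain ⟨k, rfl⟩ := Nat.exists_eq_add_of_le' hn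
    rw [Function.iterate_add]
    exact (h.surjOn_iterate k).comp hN.superset
  choose! N hN using key
  obtain ⟨s, hsI, hs⟩ := isCompact_Icc.elim_nhds_subcover (fun x : ℝ => ball x (δ / 4))
    (fun x (_ : x ∈ Icc a b) => ball_mem_nhds x (by positivity))
  refine ⟨s.sup N, fun n hn p hp q hq hpq => ?_⟩
  have hmid : (p + q) / 2 ∈ Icc a b := ⟨by linarith [hp.1, hq.1], by linarith [hp.2, hq.2]⟩
  obtain ⟨x, hxs, hx⟩ := mem_iUnion₂.1 (hs hmid)
  refine (hN x (hsI x hxs) n ((Finset.le_sup hxs).trans hn)).mono ?_ Subset.rfl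
  rintro y ⟨hy, -⟩
  rw [mem_ball, Real.dist_eq, abs_lt] at hx hy
  rw [mem_uIcc]
  rcases le_total p q with hle | hle
  · rw [abs_of_nonpos (by linarith)] at hpq
    exact Or.inl ⟨by linarith, by linarith⟩
  · rw [abs_of_nonneg (by linarith)] at hpq
    exact Or.inr ⟨by linarith, by linarith⟩

theorem exists_slope_bound (h : ExactSlopeMap T d a b) :
    ∃ K : ℝ, 1 ≤ K ∧ ∀ x ∈ Icc a b, d x ≤ K := by
  obtain ⟨K, hK⟩ := (isCompact_Icc (a := a) (b := b)).bddAbove_image h.slope_cont.continuousOn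
  exact ⟨max K 1, le_max_right _ _, fun x hx => (hK (mem_image_of_mem _ hx)).trans (le_max_left _ _)⟩

theorem abs_iterate_sub_le (h : ExactSlopeMap T d a b) {K : ℝ} (hK : ∀ x ∈ Icc a b, d x ≤ K)
    (hK1 : 1 ≤ K) (n : ℕ) {x y : ℝ} (hx : x ∈ Icc a b) (hy : y ∈ Icc a b) :
    |T^[n] x - T^[n] y| ≤ K ^ n * |x - y| := by
  induction n with
  | zero => simp
  | succ n ih =>
    rw [Function.iterate_succ_apply', Function.iterate_succ_apply']
    obtain ⟨w, hw, he⟩ := h.exists_slope _ (h.iterate_mem hx n) _ (h.iterate_mem hy n)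
    have hwI := uIcc_subset_Icc (h.iterate_mem hx n) (h.iterate_mem hy n) hw
    rw [he, pow_succ']
    calc d w * |T^[n] x - T^[n] y| ≤ K * (K ^ n * |x - y|) :=
          mul_le_mul (hK w hwI) ih (abs_nonneg _) (by linarith)
      _ = _ := by ring

/-- Topological exactness excludes superattracting cycles. -/
theorem not_periodic_of_crit (h : ExactSlopeMap T d a b) {c : ℝ} (hc : c ∈ Icc a b)
    (hdc : d c = 0) {p : ℕ} (hp : 1 ≤ p) : T^[p] c ≠ c := by
  intro hper
  obtain ⟨C, β, hC, hβ, hhol⟩ := h.holder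
  obtain ⟨K, hK1, hK⟩ := h.exists_slope_bound
  obtain ⟨p, rfl⟩ := Nat.exists_eq_succ_of_ne_zero (by lia : p ≠ 0)
  have hlim : Tendsto (fun ρ : ℝ => K ^ p * (C * ρ ^ β)) (nhds 0) (nhds 0) := by
    have := ((Real.continuousAt_rpow_const 0 β (Or.inr hβ.le)).tendsto.const_mul C).const_mul (K ^ p)
    simpa [Real.zero_rpow hβ.ne'] using this
  obtain ⟨ρ₀, hρ₀, hsmall⟩ := Metric.eventually_nhds_iff.1 (hlim.eventually_lt_const one_pos)
  have hlt := h.lt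
  set ρ := min (ρ₀ / 2) ((b - a) / 4) with hρ
  have hρpos : 0 < ρ := lt_min (by positivity) (by linarith)
  have hstep : ∀ y ∈ Icc a b, |y - c| ≤ ρ → |T^[p + 1] y - c| ≤ ρ := by
    intro y hy hyc
    obtain ⟨w, hw, he⟩ := h.exists_slope y hy c hc
    have hwI := uIcc_subset_Icc hy hc hw
    have hwc : |w - c| ≤ |y - c| := by
      rw [abs_sub_comm w, abs_sub_comm y]; exact abs_sub_right_of_mem_uIcc hw
    have hdw : d w ≤ C * ρ ^ β := by
      have := hhol w hwI c hc
      rw [hdc, sub_zero, abs_of_nonneg (h.nonneg w)] at this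
      exact this.trans (mul_le_mul_of_nonneg_left
        (Real.rpow_le_rpow (abs_nonneg _) (hwc.trans hyc) hβ.le) hC.le)
    have hlt1 : K ^ p * (C * ρ ^ β) < 1 := hsmall (by
      rw [Real.dist_eq, sub_zero, abs_of_pos hρpos]
      exact (min_le_left _ _).trans_lt (by linarith))
    calc |T^[p + 1] y - c| = |T^[p] (T y) - T^[p] (T c)| := by
          rw [← Function.iterate_succ_apply, ← Function.iterate_succ_apply, hper]
      _ ≤ K ^ p * (d w * |y - c|) := by
          rw [← he]; exact h.abs_iterate_sub_le hK hK1 p (h.mem _) (h.mem _)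
      _ ≤ K ^ p * (C * ρ ^ β * ρ) := by
          have : 0 ≤ d w := h.nonneg w
          gcongr
      _ = K ^ p * (C * ρ ^ β) * ρ := by ring
      _ ≤ ρ := by nlinarith
  have hiter : ∀ k : ℕ, ∀ y ∈ Icc a b, |y - c| ≤ ρ → |(T^[p + 1])^[k] y - c| ≤ ρ := by
    intro k
    induction k with
    | zero => exact fun y _ hy => hy
    | succ k ih =>
      intro y hy hyc
      rw [Function.iterate_succ_apply]
      exact ih _ (h.iterate_mem hy _) (hstep y hy hyc)
  obtain ⟨e, he, hfar⟩ : ∃ e ∈ Icc a b, 2 * ρ ≤ |e - c| := by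
    have h4 : ρ ≤ (b - a) / 4 := min_le_right _ _
    rcases le_total c ((a + b) / 2) with hle | hle
    · exact ⟨b, right_mem_Icc.2 hlt.le, by rw [abs_of_nonneg] <;> linarith [hc.2]⟩
    · exact ⟨a, left_mem_Icc.2 hlt.le, by rw [abs_of_nonpos] <;> linarith [hc.1]⟩
  have hq : 0 < |e - c| := by linarith
  obtain ⟨N, hN⟩ := h.exists_uniform_time hρpos
  obtain ⟨q, hqI, hqc⟩ : ∃ q ∈ Icc a b, |q - c| = ρ := by
    rcases le_total c ((a + b) / 2) with hle | hle
    · have h4 : ρ ≤ (b - a) / 4 := min_le_right _ _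
      exact ⟨c + ρ, ⟨by linarith [hc.1], by linarith⟩, by simp [abs_of_pos hρpos]⟩
    · have h4 : ρ ≤ (b - a) / 4 := min_le_right _ _
      exact ⟨c - ρ, ⟨by linarith, by linarith [hc.2]⟩, by simp [abs_of_pos hρpos]⟩
  obtain ⟨y, hy, hye⟩ := hN ((p + 1) * N) (by nlinarith) q hqI c hc hqc.ge he
  have := hiter N y (uIcc_subset_Icc hqI hc hy)
    (by rw [abs_sub_comm, ← hqc, abs_sub_comm q]; exact abs_sub_right_of_mem_uIcc hy)
  rw [← Function.iterate_mul, hye] at this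
  linarith

/-- An orbit meets the critical set at most as many times as there are critical points. -/
theorem card_crit_visits_le (h : ExactSlopeMap T d a b) {x : ℝ} (hx : x ∈ Icc a b) (n : ℕ) :
    ((Finset.range n).filter (fun i => d (T^[i] x) = 0)).card ≤ h.finite_crit.toFinset.card := by
  refine Finset.card_le_card_of_injOn (fun i => T^[i] x) ?_ ?_
  · intro i hi
    simp only [Finset.coe_filter, mem_ofPred_eq] at hi
    simpa using ⟨h.iterate_mem hx i, hi.2⟩
  · have aux : ∀ i j : ℕ, i < j → d (T^[i] x) = 0 → T^[i] x ≠ T^[j] x := by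
      intro i j hij hi he
      obtain ⟨k, rfl⟩ := Nat.exists_eq_add_of_le' hij.le
      rw [Function.iterate_add_apply] at he
      exact h.not_periodic_of_crit (h.iterate_mem hx i) hi (by lia) he.symm
    intro i hi j hj he
    simp only [Finset.coe_filter, mem_ofPred_eq] at hi hj
    rcases lt_trichotomy i j with hij | hij | hij
    · exact absurd he (aux i j hij hi.2)
    · exact hij
    · exact absurd he.symm (aux j i hij hj.2)

end ExactSlopeMap

theorem sum_range_exp_neg_le {κ : ℝ} (hκ : 0 < κ) (m : ℕ) :
    ∑ i ∈ Finset.range m, Real.exp (-κ * ((m : ℝ) - i)) ≤ (1 - Real.exp (-κ))⁻¹ := by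
  have h1 : Real.exp (-κ) < 1 := Real.exp_lt_one_iff.2 (by linarith)
  rw [← Finset.sum_range_reflect]
  calc ∑ j ∈ Finset.range m, Real.exp (-κ * ((m : ℝ) - ((m - 1 - j : ℕ) : ℝ)))
      ≤ ∑ j ∈ Finset.range m, Real.exp (-κ) ^ j := by
        refine Finset.sum_le_sum fun j hj => ?_
        have hj := Finset.mem_range.1 hj
        rw [← Real.exp_nat_mul, Real.exp_le_exp]
        have : (m : ℝ) - ((m - 1 - j : ℕ) : ℝ) = j + 1 := by
          rw [show m - 1 - j = m - (j + 1) by lia, Nat.cast_sub (by lia)]; push_cast; ring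
        rw [this]
        linarith
    _ ≤ ∑' j : ℕ, Real.exp (-κ) ^ j :=
        (summable_geometric_of_lt_one (Real.exp_pos _).le h1).sum_le_tsum _
          fun _ _ => pow_nonneg (Real.exp_pos _).le _
    _ = _ := tsum_geometric_of_lt_one (Real.exp_pos _).le h1

namespace ExactSlopeMap

variable {T d : ℝ → ℝ} {a b : ℝ}

/-- Starting from `y`, move towards the far end of `[a, b]` until some iterate first leaves its
prescribed ball. -/
theorem exists_first_exit (h : ExactSlopeMap T d a b) {y : ℝ} (hy : y ∈ Icc a b) (n : ℕ)
    {r : ℕ → ℝ} (hr : ∀ i, 0 < r i) (hr0 : r 0 < (b - a) / 2) :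
    ∃ e ∈ Icc a b, (∀ z ∈ uIcc y e, ∀ i ≤ n, |T^[i] z - T^[i] y| ≤ r i) ∧
      ∃ i ≤ n, r i ≤ |T^[i] e - T^[i] y| := by
  have hlt := h.lt
  obtain ⟨e₁, he₁, hfar⟩ : ∃ e₁ ∈ Icc a b, (b - a) / 2 ≤ |e₁ - y| := by
    rcases le_total y ((a + b) / 2) with hle | hle
    · exact ⟨b, right_mem_Icc.2 hlt.le, by rw [abs_of_nonneg] <;> linarith [hy.2]⟩
    · exact ⟨a, left_mem_Icc.2 hlt.le, by rw [abs_of_nonpos] <;> linarith [hy.1]⟩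
  set γ : ℝ → ℝ := fun τ => y + τ * (e₁ - y) with hγ
  have hγc : Continuous γ := by fun_prop
  have hu : ∀ i, Continuous fun τ => |T^[i] (γ τ) - T^[i] y| := fun i =>
    (((h.cont.iterate i).comp hγc).sub continuous_const).abs
  set S : Set ℝ := Icc 0 1 ∩ ⋃ i ∈ Finset.range (n + 1), {τ | r i ≤ |T^[i] (γ τ) - T^[i] y|}
  have hS : IsCompact S := isCompact_Icc.inter_right
    ((Finset.range (n + 1)).finite_toSet.isClosed_biUnion fun i _ =>
      isClosed_le continuous_const (hu i))
  have h1S : (1 : ℝ) ∈ S := by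
    refine ⟨by simp, mem_iUnion₂.2 ⟨0, by simp, ?_⟩⟩
    simp only [mem_ofPred_eq, hγ, Function.iterate_zero, id]
    simpa using hr0.le.trans hfar
  obtain ⟨τ₀, ⟨⟨h0τ, hτ1⟩, hτS⟩, hmin⟩ := hS.exists_isLeast ⟨1, h1S⟩
  obtain ⟨i₀, hi₀, hri₀⟩ := mem_iUnion₂.1 hτS
  have hτpos : 0 < τ₀ := by
    rcases h0τ.eq_or_lt with h0 | h0
    · rw [← h0] at hri₀
      simp only [mem_ofPred_eq, hγ, zero_mul, add_zero, sub_self, abs_zero] at hri₀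
      exact absurd hri₀ (hr _).not_ge
    · exact h0
  refine ⟨γ τ₀, ?_, ?_, i₀, by simpa [Nat.lt_succ_iff] using hi₀, hri₀⟩
  · constructor <;> simp only [hγ] <;> nlinarith [hy.1, hy.2, he₁.1, he₁.2]
  · have hle : ∀ i ≤ n, ∀ τ ∈ Icc 0 τ₀, |T^[i] (γ τ) - T^[i] y| ≤ r i := by
      intro i hi τ hτ
      have hsub : Ico 0 τ₀ ⊆ {τ | |T^[i] (γ τ) - T^[i] y| ≤ r i} := by
        intro s hs
        by_contra hcon
        have hcon : r i < |T^[i] (γ s) - T^[i] y| := not_le.1 hcon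
        exact absurd (hmin ⟨⟨hs.1, hs.2.le.trans hτ1⟩,
          mem_iUnion₂.2 ⟨i, by simpa [Nat.lt_succ_iff] using hi, hcon.le⟩⟩) hs.2.not_ge
      have := closure_minimal hsub (isClosed_le (hu i) continuous_const)
      rw [closure_Ico hτpos.ne] at this
      exact this hτ
    intro z hz i hi
    obtain ⟨τ, hτ, rfl⟩ : ∃ τ ∈ Icc 0 τ₀, γ τ = z := by
      have := intermediate_value_uIcc (a := 0) (b := τ₀) hγc.continuousOn
      rw [uIcc_of_le h0τ] at this
      exact this (by simpa [hγ] using hz)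
    exact hle i hi τ hτ

theorem exp_mul_le_abs_iterate_sub (h : ExactSlopeMap T d a b) {μ : ℝ} {x y : ℝ}
    (hx : x ∈ Icc a b) (hy : y ∈ Icc a b) (k : ℕ)
    (hpos : ∀ j < k, 0 < d (T^[j] y))
    (hslope : ∀ j < k, ∀ w ∈ uIcc (T^[j] x) (T^[j] y),
      Real.exp (-μ) * d (T^[j] y) ≤ d w) :
    Real.exp (birkhoffSum T (fun z => Real.log (d z)) k y - μ * k) * |x - y| ≤
      |T^[k] x - T^[k] y| := by
  induction k with
  | zero => simp
  | succ k ih =>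
    have ih := ih (fun j hj => hpos j (by lia)) (fun j hj => hslope j (by lia))
    rw [Function.iterate_succ_apply', Function.iterate_succ_apply']
    obtain ⟨w, hw, he⟩ := h.exists_slope _ (h.iterate_mem hx k) _ (h.iterate_mem hy k)
    have hk := hpos k (by lia)
    rw [he, birkhoffSum_succ]
    calc _ = (Real.exp (-μ) * d (T^[k] y)) *
          (Real.exp (birkhoffSum T (fun z => Real.log (d z)) k y - μ * k) * |x - y|) := by
          rw [← Real.exp_log hk]
          simp only [Real.log_exp]
          rw [← mul_assoc, ← Real.exp_add, ← Real.exp_add]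
          congr 2
          push_cast; ring
      _ ≤ d w * |T^[k] x - T^[k] y| :=
          mul_le_mul (hslope k (by lia) w hw) ih (by positivity) (h.nonneg _)

/-- Around a hyperbolic orbit segment which approaches the critical points slowly there is an
interval with bounded distortion covering `[a, b]` a bounded time after the end of the segment. -/
theorem exists_covering_of_hyperbolic (h : ExactSlopeMap T d a b) {C β : ℝ} (hC : 0 < C)
    (hβ : 0 < β)
    (hhol : ∀ x ∈ Icc a b, ∀ y ∈ Icc a b, |d x - d y| ≤ C * |x - y| ^ β)
    {Φ : ℝ → ℝ} (hΦ : HolderOn Φ (Icc a b)) {t : ℝ} (ht : 0 ≤ t)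
    {μ η : ℝ} (hμ : 0 < μ) (hη : 0 < η) :
    ∃ (D : ℝ) (N : ℕ), ∀ (m : ℕ) (y : ℝ), y ∈ Icc a b →
      (∀ i < m, 2 * μ * ((m : ℝ) - i) ≤
        birkhoffSum T (fun z => Real.log (d z)) (m - i) (T^[i] y)) →
      (∀ i < m, η * Real.exp (-(β * μ / 2) * ((m : ℝ) - i)) ≤ d (T^[i] y)) →
      ∃ e ∈ Icc a b, SurjOn T^[m + N] (uIcc y e) (Icc a b) ∧
        ∀ z ∈ uIcc y e, birkhoffSum T (fun z => Φ z - t * Real.log (d z)) m y - D ≤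
          birkhoffSum T (fun z => Φ z - t * Real.log (d z)) m z := by
  have hlt := h.lt
  obtain ⟨A, α, hα, -, hA, hΦ⟩ := hΦ
  set σ := 1 - Real.exp (-μ) with hσ
  have hσ0 : 0 < σ := by rw [hσ, sub_pos]; exact Real.exp_lt_one_iff.2 (by linarith)
  obtain ⟨δ, hδ0, hδ1, hδ2⟩ : ∃ δ : ℝ, 0 < δ ∧ δ < (b - a) / 2 ∧ C * δ ^ β ≤ σ * η := by
    have hlim : Tendsto (fun ρ : ℝ => C * ρ ^ β) (nhds 0) (nhds 0) := by
      have := (Real.continuousAt_rpow_const 0 β (Or.inr hβ.le)).tendsto.const_mul C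
      simpa [Real.zero_rpow hβ.ne'] using this
    have h1 := (hlim.eventually_lt_const (mul_pos hσ0 hη)).filter_mono
      (nhdsWithin_le_nhds (s := Ioi 0))
    have h2 : ∀ᶠ δ : ℝ in nhdsWithin 0 (Ioi 0), δ < (b - a) / 2 :=
      (eventually_lt_nhds (by linarith : (0 : ℝ) < (b - a) / 2)).filter_mono nhdsWithin_le_nhds
    obtain ⟨δ, hδ⟩ := (h1.and (h2.and self_mem_nhdsWithin)).exists
    exact ⟨δ, hδ.2.2, hδ.2.1, hδ.1.le⟩
  obtain ⟨N, hN⟩ := h.exists_uniform_time hδ0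
  refine ⟨A * δ ^ α * (1 - Real.exp (-(α * μ)))⁻¹ + t * σ * (1 - Real.exp (-(β * μ / 2)))⁻¹, N,
    fun m y hy hexp hslow => ?_⟩
  have hpos : ∀ i < m, 0 < d (T^[i] y) := fun i hi =>
    (mul_pos hη (Real.exp_pos _)).trans_le (hslow i hi)
  set r : ℕ → ℝ := fun i => δ * Real.exp (-μ * ((m : ℝ) - i)) with hr
  have hrpos : ∀ i, 0 < r i := fun i => mul_pos hδ0 (Real.exp_pos _)
  have hr0 : r 0 < (b - a) / 2 := by
    refine lt_of_le_of_lt ?_ hδ1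
    have : Real.exp (-μ * ((m : ℝ) - (0 : ℕ))) ≤ 1 := Real.exp_le_one_iff.2 (by
      have : (0 : ℝ) ≤ m := m.cast_nonneg
      push_cast; nlinarith)
    exact mul_le_of_le_one_right hδ0.le this
  have hcomp : ∀ i < m, ∀ w ∈ Icc a b, |w - T^[i] y| ≤ r i →
      |d w - d (T^[i] y)| ≤ σ * Real.exp (-(β * μ / 2) * ((m : ℝ) - i)) * d (T^[i] y) := by
    intro i hi w hw hwr
    calc |d w - d (T^[i] y)| ≤ C * |w - T^[i] y| ^ β := hhol w hw _ (h.iterate_mem hy i)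
      _ ≤ C * (r i) ^ β := by gcongr
      _ = (C * δ ^ β) * Real.exp (-(β * μ) * ((m : ℝ) - i)) := by
          rw [hr, Real.mul_rpow hδ0.le (Real.exp_pos _).le, ← Real.exp_mul, ← mul_assoc]
          congr 2; ring
      _ ≤ (σ * η) * Real.exp (-(β * μ) * ((m : ℝ) - i)) := by gcongr
      _ = σ * Real.exp (-(β * μ / 2) * ((m : ℝ) - i)) *
            (η * Real.exp (-(β * μ / 2) * ((m : ℝ) - i))) := by
          rw [show -(β * μ) * ((m : ℝ) - i) = -(β * μ / 2) * ((m : ℝ) - i) +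
            -(β * μ / 2) * ((m : ℝ) - i) by ring, Real.exp_add]
          ring
      _ ≤ _ := mul_le_mul_of_nonneg_left (hslow i hi) (by positivity)
  obtain ⟨e, he, hball, i, him, hexit⟩ := h.exists_first_exit hy m hrpos hr0
  refine ⟨e, he, ?_, ?_⟩
  · have hgrow : δ ≤ |T^[m] e - T^[m] y| := by
      have hk := h.exp_mul_le_abs_iterate_sub (μ := μ) (h.iterate_mem he i) (h.iterate_mem hy i)
        (m - i) (fun j hj => by
          rw [← Function.iterate_add_apply]; exact hpos _ (by lia)) (fun j hj w hw => by
          rw [← Function.iterate_add_apply] at hw ⊢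
          rw [← Function.iterate_add_apply] at hw
          have hwI := uIcc_subset_Icc (h.iterate_mem he _) (h.iterate_mem hy _) hw
          have hwr : |w - T^[j + i] y| ≤ r (j + i) := by
            refine le_trans ?_ (hball e right_mem_uIcc (j + i) (by lia))
            rw [abs_sub_comm w, abs_sub_comm (T^[j + i] e)]
            exact abs_sub_right_of_mem_uIcc hw
          have h1 := (abs_le.1 (hcomp (j + i) (by lia) w hwI hwr)).1
          have h2 : Real.exp (-(β * μ / 2) * ((m : ℝ) - (j + i : ℕ))) ≤ 1 :=
            Real.exp_le_one_iff.2 (by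
              have : ((j + i : ℕ) : ℝ) ≤ m := by exact_mod_cast (by lia : j + i ≤ m)
              have h3 : 0 < β * μ := mul_pos hβ hμ
              nlinarith)
          have h3 : σ * Real.exp (-(β * μ / 2) * ((m : ℝ) - (j + i : ℕ))) * d (T^[j + i] y) ≤
              σ * d (T^[j + i] y) :=
            mul_le_mul_of_nonneg_right (mul_le_of_le_one_right hσ0.le h2) (h.nonneg _)
          rw [hσ] at h3 h1
          linarith)
      rw [← Function.iterate_add_apply, ← Function.iterate_add_apply, Nat.sub_add_cancel him] at hk
      refine le_trans ?_ hk
      have hS : 2 * μ * ((m : ℝ) - i) ≤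
          birkhoffSum T (fun z => Real.log (d z)) (m - i) (T^[i] y) := by
        rcases him.eq_or_lt with rfl | hlt'
        · simp
        · exact hexp i hlt'
      calc δ = Real.exp (μ * ((m : ℝ) - i)) * r i := by
            rw [hr]
            simp only
            rw [mul_left_comm, ← Real.exp_add]
            ring_nf
            simp
        _ ≤ _ := by
            refine mul_le_mul (Real.exp_le_exp.2 ?_) hexit (hrpos i).le (Real.exp_pos _).le
            rw [Nat.cast_sub him]
            linarith
    intro w hw
    obtain ⟨v, hv, rfl⟩ := hN N le_rfl _ (h.iterate_mem hy m) _ (h.iterate_mem he m)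
      (by rwa [abs_sub_comm]) hw
    obtain ⟨u, hu, rfl⟩ := intermediate_value_uIcc (h.cont.iterate m).continuousOn hv
    exact ⟨u, hu, by rw [add_comm, Function.iterate_add_apply]⟩
  · intro z hz
    have hzI := uIcc_subset_Icc hy he hz
    have hterm : ∀ i ∈ Finset.range m,
        (Φ (T^[i] y) - t * Real.log (d (T^[i] y))) -
          (A * δ ^ α * Real.exp (-(α * μ) * ((m : ℝ) - i)) +
            t * σ * Real.exp (-(β * μ / 2) * ((m : ℝ) - i))) ≤
        Φ (T^[i] z) - t * Real.log (d (T^[i] z)) := by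
      intro i hi
      have hi := Finset.mem_range.1 hi
      have hzr := hball z hz i hi.le
      have h1 := (abs_le.1 (hΦ _ (h.iterate_mem hzI i) _ (h.iterate_mem hy i))).1
      have h2 : A * |T^[i] z - T^[i] y| ^ α ≤
          A * δ ^ α * Real.exp (-(α * μ) * ((m : ℝ) - i)) := by
        calc _ ≤ A * (r i) ^ α := by gcongr
          _ = _ := by
            rw [hr, Real.mul_rpow hδ0.le (Real.exp_pos _).le, ← Real.exp_mul, ← mul_assoc]
            congr 2; ring
      have h3 := hcomp i hi _ (h.iterate_mem hzI i) hzr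
      set s := Real.exp (-(β * μ / 2) * ((m : ℝ) - i)) with hs
      have hs1 : s ≤ 1 := Real.exp_le_one_iff.2 (by
              have : (i : ℝ) ≤ m := by exact_mod_cast hi.le
              have h3 : 0 < β * μ := mul_pos hβ hμ
              nlinarith)
      have hp := hpos i hi
      have hσs : σ * s < 1 := by
        have : σ < 1 := by rw [hσ]; linarith [Real.exp_pos (-μ)]
        nlinarith [Real.exp_pos (-(β * μ / 2) * ((m : ℝ) - i))]
      have hzpos : 0 < d (T^[i] z) := by
        nlinarith [(abs_le.1 h3).1]
      have h4 : Real.log (d (T^[i] z)) ≤ Real.log (d (T^[i] y)) + σ * s := by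
        rw [← sub_le_iff_le_add', ← Real.log_div hzpos.ne' hp.ne']
        refine (Real.log_le_sub_one_of_pos (div_pos hzpos hp)).trans ?_
        rw [sub_le_iff_le_add, div_le_iff₀ hp]
        linarith [(abs_le.1 h3).2]
      nlinarith [mul_le_mul_of_nonneg_left h4 ht]
    have hsum := Finset.sum_le_sum hterm
    rw [Finset.sum_sub_distrib, Finset.sum_add_distrib, ← Finset.mul_sum, ← Finset.mul_sum] at hsum
    have e1 := mul_le_mul_of_nonneg_left (sum_range_exp_neg_le (mul_pos hα hμ) m)
      (by positivity : 0 ≤ A * δ ^ α)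
    have e2 := mul_le_mul_of_nonneg_left (sum_range_exp_neg_le
      (by positivity : 0 < β * μ / 2) m) (by positivity : 0 ≤ t * σ)
    simp only [birkhoffSum]
    linarith

end ExactSlopeMap

/-- The number of times `1 ≤ k ≤ n` at which `B` is maximal over `{0, …, k}`. -/
def recordCount (B : ℕ → ℝ) : ℕ → ℕ
  | 0 => 0
  | n + 1 => recordCount B n + open Classical in if ∀ i < n + 1, B i ≤ B (n + 1) then 1 else 0

theorem recordCount_add_le (B : ℕ → ℝ) (n l : ℕ) :
    recordCount B (n + l) ≤ recordCount B n + l := by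
  induction l with
  | zero => rfl
  | succ l ih =>
    rw [← add_assoc, recordCount]
    split_ifs <;> lia

theorem le_mul_recordCount {B : ℕ → ℝ} {M : ℝ} (h0 : B 0 = 0)
    (hB : ∀ n, B (n + 1) ≤ B n + M) (n : ℕ) : ∀ i ≤ n, B i ≤ M * recordCount B n := by
  induction n with
  | zero => intro i hi; obtain rfl : i = 0 := by lia
            simp [h0, recordCount]
  | succ n ih =>
    intro i hi
    rw [recordCount]
    split_ifs with hrec
    · have hn := ih n le_rfl
      have : B i ≤ B (n + 1) := by
        rcases hi.eq_or_lt with rfl | hlt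
        · rfl
        · exact hrec i hlt
      push_cast
      linarith [hB n]
    · rw [add_zero]
      rcases hi.eq_or_lt with rfl | hlt
      · push Not at hrec
        obtain ⟨k, hk, hlt⟩ := hrec
        exact hlt.le.trans (ih k (by lia))
      · exact ih i (by lia)

theorem exists_record_le (B : ℕ → ℝ) (n : ℕ) :
    ∃ k ≤ n, recordCount B k = recordCount B n ∧ ∀ i < k, B i ≤ B k := by
  induction n with
  | zero => exact ⟨0, le_rfl, rfl, by simp⟩
  | succ n ih =>
    by_cases hrec : ∀ i < n + 1, B i ≤ B (n + 1)
    · exact ⟨n + 1, le_rfl, rfl, hrec⟩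
    · obtain ⟨k, hk, hc, hr⟩ := ih
      exact ⟨k, by lia, by rw [hc, recordCount, if_neg hrec, add_zero], hr⟩

/-- If `B` grows linearly while `G` decays slowly, then some long window ending at a record time of
`B` carries almost no decay of `G`. -/
theorem exists_record_window {B G : ℕ → ℝ} {M ε C : ℝ} {L N : ℕ} (hM : 0 < M) (hL : 1 ≤ L)
    (hε : 0 ≤ ε) (hB0 : B 0 = 0) (hB : ∀ n, B (n + 1) ≤ B n + M)
    (hG0 : G 0 = 0) (hG : ∀ k n, k ≤ n → G n ≤ G k + ε * ((n : ℝ) - k) + C)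
    (hN : ε * L + 2 * C + 1 + ε * N < G N + B N / (M * L)) :
    ∃ k n, k + L ≤ n ∧ (∀ i < n, B i ≤ B n) ∧ G k - 1 ≤ G n := by
  by_contra! hcon
  have hL0 : (0 : ℝ) < L := by exact_mod_cast hL
  have key : ∀ k : ℕ, (∀ i < k, B i ≤ B k) →
      G k ≤ ε * L + C + 1 - recordCount B k / L := by
    intro k
    induction k using Nat.strong_induction_on with
    | _ k ih =>
      intro hk
      rcases lt_or_ge k L with hkL | hkL
      · have h1 := hG 0 k (by lia)
        have h2 : (recordCount B k : ℝ) ≤ L := by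
          have := recordCount_add_le B 0 k
          rw [zero_add, recordCount, zero_add] at this
          exact_mod_cast this.trans hkL.le
        have h3 : (recordCount B k : ℝ) / L ≤ 1 := (div_le_one hL0).2 h2
        have h4 : ε * k ≤ ε * L := by gcongr
        rw [hG0] at h1
        push_cast at h1
        linarith
      · obtain ⟨k', hk', hc, hr⟩ := exists_record_le B (k - L)
        have h1 := ih k' (by lia) hr
        have h2 := hcon k' k (by lia) hk
        have h3 : (recordCount B k : ℝ) / L ≤ recordCount B k' / L + 1 := by
          rw [div_le_iff₀ hL0, add_mul, div_mul_cancel₀ _ hL0.ne', hc, one_mul]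
          have := recordCount_add_le B (k - L) L
          rw [Nat.sub_add_cancel hkL] at this
          exact_mod_cast this
        linarith
  obtain ⟨k, hk, hc, hr⟩ := exists_record_le B N
  have h1 := key k hr
  have h2 := hG k N hk
  have h3 : B N / (M * L) ≤ recordCount B N / L := by
    rw [div_le_div_iff₀ (by positivity) hL0]
    have := le_mul_recordCount hB0 hB N N le_rfl
    nlinarith
  have h4 : 0 ≤ ε * k := by positivity
  rw [hc] at h1
  linarith

namespace ExactSlopeMap

variable {T d : ℝ → ℝ} {a b : ℝ}

/-- The potential `Φ - t log d`, with `d` truncated from below at `e^{-j}`. -/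
def truncatedPotential (Φ d : ℝ → ℝ) (t : ℝ) (j : ℕ) (x : ℝ) : ℝ :=
  Φ x - t * Real.log (max (d x) (Real.exp (-j)))

theorem log_max_exp (j : ℕ) (x : ℝ) : -(j : ℝ) ≤ Real.log (max x (Real.exp (-j))) := by
  rw [Real.le_log_iff_exp_le (lt_max_of_lt_right (Real.exp_pos _))]
  exact le_max_right _ _

theorem log_le_log_max_exp (j : ℕ) {x : ℝ} (hx : 0 < x) :
    Real.log x ≤ Real.log (max x (Real.exp (-j))) :=
  Real.log_le_log hx (le_max_left _ _)

theorem continuous_truncatedPotential (h : ExactSlopeMap T d a b) {Φ : ℝ → ℝ} (hΦ : Continuous Φ)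
    (t : ℝ) (j : ℕ) : Continuous (truncatedPotential Φ d t j) := by
  refine hΦ.sub (continuous_const.mul (Continuous.log ?_ fun x => ?_))
  · exact h.slope_cont.max continuous_const
  · exact (lt_max_of_lt_right (Real.exp_pos _)).ne'

theorem truncated_birkhoffSum_le (h : ExactSlopeMap T d a b) (Φ : ℝ → ℝ) {t : ℝ} (ht : 0 ≤ t)
    (j m : ℕ) {z : ℝ} (hz : z ∈ Icc a b) :
    birkhoffSum T (truncatedPotential Φ d t j) m z - t * j * h.finite_crit.toFinset.card ≤
      birkhoffSum T (fun x => Φ x - t * Real.log (d x)) m z := by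
  have hterm : ∀ i ∈ Finset.range m, truncatedPotential Φ d t j (T^[i] z) ≤
      (Φ (T^[i] z) - t * Real.log (d (T^[i] z))) + if d (T^[i] z) = 0 then t * j else 0 := by
    intro i _
    unfold truncatedPotential
    split_ifs with h0
    · have := mul_le_mul_of_nonneg_left (log_max_exp j (d (T^[i] z))) ht
      rw [h0, Real.log_zero] at *
      linarith
    · have := mul_le_mul_of_nonneg_left
        (log_le_log_max_exp j (lt_of_le_of_ne (h.nonneg (T^[i] z)) (Ne.symm h0))) ht
      linarith
  have hsum := Finset.sum_le_sum hterm
  rw [Finset.sum_add_distrib, ← Finset.sum_filter, Finset.sum_const, nsmul_eq_mul] at hsum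
  have hcard : (((Finset.range m).filter (fun i => d (T^[i] z) = 0)).card : ℝ) ≤
      h.finite_crit.toFinset.card := by exact_mod_cast h.card_crit_visits_le hz m
  have := mul_le_mul_of_nonneg_right hcard (by positivity : 0 ≤ t * (j : ℝ))
  simp only [birkhoffSum]
  linarith

theorem birkhoffSum_ge_neg (h : ExactSlopeMap T d a b) {g : ℝ → ℝ} {A : ℝ}
    (hg : ∀ x ∈ Icc a b, -A ≤ g x) {z : ℝ} (hz : z ∈ Icc a b) (n : ℕ) :
    -(n * A) ≤ birkhoffSum T g n z := by
  have := Finset.card_nsmul_le_sum (Finset.range n) (fun i => g (T^[i] z)) (-A)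
    fun i _ => hg _ (h.iterate_mem hz i)
  simp only [Finset.card_range, nsmul_eq_mul] at this
  simp only [birkhoffSum]
  linarith

theorem birkhoffSum_le (h : ExactSlopeMap T d a b) {g : ℝ → ℝ} {A : ℝ}
    (hg : ∀ x ∈ Icc a b, g x ≤ A) {z : ℝ} (hz : z ∈ Icc a b) (n : ℕ) :
    birkhoffSum T g n z ≤ n * A := by
  have := Finset.sum_le_card_nsmul (Finset.range n) (fun i => g (T^[i] z)) A
    fun i _ => hg _ (h.iterate_mem hz i)
  simpa [birkhoffSum] using this

theorem exists_potential_lower_bound (h : ExactSlopeMap T d a b) {Φ : ℝ → ℝ} (hΦ : Continuous Φ)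
    {t : ℝ} (ht : 0 ≤ t) :
    ∃ A : ℝ, 0 ≤ A ∧ ∀ x ∈ Icc a b, -A ≤ Φ x - t * Real.log (d x) := by
  obtain ⟨K, hK1, hK⟩ := h.exists_slope_bound
  obtain ⟨A, hA⟩ := (isCompact_Icc (a := a) (b := b)).exists_bound_of_continuousOn hΦ.continuousOn
  have hlog := Real.log_nonneg hK1
  have hA0 : 0 ≤ A := (norm_nonneg _).trans (hA a (left_mem_Icc.2 h.lt.le))
  refine ⟨A + t * Real.log K, by positivity, fun x hx => ?_⟩
  have h1 : Real.log (d x) ≤ Real.log K := by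
    rcases (h.nonneg x).eq_or_lt with h0 | h0
    · rwa [← h0, Real.log_zero]
    · exact Real.log_le_log h0 (hK x hx)
  have h2 := (abs_le.1 (hA x hx)).1
  nlinarith [mul_le_mul_of_nonneg_left h1 ht]

/-- If the truncated Birkhoff sums grow linearly along some orbit segments, these segments have
neighbourhoods covering `[a, b]`. -/
theorem exists_covering_of_growth (h : ExactSlopeMap T d a b) {Φ : ℝ → ℝ} (hΦ : Continuous Φ)
    {t : ℝ} (ht : 0 ≤ t) {j : ℕ} {ε : ℝ} (hε : 0 < ε)
    (hgrow : ∀ C : ℝ, ∃ m : ℕ, ∃ y ∈ Icc a b,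
      ε * m + C < birkhoffSum T (truncatedPotential Φ d t j) m y) :
    ∃ D : ℝ, ∀ L : ℕ, ∃ m ≥ L, ∃ y ∈ Icc a b, ∃ e ∈ Icc a b,
      SurjOn T^[m] (uIcc y e) (Icc a b) ∧
      ∀ z ∈ uIcc y e, -D ≤ birkhoffSum T (fun x => Φ x - t * Real.log (d x)) m z := by
  have hlt := h.lt
  have hg := h.continuous_truncatedPotential hΦ t j
  set g := truncatedPotential Φ d t j with hgdef
  obtain ⟨δ₁, hδ₁, hunif⟩ := Metric.uniformContinuousOn_iff.1
    ((isCompact_Icc (a := a) (b := b)).uniformContinuousOn_of_continuous hg.continuousOn) ε hε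
  set δ := min (δ₁ / 2) ((b - a) / 4) with hδ
  have hδ0 : 0 < δ := lt_min (by positivity) (by linarith)
  have hδ2 : δ < (b - a) / 2 := (min_le_right _ _).trans_lt (by linarith)
  have hδ3 : δ < δ₁ := (min_le_left _ _).trans_lt (by linarith)
  obtain ⟨N, hN⟩ := h.exists_uniform_time hδ0
  obtain ⟨A, hA0, hA⟩ := h.exists_potential_lower_bound hΦ ht
  obtain ⟨G, hG⟩ := (isCompact_Icc (a := a) (b := b)).exists_bound_of_continuousOn hg.continuousOn
  have hG0 : 0 ≤ G := (norm_nonneg _).trans (hG a (left_mem_Icc.2 hlt.le))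
  refine ⟨t * j * h.finite_crit.toFinset.card + N * A, fun L => ?_⟩
  obtain ⟨m, y, hy, hm⟩ := hgrow (G * L)
  have hmL : L ≤ m := by
    by_contra! hlt'
    have h1 := h.birkhoffSum_le (fun x hx => (abs_le.1 (hG x hx)).2) hy m
    have h2 : (m : ℝ) ≤ L := by exact_mod_cast hlt'.le
    nlinarith [mul_le_mul_of_nonneg_right h2 hG0, (Nat.cast_nonneg m : (0 : ℝ) ≤ m)]
  obtain ⟨e, he, hball, i, him, hexit⟩ :=
    h.exists_first_exit hy m (r := fun _ => δ) (fun _ => hδ0) hδ2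
  refine ⟨m + N, by lia, y, hy, e, he, ?_, fun z hz => ?_⟩
  · intro w hw
    obtain ⟨v, hv, rfl⟩ := hN (m - i + N) (by lia) _ (h.iterate_mem hy i) _ (h.iterate_mem he i)
      (by rwa [abs_sub_comm]) hw
    obtain ⟨u, hu, rfl⟩ := intermediate_value_uIcc (h.cont.iterate i).continuousOn hv
    exact ⟨u, hu, by
      rw [← Function.iterate_add_apply, show m - i + N + i = m + N by lia]⟩
  · have hzI := uIcc_subset_Icc hy he hz
    have hterm : ∀ i ∈ Finset.range m, g (T^[i] y) ≤ g (T^[i] z) + ε := by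
      intro i hi
      have := hunif _ (h.iterate_mem hzI i) _ (h.iterate_mem hy i) (by
        rw [Real.dist_eq]; exact (hball z hz i (Finset.mem_range.1 hi).le).trans_lt hδ3)
      rw [Real.dist_eq] at this
      linarith [(abs_lt.1 this).1]
    have hsum := Finset.sum_le_sum hterm
    rw [Finset.sum_add_distrib, Finset.sum_const, Finset.card_range, nsmul_eq_mul] at hsum
    have h1 := h.truncated_birkhoffSum_le Φ ht j m hzI
    have h2 := h.birkhoffSum_ge_neg hA (h.iterate_mem hzI m) N
    rw [birkhoffSum_add]
    simp only [birkhoffSum, ← hgdef] at h1 h2 hm ⊢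
    have : 0 ≤ G * L := by positivity
    linarith

end ExactSlopeMap

theorem _root_.MeasureTheory.MeasurePreserving.integrable_birkhoffSum {X : Type*}
    [MeasurableSpace X] {ν : Measure X} {T : X → X} (hT : MeasurePreserving T ν ν) {u : X → ℝ}
    (hu : Integrable u ν) (n : ℕ) : Integrable (birkhoffSum T u n) ν :=
  integrable_finsetSum _ fun i _ => (hT.iterate i).integrable_comp_of_integrable hu

theorem _root_.MeasureTheory.MeasurePreserving.integral_birkhoffSum {X : Type*}
    [MeasurableSpace X] {ν : Measure X} {T : X → X} (hT : MeasurePreserving T ν ν) {u : X → ℝ}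
    (hu : Integrable u ν) (n : ℕ) : ∫ x, birkhoffSum T u n x ∂ν = n * ∫ x, u x ∂ν := by
  have hi : ∀ i, ∫ x, u (T^[i] x) ∂ν = ∫ x, u x ∂ν := fun i => by
    conv_rhs => rw [← (hT.iterate i).map_eq]
    rw [integral_map (hT.iterate i).measurable.aemeasurable]
    rw [(hT.iterate i).map_eq]
    exact hu.aestronglyMeasurable
  simp only [birkhoffSum]
  rw [integral_finsetSum (f := fun i x => u (T^[i] x)) _ fun i _ => (hT.iterate i).integrable_comp_of_integrable hu]
  simp [hi]

namespace ExactSlopeMap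

variable {T d : ℝ → ℝ} {a b : ℝ}

/-- An invariant probability measure does not charge the critical set. -/
theorem measure_crit_eq_zero (h : ExactSlopeMap T d a b) {ν : Measure ℝ} [IsProbabilityMeasure ν]
    (hT : MeasurePreserving T ν ν) (hI : ∀ᵐ x ∂ν, x ∈ Icc a b) : ∀ᵐ x ∂ν, 0 < d x := by
  have hA : MeasurableSet {x | d x = 0} := (isClosed_eq h.slope_cont continuous_const).measurableSet
  have hu : Integrable ({x | d x = 0}.indicator fun _ => (1 : ℝ)) ν :=
    (integrable_const 1).indicator hA
  have hle : ∀ n : ℕ, n * ν.real {x | d x = 0} ≤ h.finite_crit.toFinset.card := by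
    intro n
    have h1 := hT.integral_birkhoffSum hu n
    rw [integral_indicator_const _ hA, smul_eq_mul, mul_one] at h1
    rw [← h1]
    have h2 : ∫ _ : ℝ, (h.finite_crit.toFinset.card : ℝ) ∂ν = h.finite_crit.toFinset.card := by simp
    rw [← h2]
    refine integral_mono_ae (hT.integrable_birkhoffSum hu n) (integrable_const _) ?_
    filter_upwards [hI] with x hx
    have := h.card_crit_visits_le hx n
    simp only [birkhoffSum, indicator_apply, mem_ofPred_eq, Finset.sum_boole]
    exact_mod_cast this
  have h0 : ν.real {x | d x = 0} = 0 := by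
    by_contra hne
    have hpos : 0 < ν.real {x | d x = 0} := lt_of_le_of_ne measureReal_nonneg (Ne.symm hne)
    obtain ⟨n, hn⟩ := exists_nat_gt ((h.finite_crit.toFinset.card : ℝ) / ν.real {x | d x = 0})
    rw [div_lt_iff₀ hpos] at hn
    exact absurd (hle n) hn.not_ge
  rw [measureReal_eq_zero_iff] at h0
  filter_upwards [measure_eq_zero_iff_ae_notMem.1 h0] with x hx
  exact lt_of_le_of_ne (h.nonneg x) (Ne.symm hx)

/-- The error made by truncating `log d` at `e^{-j}`. -/
def truncationGap (d : ℝ → ℝ) (j : ℕ) (x : ℝ) : ℝ :=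
  Real.log (max (d x) (Real.exp (-j))) - Real.log (d x)

theorem truncationGap_nonneg (j : ℕ) {x : ℝ} (hx : 0 < d x) : 0 ≤ truncationGap d j x :=
  sub_nonneg.2 (log_le_log_max_exp j hx)

theorem abs_truncationGap_le (j : ℕ) {x : ℝ} (hx : 0 < d x) :
    |truncationGap d j x| ≤ |Real.log (d x)| := by
  rw [abs_of_nonneg (truncationGap_nonneg j hx), truncationGap]
  rcases le_total (d x) (Real.exp (-j)) with hle | hle
  · rw [max_eq_right hle, Real.log_exp]
    have : (0 : ℝ) ≤ j := j.cast_nonneg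
    linarith [neg_le_abs (Real.log (d x))]
  · rw [max_eq_left hle, sub_self]
    exact abs_nonneg _

theorem measurable_truncationGap (h : ExactSlopeMap T d a b) (j : ℕ) :
    Measurable (truncationGap d j) :=
  ((h.slope_cont.max continuous_const).measurable.log).sub h.slope_cont.measurable.log

theorem integrable_truncationGap (h : ExactSlopeMap T d a b) {ν : Measure ℝ}
    (hpos : ∀ᵐ x ∂ν, 0 < d x) (hint : Integrable (fun x => Real.log (d x)) ν) (j : ℕ) :
    Integrable (truncationGap d j) ν :=
  hint.mono (h.measurable_truncationGap j).aestronglyMeasurable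
    (hpos.mono fun _ hx => abs_truncationGap_le j hx)

theorem tendsto_integral_truncationGap (h : ExactSlopeMap T d a b) {ν : Measure ℝ}
    (hpos : ∀ᵐ x ∂ν, 0 < d x) (hint : Integrable (fun x => Real.log (d x)) ν) :
    Tendsto (fun j => ∫ x, truncationGap d j x ∂ν) atTop (nhds 0) := by
  rw [← integral_zero ℝ ℝ (μ := ν)]
  refine tendsto_integral_of_dominated_convergence (fun x => |Real.log (d x)|)
    (fun j => (h.measurable_truncationGap j).aestronglyMeasurable) hint.abs
    (fun j => hpos.mono fun _ hx => abs_truncationGap_le j hx) (hpos.mono fun x hx => ?_)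
  refine tendsto_const_nhds.congr' ?_
  have hlim : Tendsto (fun j : ℕ => Real.exp (-(j : ℝ))) atTop (nhds 0) :=
    Real.tendsto_exp_neg_atTop_nhds_zero.comp tendsto_natCast_atTop_atTop
  filter_upwards [hlim.eventually_lt_const hx] with j hj
  rw [truncationGap, max_eq_left hj.le, sub_self]

theorem truncatedPotential_eq (Φ d : ℝ → ℝ) (t : ℝ) (j : ℕ) (x : ℝ) :
    truncatedPotential Φ d t j x = Φ x - t * Real.log (d x) - t * truncationGap d j x := by
  unfold truncatedPotential truncationGap
  ring

/-- Suppose the truncated Birkhoff sums of a zero-mean potential have no linear growth. Then some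
long orbit segment, all of whose terminal subsegments are expanding on average, carries almost no
decay of the potential. -/
theorem exists_hyperbolic_segment (h : ExactSlopeMap T d a b) {Φ : ℝ → ℝ}
    {t : ℝ} (ht : 0 ≤ t) {ν : Measure ℝ} [IsProbabilityMeasure ν]
    (hT : MeasurePreserving T ν ν) (hI : ∀ᵐ x ∂ν, x ∈ Icc a b)
    (hint : Integrable (fun x => Real.log (d x)) ν)
    (hgint : Integrable (fun x => Φ x - t * Real.log (d x)) ν)
    (hg0 : ∫ x, (Φ x - t * Real.log (d x)) ∂ν = 0)
    (hslow : ∀ j : ℕ, ∀ ε > 0, ∃ C : ℝ, ∀ m : ℕ, ∀ y ∈ Icc a b,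
      birkhoffSum T (truncatedPotential Φ d t j) m y ≤ ε * m + C)
    {H : ℝ → ℝ} (hH : Integrable H ν) {χ M : ℝ} (hχ : 0 < χ) (hχM : χ ≤ M)
    (hHM : ∀ x ∈ Icc a b, 0 < d x → H x ≤ M) (hHχ : χ / 2 ≤ ∫ x, H x ∂ν) (L : ℕ) (hL : 1 ≤ L) :
    ∃ m ≥ L, ∃ y ∈ Icc a b, (∀ i, 0 < d (T^[i] y)) ∧
      (∀ i < m, χ / 8 * ((m : ℝ) - i) ≤ birkhoffSum T H (m - i) (T^[i] y)) ∧
      -1 ≤ birkhoffSum T (fun x => Φ x - t * Real.log (d x)) m y := by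
  have hM : 0 < M := hχ.trans_le hχM
  have hL0 : (0 : ℝ) < L := by exact_mod_cast hL
  have hpos := h.measure_crit_eq_zero hT hI
  set s : ℝ := χ / (16 * M * L) with hs
  set Λ : ℝ := M / s with hΛ
  have hs0 : 0 < s := by positivity
  have hΛ0 : 0 < Λ := by positivity
  set ε : ℝ := χ / (16 * Λ) with hε
  have hε0 : 0 < ε := by positivity
  have hεs : 2 * ε ≤ s := by
    have : 2 * ε = χ / M * s / 8 := by rw [hε, hΛ]; field_simp; norm_num
    rw [this]
    have : χ / M ≤ 1 := (div_le_one hM).2 hχM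
    nlinarith
  obtain ⟨j, hj⟩ : ∃ j : ℕ, -ε ≤ ∫ x, truncatedPotential Φ d t j x ∂ν := by
    have hlim := (h.tendsto_integral_truncationGap hpos hint).const_mul (-t)
    rw [mul_zero] at hlim
    obtain ⟨j, hj⟩ := (hlim.eventually_const_lt (neg_lt_zero.2 hε0)).exists
    refine ⟨j, ?_⟩
    simp only [truncatedPotential_eq]
    rw [integral_sub hgint ((h.integrable_truncationGap hpos hint j).const_mul t), hg0,
      integral_const_mul]
    linarith
  have hgj : Integrable (truncatedPotential Φ d t j) ν :=
    (hgint.sub ((h.integrable_truncationGap hpos hint j).const_mul t)).congr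
      (Eventually.of_forall fun x => (truncatedPotential_eq Φ d t j x).symm)
  obtain ⟨C₀, hC₀⟩ := hslow j ε hε0
  set C := max C₀ 0 with hC
  have hC0 : 0 ≤ C := le_max_right _ _
  have hsum : ∀ m : ℕ, ∀ y ∈ Icc a b,
      birkhoffSum T (truncatedPotential Φ d t j) m y ≤ ε * m + C := fun m y hy =>
    (hC₀ m y hy).trans (by linarith [le_max_left C₀ 0])
  obtain ⟨N, hN⟩ := exists_nat_gt ((ε * L + 2 * C + 1 + Λ * C / (M * L)) / s)
  rw [div_lt_iff₀ hs0] at hN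
  have hΨ : Integrable (fun x => birkhoffSum T H N x +
      Λ * birkhoffSum T (truncatedPotential Φ d t j) N x) ν :=
    (hT.integrable_birkhoffSum hH N).add ((hT.integrable_birkhoffSum hgj N).const_mul Λ)
  have hgood : ∀ᵐ x ∂ν, x ∈ Icc a b ∧ ∀ i, 0 < d (T^[i] x) :=
    hI.and (ae_all_iff.2 fun i => (hT.iterate i).quasiMeasurePreserving.ae hpos)
  obtain ⟨x, hxgood, hx⟩ := exists_notMem_null_integral_le hΨ hgood
  obtain ⟨hxI, hxpos⟩ : x ∈ Icc a b ∧ ∀ i, 0 < d (T^[i] x) := not_not.1 hxgood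
  rw [integral_add (hT.integrable_birkhoffSum hH N)
    ((hT.integrable_birkhoffSum hgj N).const_mul Λ), integral_const_mul,
    hT.integral_birkhoffSum hH, hT.integral_birkhoffSum hgj] at hx
  set B : ℕ → ℝ := fun n => birkhoffSum T H n x - χ / 8 * n with hB
  set G : ℕ → ℝ := fun n => birkhoffSum T (truncatedPotential Φ d t j) n x with hG
  have hwin : ∀ (u : ℝ → ℝ) (k n : ℕ), k ≤ n → birkhoffSum T u n x =
      birkhoffSum T u k x + birkhoffSum T u (n - k) (T^[k] x) := fun u k n hkn => by
    rw [← birkhoffSum_add, Nat.add_sub_cancel' hkn]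
  have hstep : ∀ n, B (n + 1) ≤ B n + M := fun n => by
    simp only [hB, birkhoffSum_succ]
    push_cast
    linarith [hHM _ (h.iterate_mem hxI n) (hxpos n)]
  have hNlt : ε * L + 2 * C + 1 + ε * N < G N + B N / (M * L) := by
    have hN0 : (0 : ℝ) ≤ N := N.cast_nonneg
    have hGN : G N ≤ ε * N + C := hsum N x hxI
    have hHN : birkhoffSum T H N x ≤ N * M := by
      have := Finset.sum_le_card_nsmul (Finset.range N) (fun i => H (T^[i] x)) M
        fun i _ => hHM _ (h.iterate_mem hxI i) (hxpos i)
      simpa [birkhoffSum] using this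
    have hmean : N * (χ / 2) - Λ * (N * ε) ≤
        birkhoffSum T H N x + Λ * G N := by
      refine le_trans ?_ hx
      have h1 := mul_le_mul_of_nonneg_left hHχ hN0
      have h2 := mul_le_mul_of_nonneg_left (mul_le_mul_of_nonneg_left hj hN0) hΛ0.le
      linarith
    have hΛε : Λ * ε = χ / 16 := by rw [hε]; field_simp
    have hBN : N * (χ / 4) - Λ * C ≤ B N := by
      have := mul_le_mul_of_nonneg_left hGN hΛ0.le
      have e1 : Λ * (ε * N + C) = χ / 16 * N + Λ * C := by rw [← hΛε]; ring
      have e2 : Λ * (N * ε) = χ / 16 * N := by rw [← hΛε]; ring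
      simp only [hB]
      linarith
    have hGN' : -(N * (s + ε)) ≤ G N := by
      have e1 : Λ * -(N * (s + ε)) = -(N * M) - Λ * (N * ε) := by
        have : Λ * s = M := by rw [hΛ]; field_simp
        rw [← this]; ring
      refine le_of_mul_le_mul_left ?_ hΛ0
      rw [e1]
      nlinarith
    have hdiv : (N * (χ / 4) - Λ * C) / (M * L) ≤ B N / (M * L) := by gcongr
    have e3 : (N * (χ / 4) - Λ * C) / (M * L) = N * (4 * s) - Λ * C / (M * L) := by
      rw [hs]; field_simp; ring
    have h6 : 0 ≤ N * s := by positivity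
    have h5 : N * (2 * ε) ≤ N * s := by gcongr
    linarith
  obtain ⟨k, n, hkn, hrec, hwindow⟩ := exists_record_window hM hL hε0.le (by simp [hB]) hstep
    (by simp [hG]) (fun k n hkn => by
      have := hsum (n - k) _ (h.iterate_mem hxI k)
      rw [Nat.cast_sub hkn] at this
      simp only [hG]
      rw [hwin _ k n hkn]
      linarith) hNlt
  refine ⟨n - k, by lia, T^[k] x, h.iterate_mem hxI k, fun i => ?_, fun i hi => ?_, ?_⟩
  · rw [← Function.iterate_add_apply]; exact hxpos _
  · have := hrec (i + k) (by lia)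
    simp only [hB] at this
    rw [hwin _ (i + k) n (by lia)] at this
    rw [← Function.iterate_add_apply, show n - k - i = n - (i + k) by lia, Nat.cast_sub (by lia)]
    push_cast at this
    linarith
  · have h1 : birkhoffSum T (truncatedPotential Φ d t j) (n - k) (T^[k] x) ≤
        birkhoffSum T (fun x => Φ x - t * Real.log (d x)) (n - k) (T^[k] x) := by
      refine Finset.sum_le_sum fun i _ => ?_
      rw [truncatedPotential_eq, ← Function.iterate_add_apply]
      have := mul_nonneg ht (truncationGap_nonneg j (hxpos (i + k)))
      linarith
    simp only [hG] at hwindow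
    rw [hwin _ k n (by lia)] at hwindow
    linarith

/-- A zero-mean potential has long orbit segments, covering `[a, b]` with bounded loss of Birkhoff
sums. -/
theorem exists_covering (h : ExactSlopeMap T d a b) {Φ : ℝ → ℝ} (hΦ : Continuous Φ)
    (hΦH : HolderOn Φ (Icc a b)) {t : ℝ} (ht : 0 ≤ t) {ν : Measure ℝ} [IsProbabilityMeasure ν]
    (hT : MeasurePreserving T ν ν) (hI : ∀ᵐ x ∂ν, x ∈ Icc a b)
    (hχ : 0 < ∫ x, Real.log (d x) ∂ν)
    (hgint : Integrable (fun x => Φ x - t * Real.log (d x)) ν)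
    (hg0 : ∫ x, (Φ x - t * Real.log (d x)) ∂ν = 0) :
    ∃ D : ℝ, ∀ L : ℕ, ∃ m ≥ L, ∃ y ∈ Icc a b, ∃ e ∈ Icc a b,
      SurjOn T^[m] (uIcc y e) (Icc a b) ∧
      ∀ z ∈ uIcc y e, -D ≤ birkhoffSum T (fun x => Φ x - t * Real.log (d x)) m z := by
  by_cases hslow : ∀ j : ℕ, ∀ ε > 0, ∃ C : ℝ, ∀ m : ℕ, ∀ y ∈ Icc a b,
      birkhoffSum T (truncatedPotential Φ d t j) m y ≤ ε * m + C
  swap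
  · push Not at hslow
    obtain ⟨j, ε, hε, hgrow⟩ := hslow
    exact h.exists_covering_of_growth hΦ ht hε hgrow
  have hint : Integrable (fun x => Real.log (d x)) ν := by
    by_contra hn
    rw [integral_undef hn] at hχ
    exact hχ.false
  have hpos := h.measure_crit_eq_zero hT hI
  obtain ⟨C, β, hC, hβ, hhol⟩ := h.holder
  obtain ⟨K, hK1, hK⟩ := h.exists_slope_bound
  set χ := ∫ x, Real.log (d x) ∂ν
  set M := max (Real.log K) χ with hM
  have hM0 : 0 < M := hχ.trans_le (le_max_right _ _)
  set κ := β * (χ / 16) / 2 with hκ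
  have hκ0 : 0 < κ := by positivity
  have hlogM : ∀ x ∈ Icc a b, 0 < d x → Real.log (d x) ≤ M := fun x hx h0 =>
    (Real.log_le_log h0 (hK x hx)).trans (le_max_left _ _)
  obtain ⟨j, hj⟩ : ∃ j : ℕ, M / κ * ∫ x, truncationGap d j x ∂ν ≤ χ / 2 := by
    have hlim := (h.tendsto_integral_truncationGap hpos hint).const_mul (M / κ)
    rw [mul_zero] at hlim
    obtain ⟨j, hj⟩ := (hlim.eventually_lt_const (half_pos hχ)).exists
    exact ⟨j, hj.le⟩
  have hq := h.integrable_truncationGap hpos hint j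
  set H : ℝ → ℝ := fun x => Real.log (d x) - M / κ * truncationGap d j x with hH
  have hHle : ∀ x, 0 < d x → H x ≤ Real.log (d x) := fun x hx => by
    have := mul_nonneg (div_pos hM0 hκ0).le (truncationGap_nonneg j hx)
    simp only [hH]
    linarith
  have hHint : Integrable H ν := hint.sub (hq.const_mul _)
  have hHχ : χ / 2 ≤ ∫ x, H x ∂ν := by
    rw [integral_sub hint (hq.const_mul _), integral_const_mul]
    linarith
  obtain ⟨D, N, hDN⟩ := h.exists_covering_of_hyperbolic hC hβ hhol hΦH ht
    (μ := χ / 16) (by positivity) (Real.exp_pos (-(j : ℝ)))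
  obtain ⟨A, hA0, hA⟩ := h.exists_potential_lower_bound hΦ ht
  refine ⟨1 + D + N * A, fun L => ?_⟩
  obtain ⟨m, hmL, y, hy, hypos, hhyp, hsum⟩ := h.exists_hyperbolic_segment ht hT hI hint hgint hg0
    hslow hHint hχ (le_max_right _ _) (fun x hx h0 => (hHle x h0).trans (hlogM x hx h0)) hHχ
    (max L 1) (le_max_right _ _)
  have hexp : ∀ i < m, 2 * (χ / 16) * ((m : ℝ) - i) ≤
      birkhoffSum T (fun z => Real.log (d z)) (m - i) (T^[i] y) := by
    intro i hi
    have h1 := hhyp i hi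
    have h2 : birkhoffSum T H (m - i) (T^[i] y) ≤
        birkhoffSum T (fun z => Real.log (d z)) (m - i) (T^[i] y) :=
      Finset.sum_le_sum fun l _ => hHle _ (by rw [← Function.iterate_add_apply]; exact hypos _)
    linarith
  have hrec : ∀ i < m, Real.exp (-(j : ℝ)) * Real.exp (-κ * ((m : ℝ) - i)) ≤ d (T^[i] y) := by
    intro i hi
    have h1 := hhyp i hi
    have hcast : ((m - i : ℕ) : ℝ) = (m : ℝ) - i := Nat.cast_sub hi.le
    have hmi : (0 : ℝ) < (m : ℝ) - i := by rw [← hcast]; exact_mod_cast (by lia : 0 < m - i)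
    have h2 : birkhoffSum T H (m - i) (T^[i] y) ≤
        ((m : ℝ) - i) * M - M / κ * truncationGap d j (T^[i] y) := by
      have e1 : birkhoffSum T H (m - i) (T^[i] y) =
          birkhoffSum T (fun z => Real.log (d z)) (m - i) (T^[i] y) -
            M / κ * birkhoffSum T (truncationGap d j) (m - i) (T^[i] y) := by
        simp only [birkhoffSum, hH, Finset.sum_sub_distrib, Finset.mul_sum]
      have e2 := Finset.sum_le_card_nsmul (Finset.range (m - i))
        (fun l => Real.log (d (T^[l] (T^[i] y)))) M fun l _ => by
          rw [← Function.iterate_add_apply]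
          exact hlogM _ (h.iterate_mem hy _) (hypos _)
      rw [Finset.card_range, nsmul_eq_mul, hcast] at e2
      have e3 : truncationGap d j (T^[i] y) ≤
          birkhoffSum T (truncationGap d j) (m - i) (T^[i] y) :=
        Finset.single_le_sum (f := fun l => truncationGap d j (T^[l] (T^[i] y))) (fun l _ => by
          rw [← Function.iterate_add_apply]
          exact truncationGap_nonneg j (hypos _)) (Finset.mem_range.2 (by lia : 0 < m - i))
      rw [e1]
      have e4 := mul_le_mul_of_nonneg_left e3 (div_pos hM0 hκ0).le
      simp only [birkhoffSum] at e2 e4 ⊢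
      linarith
    have h3 : truncationGap d j (T^[i] y) ≤ κ * ((m : ℝ) - i) := by
      have h4 : 0 ≤ χ / 8 * ((m : ℝ) - i) := by positivity
      have h5 : M / κ * truncationGap d j (T^[i] y) ≤ M / κ * (κ * ((m : ℝ) - i)) := by
        have : M / κ * (κ * ((m : ℝ) - i)) = ((m : ℝ) - i) * M := by field_simp
        linarith
      exact le_of_mul_le_mul_left h5 (div_pos hM0 hκ0)
    rw [← Real.exp_add, ← Real.le_log_iff_exp_le (hypos i)]
    have h6 := log_max_exp j (d (T^[i] y))
    unfold truncationGap at h3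
    linarith
  obtain ⟨e, he, hsurj, hdist⟩ := hDN m y hy hexp hrec
  refine ⟨m + N, by lia, y, hy, e, he, hsurj, fun z hz => ?_⟩
  have hzI := uIcc_subset_Icc hy he hz
  have h1 := h.birkhoffSum_ge_neg hA (h.iterate_mem hzI m) N
  have h2 := hdist z hz
  rw [birkhoffSum_add]
  linarith

end ExactSlopeMap

/-- A continuous real function whose values cover `[p, q]` maps some subinterval exactly onto
`[p, q]`. -/
theorem exists_uIcc_image_eq_Icc {F : ℝ → ℝ} (hF : Continuous F) {u v p q : ℝ} (hpq : p ≤ q)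
    (hcov : Icc p q ⊆ F '' uIcc u v) :
    ∃ s t, uIcc s t ⊆ uIcc u v ∧ F '' uIcc s t = Icc p q := by
  obtain ⟨s₀, hs₀, hFs⟩ := hcov (left_mem_Icc.2 hpq)
  obtain ⟨t₀, ht₀, hFt⟩ := hcov (right_mem_Icc.2 hpq)
  set γ : ℝ → ℝ := fun τ => s₀ + τ * (t₀ - s₀) with hγ
  have hγc : Continuous γ := by fun_prop
  have hG : Continuous (F ∘ γ) := hF.comp hγc
  have hG0 : (F ∘ γ) 0 = p := by simp [hγ, hFs]
  have hG1 : (F ∘ γ) 1 = q := by simp [hγ, hFt]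
  obtain ⟨τ, ⟨hτ, hGτ⟩, hτmin⟩ := (isCompact_Icc.inter_right
    (isClosed_eq hG continuous_const)).exists_isLeast
    (⟨1, by simp, hG1⟩ : (Icc (0 : ℝ) 1 ∩ {τ | (F ∘ γ) τ = q}).Nonempty)
  obtain ⟨σ, ⟨hσ, hGσ⟩, hσmax⟩ := (isCompact_Icc.inter_right
    (isClosed_eq hG continuous_const)).exists_isGreatest
    (⟨0, ⟨le_rfl, hτ.1⟩, hG0⟩ : (Icc (0 : ℝ) τ ∩ {σ | (F ∘ γ) σ = p}).Nonempty)
  have hGσ : F (γ σ) = p := hGσ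
  have hGτ : F (γ τ) = q := hGτ
  have hγmem : ∀ ρ ∈ Icc (0 : ℝ) 1, γ ρ ∈ uIcc s₀ t₀ := by
    intro ρ hρ
    rw [mem_uIcc]
    rcases le_total s₀ t₀ with hle | hle
    · left; constructor <;> simp only [hγ] <;> nlinarith [hρ.1, hρ.2]
    · right; constructor <;> simp only [hγ] <;> nlinarith [hρ.1, hρ.2]
  refine ⟨γ σ, γ τ, ?_, Subset.antisymm ?_ ?_⟩
  · exact (uIcc_subset_uIcc (hγmem σ ⟨hσ.1, hσ.2.trans hτ.2⟩) (hγmem τ hτ)).trans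
      (uIcc_subset_uIcc hs₀ ht₀)
  · rintro _ ⟨w, hw, rfl⟩
    obtain ⟨ρ, hρ, rfl⟩ := intermediate_value_uIcc hγc.continuousOn hw
    rw [uIcc_of_le hσ.2] at hρ
    constructor
    · by_contra! hlt
      obtain ⟨ρ', hρ', he⟩ := intermediate_value_Icc hρ.2 hG.continuousOn
        (⟨hlt.le, by rw [Function.comp, hGτ]; exact hpq⟩ : p ∈ Icc ((F ∘ γ) ρ) ((F ∘ γ) τ))
      have h1 : ρ' ≤ σ := hσmax ⟨⟨hσ.1.trans (hρ.1.trans hρ'.1), hρ'.2⟩, he⟩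
      have h2 : ρ = σ := le_antisymm (hρ'.1.trans h1) hρ.1
      rw [h2, hGσ] at hlt
      exact hlt.false
    · by_contra! hlt
      obtain ⟨ρ', hρ', he⟩ := intermediate_value_Icc hρ.1 hG.continuousOn
        (⟨by rw [Function.comp, hGσ]; exact hpq, hlt.le⟩ : q ∈ Icc ((F ∘ γ) σ) ((F ∘ γ) ρ))
      have h1 : τ ≤ ρ' := hτmin ⟨⟨hσ.1.trans hρ'.1, hρ'.2.trans (hρ.2.trans hτ.2)⟩, he⟩
      have h2 : ρ = τ := le_antisymm hρ.2 (h1.trans hρ'.2)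
      rw [h2, hGτ] at hlt
      exact hlt.false
  · have := intermediate_value_uIcc (a := γ σ) (b := γ τ) hF.continuousOn
    rwa [hGσ, hGτ, uIcc_of_le hpq] at this

theorem IsClosed.isClosed_connectedComponentIn {X : Type*} [TopologicalSpace X] {F : Set X}
    (hF : IsClosed F) (x : X) : IsClosed (connectedComponentIn F x) := by
  by_cases hx : x ∈ F
  · refine isClosed_of_closure_subset ?_
    exact isPreconnected_connectedComponentIn.closure.subset_connectedComponentIn
      (subset_closure (mem_connectedComponentIn hx))
      (closure_minimal (connectedComponentIn_subset F x) hF)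
  · rw [connectedComponentIn_eq_empty hx]
    exact isClosed_empty

/-- A pull-back component trapped between two points `u`, `v` mapped outside `[e, c]`, and
containing a point mapped to the extreme point `e`, is mapped onto `[e, c]`. -/
theorem connectedComponentIn_trapped {G : ℝ → ℝ} (hG : Continuous G) {I : Set ℝ}
    [hIc : OrdConnected I]
    (hGI : ∀ x ∈ I, G x ∈ I) {e c : ℝ} (hside : ∀ w ∈ I, w ∉ uIcc e c → c ∈ uIcc e w)
    {u v x : ℝ} (hu : u ∈ I) (hv : v ∈ I) (hx : x ∈ uIcc u v) (hGu : G u ∉ uIcc e c)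
    (hGv : G v ∉ uIcc e c) (hGx : G x = e) :
    x ∈ connectedComponentIn (G ⁻¹' uIcc e c ∩ I) x ∧
    connectedComponentIn (G ⁻¹' uIcc e c ∩ I) x ⊆ uIcc u v ∧
    G '' connectedComponentIn (G ⁻¹' uIcc e c ∩ I) x = uIcc e c := by
  set W := connectedComponentIn (G ⁻¹' uIcc e c ∩ I) x with hW
  have huv : uIcc u v ⊆ I := hIc.uIcc_subset hu hv
  have hxW : x ∈ W := mem_connectedComponentIn ⟨by simp [hGx], huv hx⟩
  have hWsub : W ⊆ G ⁻¹' uIcc e c ∩ I := connectedComponentIn_subset _ _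
  have hord : OrdConnected W := isPreconnected_connectedComponentIn.ordConnected
  refine ⟨hxW, ?_, Subset.antisymm ?_ ?_⟩
  · intro w hw
    by_contra hcon
    have huW : u ∉ W := fun h => hGu (hWsub h).1
    have hvW : v ∉ W := fun h => hGv (hWsub h).1
    rw [mem_uIcc, not_or, not_and_or, not_and_or, not_le, not_le, not_le, not_le] at hcon
    rw [mem_uIcc] at hx
    rcases lt_or_ge w x with hlt | hge
    · rcases hx with hx | hx
      · refine huW (hord.out hw hxW ⟨?_, hx.1⟩)
        rcases hcon.1 with h1 | h1
        · exact h1.le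
        · linarith
      · refine hvW (hord.out hw hxW ⟨?_, hx.1⟩)
        rcases hcon.2 with h1 | h1
        · exact h1.le
        · linarith
    · rcases hx with hx | hx
      · refine hvW (hord.out hxW hw ⟨hx.2, ?_⟩)
        rcases hcon.1 with h1 | h1
        · linarith
        · exact h1.le
      · refine huW (hord.out hxW hw ⟨hx.2, ?_⟩)
        rcases hcon.2 with h1 | h1
        · linarith
        · exact h1.le
  · rintro _ ⟨w, hw, rfl⟩
    exact (hWsub hw).1
  · set γ : ℝ → ℝ := fun τ => x + τ * (v - x) with hγ
    have hγc : Continuous γ := by fun_prop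
    have hγ0 : γ 0 = x := by simp [hγ]
    have hγ1 : γ 1 = v := by simp [hγ]
    have hγI : ∀ τ ∈ Icc (0 : ℝ) 1, γ τ ∈ I := by
      intro τ hτ
      refine hIc.uIcc_subset (huv hx) hv ?_
      rw [mem_uIcc]
      rcases le_total x v with hle | hle
      · left; constructor <;> simp only [hγ] <;> nlinarith [hτ.1, hτ.2]
      · right; constructor <;> simp only [hγ] <;> nlinarith [hτ.1, hτ.2]
    have hhit : ∀ τ ∈ Icc (0 : ℝ) 1, G (γ τ) ∉ uIcc e c → ∃ τ' ∈ Icc 0 τ, G (γ τ') = c := by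
      intro τ hτ hout
      have := intermediate_value_uIcc (a := 0) (b := τ) (hG.comp hγc).continuousOn
        (by simpa [hγ0, hGx] using hside _ (hGI _ (hγI τ hτ)) hout)
      rwa [uIcc_of_le hτ.1] at this
    obtain ⟨τ₁, hτ₁, hGτ₁⟩ := hhit 1 (by simp) (by rwa [hγ1])
    obtain ⟨τ, ⟨hτ, hGτ⟩, hτmin⟩ := (isCompact_Icc.inter_right
      (isClosed_eq (hG.comp hγc) continuous_const)).exists_isLeast
      (⟨τ₁, hτ₁, hGτ₁⟩ : (Icc (0 : ℝ) 1 ∩ {τ | (G ∘ γ) τ = c}).Nonempty)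
    have hGτ : G (γ τ) = c := hGτ
    have hsub : γ '' Icc 0 τ ⊆ W := by
      refine ((isPreconnected_Icc.image γ hγc.continuousOn)).subset_connectedComponentIn
        ⟨0, ⟨le_rfl, hτ.1⟩, hγ0⟩ ?_
      rintro _ ⟨ρ, hρ, rfl⟩
      have hρ1 : ρ ∈ Icc (0 : ℝ) 1 := ⟨hρ.1, hρ.2.trans hτ.2⟩
      refine ⟨?_, hγI ρ hρ1⟩
      by_contra hout
      obtain ⟨τ', hτ', he⟩ := hhit ρ hρ1 hout
      have : τ ≤ τ' := hτmin ⟨⟨hτ'.1, hτ'.2.trans hρ1.2⟩, he⟩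
      have hρτ : ρ = τ := le_antisymm hρ.2 (this.trans hτ'.2)
      rw [hρτ, mem_preimage, hGτ] at hout
      exact hout right_mem_uIcc
    intro w hw
    have := intermediate_value_uIcc (a := 0) (b := τ) (hG.comp hγc).continuousOn
      (by simpa [hγ0, hGx, hGτ] using hw)
    rw [uIcc_of_le hτ.1] at this
    obtain ⟨ρ, hρ, rfl⟩ := this
    exact ⟨γ ρ, hsub ⟨ρ, hρ, rfl⟩, rfl⟩

/-- `W` is a component of `T^{-m}(B₀) ∩ I` inside `B₀`, mapped onto `B₀`, along which the Birkhoff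
sums of `g` are at least `-D`. -/
structure IsGoodPullback (T g : ℝ → ℝ) (I B₀ : Set ℝ) (D : ℝ) (m : ℕ) (W : Set ℝ) : Prop where
  one_le : 1 ≤ m
  sub : W ⊆ B₀
  pullback : ∃ x ∈ W, W = connectedComponentIn (T^[m] ⁻¹' B₀ ∩ I) x
  onto : T^[m] '' W = B₀
  sum_ge : ∀ y ∈ W, -D ≤ birkhoffSum T g m y

namespace ExactSlopeMap

variable {T d : ℝ → ℝ} {a b : ℝ}

/-- Five ordered points with prescribed images alternating between two values. -/
theorem exists_alternating_points (h : ExactSlopeMap T d a b) {e z : ℝ} (he : e ∈ Icc a b)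
    (hz : z ∈ Icc a b) :
    ∃ (N : ℕ) (p q c₁ c₂ c₃ c₄ c₅ : ℝ), a < p ∧ p ≤ c₁ ∧ c₁ ≤ c₂ ∧ c₂ ≤ c₃ ∧ c₃ ≤ c₄ ∧ c₄ ≤ c₅ ∧
      c₅ ≤ q ∧ q < b ∧ T^[N] c₁ = z ∧ T^[N] c₂ = e ∧ T^[N] c₃ = z ∧ T^[N] c₄ = e ∧
      T^[N] c₅ = z := by
  have hlt := h.lt
  set l := (b - a) / 7 with hl
  have hl0 : 0 < l := by rw [hl]; linarith
  obtain ⟨N, hN⟩ := h.exists_uniform_time hl0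
  have key : ∀ k : ℕ, 1 ≤ k → k ≤ 5 → ∀ w ∈ Icc a b,
      ∃ c, a + k * l ≤ c ∧ c ≤ a + (k + 1) * l ∧ T^[N] c = w := by
    intro k h1 h5 w hw
    have h1' : (1 : ℝ) ≤ k := by exact_mod_cast h1
    have h5' : (k : ℝ) ≤ 5 := by exact_mod_cast h5
    have h7 : b = a + 7 * l := by rw [hl]; ring
    have hle : a + k * l ≤ a + (k + 1) * l := by nlinarith
    obtain ⟨c, hc, hcw⟩ := hN N le_rfl (a + k * l) ⟨by nlinarith, by nlinarith⟩
      (a + (k + 1) * l) ⟨by nlinarith, by nlinarith⟩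
      (by rw [abs_sub_comm, abs_of_nonneg] <;> linarith) hw
    rw [uIcc_of_le hle] at hc
    exact ⟨c, hc.1, hc.2, hcw⟩
  obtain ⟨c₁, h11, h12, e1⟩ := key 1 le_rfl (by norm_num) z hz
  obtain ⟨c₂, h21, h22, e2⟩ := key 2 (by norm_num) (by norm_num) e he
  obtain ⟨c₃, h31, h32, e3⟩ := key 3 (by norm_num) (by norm_num) z hz
  obtain ⟨c₄, h41, h42, e4⟩ := key 4 (by norm_num) (by norm_num) e he
  obtain ⟨c₅, h51, h52, e5⟩ := key 5 (by norm_num) (by norm_num) z hz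
  push_cast at *
  exact ⟨N, a + l, a + 6 * l, c₁, c₂, c₃, c₄, c₅, by linarith, by linarith, by linarith,
    by linarith, by linarith, by linarith, by linarith, by rw [hl]; linarith, e1, e2, e3, e4, e5⟩

/-- Two disjoint good pull-backs at arbitrarily small scale. -/
theorem exists_two_good_pullbacks (h : ExactSlopeMap T d a b) {g : ℝ → ℝ} {A D : ℝ}
    (hA : ∀ x ∈ Icc a b, -A ≤ g x)
    (hcov : ∀ L : ℕ, ∃ m ≥ L, ∃ y ∈ Icc a b, ∃ e ∈ Icc a b,
      SurjOn T^[m] (uIcc y e) (Icc a b) ∧ ∀ z ∈ uIcc y e, -D ≤ birkhoffSum T g m z)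
    {e c z : ℝ} (he : e ∈ Icc a b) (hc : c ∈ Icc a b) (hec : e ≠ c) (hz : z ∈ Icc a b)
    (hzc : z ∉ uIcc e c) (hside : ∀ w ∈ Icc a b, w ∉ uIcc e c → c ∈ uIcc e w) :
    ∃ D' : ℝ, ∀ δ > 0, ∃ p ∈ Icc a b, ∃ (m : ℕ) (W₁ W₂ : Set ℝ), Disjoint W₁ W₂ ∧
      W₁ ⊆ ball p δ ∧ W₂ ⊆ ball p δ ∧ IsGoodPullback T g (Icc a b) (uIcc e c) D' m W₁ ∧
      IsGoodPullback T g (Icc a b) (uIcc e c) D' m W₂ := by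
  have hlt := h.lt
  obtain ⟨N₁, p, q, c₁, c₂, c₃, c₄, c₅, hap, hp1, h12, h23, h34, h45, h5q, hqb,
    e1, e2, e3, e4, e5⟩ := h.exists_alternating_points he hz
  obtain ⟨N₀, hN₀⟩ := h.exists_uniform_time (abs_pos.2 (sub_ne_zero.2 hec))
  refine ⟨N₀ * A + D + N₁ * A, fun δ hδ => ?_⟩
  obtain ⟨Nδ, hNδ⟩ := h.exists_uniform_time hδ
  obtain ⟨m, hm, y, hy, e', he', hsurj, hsum⟩ := hcov (Nδ + 1)
  have hecI : uIcc e c ⊆ Icc a b := uIcc_subset_Icc he hc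
  obtain ⟨s, t, hst, himg⟩ := exists_uIcc_image_eq_Icc (h.cont.iterate N₀) (u := e) (v := c)
    (p := min y e') (q := max y e') min_le_max
    ((uIcc_subset_Icc hy he').trans (hN₀ N₀ le_rfl e he c hc le_rfl))
  have hcov₂ : Icc p q ⊆ T^[m + N₀] '' uIcc s t := by
    intro w hw
    obtain ⟨v, hv, rfl⟩ := hsurj (⟨hap.le.trans hw.1, hw.2.trans hqb.le⟩ : w ∈ Icc a b)
    obtain ⟨u, hu, rfl⟩ : v ∈ T^[N₀] '' uIcc s t := by rw [himg]; exact hv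
    exact ⟨u, hu, Function.iterate_add_apply ..⟩
  obtain ⟨s', t', hst', himg'⟩ := exists_uIcc_image_eq_Icc (h.cont.iterate (m + N₀))
    (by linarith) hcov₂
  have hsub : uIcc s' t' ⊆ uIcc e c := hst'.trans hst
  have hsub' : uIcc s' t' ⊆ Icc a b := hsub.trans hecI
  have hsmall : |s' - t'| < δ := by
    by_contra! hge
    obtain ⟨w, hw, hwa⟩ := hNδ (m + N₀) (by lia) s' (hsub' left_mem_uIcc) t' (hsub' right_mem_uIcc)
      hge (left_mem_Icc.2 hlt.le)
    have : T^[m + N₀] w ∈ Icc p q := by rw [← himg']; exact mem_image_of_mem _ hw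
    rw [hwa] at this
    linarith [this.1]
  set F := T^[m + N₀] with hF
  have hFc : Continuous F := h.cont.iterate _
  obtain ⟨x₁, hx₁, f1⟩ : c₁ ∈ F '' uIcc s' t' := by rw [himg']; constructor <;> linarith
  obtain ⟨x₅, hx₅, f5⟩ : c₅ ∈ F '' uIcc s' t' := by rw [himg']; constructor <;> linarith
  obtain ⟨x₄, hx₄, f4⟩ : c₄ ∈ F '' uIcc x₁ x₅ := intermediate_value_uIcc hFc.continuousOn
    (by rw [f1, f5, uIcc_of_le (by linarith)]; constructor <;> linarith)
  obtain ⟨x₃, hx₃, f3⟩ : c₃ ∈ F '' uIcc x₁ x₄ := intermediate_value_uIcc hFc.continuousOn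
    (by rw [f1, f4, uIcc_of_le (by linarith)]; constructor <;> linarith)
  obtain ⟨x₂, hx₂, f2⟩ : c₂ ∈ F '' uIcc x₁ x₃ := intermediate_value_uIcc hFc.continuousOn
    (by rw [f1, f3, uIcc_of_le (by linarith)]; constructor <;> linarith)
  have h15 : uIcc x₁ x₅ ⊆ uIcc s' t' := uIcc_subset_uIcc hx₁ hx₅
  have h14 : uIcc x₁ x₄ ⊆ uIcc x₁ x₅ := uIcc_subset_uIcc left_mem_uIcc hx₄
  have hx₃' : x₃ ∈ uIcc s' t' := h15 (h14 hx₃)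
  have h13 : uIcc x₁ x₃ ⊆ uIcc s' t' := uIcc_subset_uIcc hx₁ hx₃'
  have h35 : uIcc x₃ x₅ ⊆ uIcc s' t' := uIcc_subset_uIcc hx₃' hx₅
  have hx₄' : x₄ ∈ uIcc x₃ x₅ := by
    rw [mem_uIcc] at *
    rcases hx₄ with h1 | h1 <;> rcases hx₃ with h2 | h2
    · exact Or.inl ⟨h2.2, h1.2⟩
    · exact Or.inl ⟨by linarith, h1.2⟩
    · exact Or.inr ⟨h1.1, by linarith⟩
    · exact Or.inr ⟨h1.1, h2.1⟩
  set M := N₁ + (m + N₀) with hM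
  have hMF : ∀ x, T^[M] x = T^[N₁] (F x) := fun x => Function.iterate_add_apply ..
  have hG1 : T^[M] x₁ = z := by rw [hMF, f1, e1]
  have hG2 : T^[M] x₂ = e := by rw [hMF, f2, e2]
  have hG3 : T^[M] x₃ = z := by rw [hMF, f3, e3]
  have hG4 : T^[M] x₄ = e := by rw [hMF, f4, e4]
  have hG5 : T^[M] x₅ = z := by rw [hMF, f5, e5]
  have hmem : ∀ x ∈ Icc a b, T^[M] x ∈ Icc a b := fun x hx => h.iterate_mem hx M
  obtain ⟨hm₁, hs₁, hi₁⟩ := connectedComponentIn_trapped (h.cont.iterate M) hmem hside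
    (hsub' hx₁) (hsub' hx₃') hx₂ (by rwa [hG1]) (by rwa [hG3]) hG2
  obtain ⟨hm₂, hs₂, hi₂⟩ := connectedComponentIn_trapped (h.cont.iterate M) hmem hside
    (hsub' hx₃') (hsub' hx₅) hx₄' (by rwa [hG3]) (by rwa [hG5]) hG4
  have hbound : ∀ x ∈ uIcc s' t', -(N₀ * A + D + N₁ * A) ≤ birkhoffSum T g M x := by
    intro x hx
    have hxI := hsub' hx
    have hV : T^[N₀] x ∈ uIcc y e' := by
      have : T^[N₀] x ∈ T^[N₀] '' uIcc s t := mem_image_of_mem _ (hst' hx)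
      rwa [himg] at this
    have b1 := h.birkhoffSum_ge_neg hA hxI N₀
    have b2 := hsum _ hV
    have b3 := h.birkhoffSum_ge_neg hA (h.iterate_mem (h.iterate_mem hxI N₀) m) N₁
    rw [hM, show N₁ + (m + N₀) = N₀ + (m + N₁) by lia, birkhoffSum_add, birkhoffSum_add]
    linarith
  have hball : uIcc s' t' ⊆ ball s' δ := by
    intro w hw
    rw [mem_ball, Real.dist_eq, abs_sub_comm]
    rw [uIcc_comm] at hw
    have := abs_sub_right_of_mem_uIcc hw
    linarith [hsmall]
  refine ⟨s', hsub' left_mem_uIcc, M, _, _, ?_, (hs₁.trans h13).trans hball,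
    (hs₂.trans h35).trans hball, ⟨by lia, (hs₁.trans h13).trans hsub, ⟨x₂, hm₁, rfl⟩, hi₁,
      fun w hw => hbound w (h13 (hs₁ hw))⟩, ⟨by lia, (hs₂.trans h35).trans hsub, ⟨x₄, hm₂, rfl⟩, hi₂,
      fun w hw => hbound w (h35 (hs₂ hw))⟩⟩
  rw [Set.disjoint_left]
  intro w hw₁ hw₂
  have hw₃ : w = x₃ := by
    have k1 := hs₁ hw₁
    have k2 := hs₂ hw₂
    rw [mem_uIcc] at *
    rcases hx₄ with h1 | h1 <;> rcases hx₃ with h2 | h2 <;> rcases k1 with k1 | k1 <;>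
      rcases k2 with k2 | k2 <;> linarith
  have := (connectedComponentIn_subset _ _ hw₁).1
  rw [hw₃, mem_preimage, hG3] at this
  exact hzc this

end ExactSlopeMap

theorem IsGoodPullback.isClosed {T g : ℝ → ℝ} {I B₀ W : Set ℝ} {D : ℝ} {m : ℕ}
    (hW : IsGoodPullback T g I B₀ D m W) (hT : Continuous T) (hI : IsClosed I)
    (hB : IsClosed B₀) : IsClosed W := by
  obtain ⟨x, -, rfl⟩ := hW.pullback
  exact ((hB.preimage (hT.iterate m)).inter hI).isClosed_connectedComponentIn x

namespace ExactSlopeMap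

variable {T d : ℝ → ℝ} {a b : ℝ}

/-- Pull-backs accumulating at a point without containing it can be chosen pairwise disjoint. -/
theorem exists_disjoint_good_pullbacks (h : ExactSlopeMap T d a b) {g : ℝ → ℝ} {B₀ : Set ℝ}
    {D : ℝ} (hB : IsClosed B₀)
    (hpair : ∀ δ > 0, ∃ p ∈ Icc a b, ∃ (m : ℕ) (W₁ W₂ : Set ℝ), Disjoint W₁ W₂ ∧
      W₁ ⊆ ball p δ ∧ W₂ ⊆ ball p δ ∧ IsGoodPullback T g (Icc a b) B₀ D m W₁ ∧
      IsGoodPullback T g (Icc a b) B₀ D m W₂) :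
    ∃ (m : ℕ → ℕ) (W : ℕ → Set ℝ), Pairwise (fun i j => Disjoint (W i) (W j)) ∧
      ∀ l, IsGoodPullback T g (Icc a b) B₀ D (m l) (W l) := by
  choose p hpI hp using fun n : ℕ => hpair (1 / ((n : ℝ) + 1)) Nat.one_div_pos_of_nat
  obtain ⟨y, -, θ, hθ, hy⟩ := isCompact_Icc.tendsto_subseq hpI
  have key : ∀ ε : ℝ, 0 < ε → ∃ (m : ℕ) (W : Set ℝ) (ε' : ℝ), 0 < ε' ∧ ε' ≤ ε ∧
      IsGoodPullback T g (Icc a b) B₀ D m W ∧ W ⊆ ball y ε ∧ Disjoint W (ball y ε') := by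
    intro ε hε
    have h1 := hy.eventually (ball_mem_nhds y (half_pos hε))
    have h2 := (tendsto_one_div_add_atTop_nhds_zero_nat (𝕜 := ℝ)).comp hθ.tendsto_atTop
    have h2 := h2.eventually (gt_mem_nhds (half_pos hε))
    obtain ⟨n, hn1, hn2⟩ := (h1.and h2).exists
    obtain ⟨m, W₁, W₂, hd, hs₁, hs₂, hW₁, hW₂⟩ := hp (θ n)
    have hball : ball (p (θ n)) (1 / ((θ n : ℕ) + 1 : ℝ)) ⊆ ball y ε := by
      refine ball_subset_ball' ?_
      have e1 : dist (p (θ n)) y < ε / 2 := hn1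
      have e2 : 1 / ((θ n : ℕ) + 1 : ℝ) < ε / 2 := hn2
      linarith
    have fin : ∀ W, IsGoodPullback T g (Icc a b) B₀ D m W → W ⊆ ball y ε → y ∉ W →
        ∃ (m : ℕ) (W : Set ℝ) (ε' : ℝ), 0 < ε' ∧ ε' ≤ ε ∧
      IsGoodPullback T g (Icc a b) B₀ D m W ∧ W ⊆ ball y ε ∧ Disjoint W (ball y ε') := by
      intro W hW hWs hyW
      obtain ⟨r, hr, hrW⟩ := Metric.isOpen_iff.1
        (hW.isClosed h.cont isClosed_Icc hB).isOpen_compl y hyW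
      exact ⟨m, W, min r ε, lt_min hr hε, min_le_right _ _, hW, hWs,
        disjoint_compl_right.mono_right ((ball_subset_ball (min_le_left _ _)).trans hrW)⟩
    by_cases hyW : y ∈ W₁
    · exact fin W₂ hW₂ (hs₂.trans hball) (disjoint_left.1 hd hyW)
    · exact fin W₁ hW₁ (hs₁.trans hball) hyW
  choose! m W r hr0 hr hgood hsub hdis using key
  let ε : ℕ → ℝ := fun n => r^[n] 1
  have hε : ∀ n, 0 < ε n := by
    intro n
    induction n with
    | zero => exact one_pos
    | succ n ih => simp only [ε, Function.iterate_succ_apply']; exact hr0 _ ih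
  have hsucc : ∀ n, ε (n + 1) = r (ε n) := fun n => Function.iterate_succ_apply' ..
  have hanti : Antitone ε := antitone_nat_of_succ_le fun n => by
    rw [hsucc]; exact hr _ (hε n)
  have hlt : ∀ i j, i < j → Disjoint (W (ε i)) (W (ε j)) := by
    intro i j hij
    refine (hdis _ (hε i)).mono_right ((hsub _ (hε j)).trans (ball_subset_ball ?_))
    rw [← hsucc]
    exact hanti hij
  refine ⟨fun n => m (ε n), fun n => W (ε n), fun i j hij => ?_, fun l => hgood _ (hε l)⟩
  rcases lt_or_gt_of_ne hij with h1 | h1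
  · exact hlt i j h1
  · exact (hlt j i h1).symm

end ExactSlopeMap

/-- An IMFS whose pull-backs are pairwise disjoint is free at every point. -/
theorem IMFS.freeAt_of_pairwise_disjoint {f : ℝ → ℝ} {I B₀ : Set ℝ} (S : IMFS f I B₀)
    (hS : Pairwise (fun i j => Disjoint (S.W i) (S.W j))) (x : ℝ) : S.FreeAt x := by
  have hpos : ∀ l u, 0 < S.time (l :: u) := fun l u => by
    have := S.one_le l
    simp only [IMFS.time, List.map_cons, List.sum_cons]
    lia
  have key : ∀ u v : List ℕ, u ≠ v → S.time u = S.time v →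
      Disjoint (S.applyWord u {x}) (S.applyWord v {x}) := by
    intro u
    induction u with
    | nil =>
      rintro (_ | ⟨l, v⟩) huv ht
      · exact absurd rfl huv
      · exact absurd ht (hpos l v).ne
    | cons k u ih =>
      rintro (_ | ⟨l, v⟩) huv ht
      · exact absurd ht (hpos k u).ne'
      by_cases hkl : k = l
      · subst hkl
        have h1 : Disjoint (S.applyWord u {x}) (S.applyWord v {x}) := by
          refine ih v (fun h => huv (by rw [h])) ?_
          simpa [IMFS.time] using ht
        exact (h1.preimage _).mono inter_subset_left inter_subset_left
      · exact (hS hkl).mono inter_subset_right inter_subset_right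
  exact fun u v _ _ huv ht => key u v huv ht

/-- Good pull-backs for `T` form a free IMFS for a map `f` agreeing with `T` on `I`. -/
theorem exists_free_IMFS_of_good_pullbacks {f T g G : ℝ → ℝ} {I B₀ : Set ℝ} {D : ℝ}
    (hT : ∀ x, T x ∈ I) (hTf : EqOn T f I) (hgG : EqOn g G I) (hB : B₀ ⊆ I)
    (hne : B₀.Nonempty) {m : ℕ → ℕ} {W : ℕ → Set ℝ}
    (hdis : Pairwise (fun i j => Disjoint (W i) (W j)))
    (hW : ∀ l, IsGoodPullback T g I B₀ D (m l) (W l)) :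
    ∃ S : IMFS f I B₀, S.Free ∧
      ∀ l : ℕ, ∀ y ∈ S.apply l B₀, -D ≤ birkhoffSum f G (S.m l) y := by
  have hit : ∀ n, ∀ x ∈ I, T^[n] x = f^[n] x ∧ T^[n] x ∈ I := by
    intro n x hx
    induction n with
    | zero => exact ⟨rfl, hx⟩
    | succ n ih =>
      rw [Function.iterate_succ_apply', Function.iterate_succ_apply', ← ih.1]
      exact ⟨hTf ih.2, hT _⟩
  have hWI : ∀ l, W l ⊆ I := fun l => (hW l).sub.trans hB
  let S : IMFS f I B₀ :=
    { m := m
      W := W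
      one_le := fun l => (hW l).one_le
      sub := fun l => (hW l).sub
      pullback := fun l => by
        have : f^[m l] ⁻¹' B₀ ∩ I = T^[m l] ⁻¹' B₀ ∩ I := by
          ext x
          simp only [mem_inter_iff, mem_preimage]
          exact and_congr_left fun hx => by rw [(hit (m l) x hx).1]
        rw [this]
        exact (hW l).pullback
      onto := fun l => by
        rw [← (hW l).onto]
        exact image_congr fun x hx => ((hit (m l) x (hWI l hx)).1).symm }
  obtain ⟨x, hx⟩ := hne
  refine ⟨S, ⟨x, hx, S.freeAt_of_pairwise_disjoint hdis x⟩, fun l y hy => ?_⟩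
  have hyW : y ∈ W l := hy.2
  have : birkhoffSum f G (m l) y = birkhoffSum T g (m l) y :=
    Finset.sum_congr rfl fun k _ => by
      have := hit k y (hWI l hyW)
      rw [← this.1, hgG this.2]
  exact ((hW l).sum_ge y hyW).trans_eq this.symm

namespace ExactSlopeMap

variable {T d : ℝ → ℝ} {a b : ℝ}

/-- Every point of `[a, b]` lies in an interval carrying disjoint good pull-backs. -/
theorem exists_interval_good_pullbacks (h : ExactSlopeMap T d a b) {g : ℝ → ℝ} {A D : ℝ}
    (hA : ∀ x ∈ Icc a b, -A ≤ g x)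
    (hcov : ∀ L : ℕ, ∃ m ≥ L, ∃ y ∈ Icc a b, ∃ e ∈ Icc a b,
      SurjOn T^[m] (uIcc y e) (Icc a b) ∧ ∀ z ∈ uIcc y e, -D ≤ birkhoffSum T g m z)
    {x₀ : ℝ} (hx₀ : x₀ ∈ Icc a b) :
    ∃ e ∈ Icc a b, ∃ c ∈ Icc a b, x₀ ∈ uIcc e c ∧ ∃ (D' : ℝ) (m : ℕ → ℕ) (W : ℕ → Set ℝ),
      Pairwise (fun i j => Disjoint (W i) (W j)) ∧
      ∀ l, IsGoodPullback T g (Icc a b) (uIcc e c) D' (m l) (W l) := by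
  have hlt := h.lt
  rcases hx₀.2.lt_or_eq with hxb | rfl
  · have hac : a ≤ (x₀ + b) / 2 := by linarith [hx₀.1]
    have hc : (x₀ + b) / 2 ∈ Icc a b := ⟨hac, by linarith⟩
    obtain ⟨D', hD'⟩ := h.exists_two_good_pullbacks hA hcov (left_mem_Icc.2 hlt.le) hc
      (by linarith [hx₀.1]) (right_mem_Icc.2 hlt.le)
      (by rw [uIcc_of_le hac]; exact fun hb => by linarith [hb.2])
      (fun w hw hwc => by
        rw [uIcc_of_le hac] at hwc
        rw [uIcc_of_le hw.1]
        exact ⟨hac, le_of_not_ge fun hle => hwc ⟨hw.1, hle⟩⟩)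
    exact ⟨a, left_mem_Icc.2 hlt.le, _, hc, by rw [uIcc_of_le hac]; exact ⟨hx₀.1, by linarith⟩,
      D', h.exists_disjoint_good_pullbacks isCompact_uIcc.isClosed hD'⟩
  · have hcb : (a + x₀) / 2 ≤ x₀ := by linarith
    have hc : (a + x₀) / 2 ∈ Icc a x₀ := ⟨by linarith, hcb⟩
    obtain ⟨D', hD'⟩ := h.exists_two_good_pullbacks hA hcov (right_mem_Icc.2 hlt.le) hc
      (by linarith) (left_mem_Icc.2 hlt.le)
      (by rw [uIcc_of_ge hcb]; exact fun ha => by linarith [ha.1])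
      (fun w hw hwc => by
        rw [uIcc_of_ge hcb] at hwc
        rw [uIcc_of_ge hw.2]
        exact ⟨le_of_not_ge fun hle => hwc ⟨hle, hw.2⟩, hcb⟩)
    exact ⟨x₀, right_mem_Icc.2 hlt.le, _, hc, left_mem_uIcc,
      D', h.exists_disjoint_good_pullbacks isCompact_uIcc.isClosed hD'⟩

end ExactSlopeMap

theorem HolderOn.mono {g : ℝ → ℝ} {s u : Set ℝ} (hg : HolderOn g s) (hu : u ⊆ s) :
    HolderOn g u := by
  obtain ⟨C, α, h1, h2, h3, h⟩ := hg
  exact ⟨C, α, h1, h2, h3, fun x hx y hy => h x (hu hx) y (hu hy)⟩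

theorem HolderOn.continuousOn {g : ℝ → ℝ} {s : Set ℝ} (hg : HolderOn g s) :
    ContinuousOn g s := by
  obtain ⟨C, α, h1, -, -, h⟩ := hg
  intro x hx
  have h0 : Tendsto (fun y : ℝ => C * |y - x| ^ α) (nhdsWithin x s) (nhds 0) := by
    have hc : Continuous fun y : ℝ => C * |y - x| ^ α :=
      continuous_const.mul ((continuous_abs.comp (continuous_sub_right x)).rpow_const
        fun _ => Or.inr h1.le)
    have := hc.tendsto x
    simp only [sub_self, abs_zero, Real.zero_rpow h1.ne', mul_zero] at this
    exact this.mono_left nhdsWithin_le_nhds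
  refine tendsto_iff_dist_tendsto_zero.2 (squeeze_zero' (Eventually.of_forall fun _ =>
    dist_nonneg) ?_ h0)
  filter_upwards [self_mem_nhdsWithin] with y hy
  exact h y hy x hx

theorem LipschitzOnWith.holderOn {g : ℝ → ℝ} {s : Set ℝ} {K : NNReal}
    (hg : LipschitzOnWith K g s) : HolderOn g s :=
  ⟨K, 1, one_pos, le_rfl, K.2, fun x hx y hy => by
    simpa [Real.dist_eq] using hg.dist_le_mul x hx y hy⟩

theorem HolderOn.comp {F g : ℝ → ℝ} {s u : Set ℝ} (hF : HolderOn F u) (hg : HolderOn g s)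
    (hsu : MapsTo g s u) : HolderOn (F ∘ g) s := by
  obtain ⟨C, α, h1, h2, h3, h⟩ := hF
  obtain ⟨C', α', h1', h2', h3', h'⟩ := hg
  refine ⟨C * C' ^ α, α' * α, by positivity, mul_le_one₀ h2' h1.le h2, by positivity,
    fun x hx y hy => ?_⟩
  refine (h _ (hsu hx) _ (hsu hy)).trans ?_
  rw [mul_assoc, Real.rpow_mul (abs_nonneg _), ← Real.mul_rpow h3' (by positivity)]
  gcongr
  exact h' x hx y hy

theorem holderOn_rpow_of_le_one {γ : ℝ} (h0 : 0 < γ) (h1 : γ ≤ 1) :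
    HolderOn (fun y => y ^ γ) (Ici 0) := by
  have key : ∀ x y : ℝ, 0 ≤ y → y ≤ x → |x ^ γ - y ^ γ| ≤ |x - y| ^ γ := by
    intro x y hy hyx
    have := Real.rpow_add_le_add_rpow hy (sub_nonneg.2 hyx) h0.le h1
    rw [add_sub_cancel] at this
    rw [abs_of_nonneg (sub_nonneg.2 (Real.rpow_le_rpow hy hyx h0.le)),
      abs_of_nonneg (sub_nonneg.2 hyx)]
    linarith
  refine ⟨1, γ, h0, h1, zero_le_one, fun x hx y hy => ?_⟩
  rw [one_mul]
  rcases le_total y x with h | h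
  · exact key x y hy h
  · rw [abs_sub_comm, abs_sub_comm x]
    exact key y x hx h

/-- `g` is Hölder continuous on a neighbourhood of `x` in `s`. -/
def LocallyHolderAt (g : ℝ → ℝ) (s : Set ℝ) (x : ℝ) : Prop :=
  ∃ U ∈ nhdsWithin x s, HolderOn g U

namespace LocallyHolderAt

variable {g k F : ℝ → ℝ} {s u : Set ℝ} {x : ℝ}

theorem continuousWithinAt (hg : LocallyHolderAt g s x) (hx : x ∈ s) :
    ContinuousWithinAt g s x := by
  obtain ⟨U, hU, hgU⟩ := hg
  exact (hgU.continuousOn x (mem_of_mem_nhdsWithin hx hU)).mono_of_mem_nhdsWithin hU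

theorem congr (hg : LocallyHolderAt g s x) (h : k =ᶠ[nhdsWithin x s] g) :
    LocallyHolderAt k s x := by
  obtain ⟨U, hU, C, α, h1, h2, h3, hgU⟩ := hg
  refine ⟨U ∩ {y | k y = g y}, inter_mem hU h, C, α, h1, h2, h3, ?_⟩
  rintro y ⟨hy, hy'⟩ z ⟨hz, hz'⟩
  rw [show k y = g y from hy', show k z = g z from hz']
  exact hgU y hy z hz

theorem of_contDiffWithinAt (hg : ContDiffWithinAt ℝ 1 g s x) (hs : Convex ℝ s) :
    LocallyHolderAt g s x := by
  obtain ⟨K, U, hU, hK⟩ := hg.exists_lipschitzOnWith hs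
  exact ⟨U, hU, hK.holderOn⟩

theorem comp (hF : LocallyHolderAt F u (g x)) (hg : LocallyHolderAt g s x) (hx : x ∈ s)
    (hsu : MapsTo g s u) : LocallyHolderAt (F ∘ g) s x := by
  have hc := (hg.continuousWithinAt hx).tendsto_nhdsWithin hsu
  obtain ⟨V, hV, hFV⟩ := hF
  obtain ⟨U, hU, hgU⟩ := hg
  exact ⟨U ∩ g ⁻¹' V, inter_mem hU (hc hV),
    hFV.comp (hgU.mono inter_subset_left) fun y hy => hy.2⟩

theorem abs (hg : LocallyHolderAt g s x) (hx : x ∈ s) :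
    LocallyHolderAt (fun y => |g y|) s x := by
  refine LocallyHolderAt.comp (F := fun y => |y|) (u := univ) ⟨univ, univ_mem, 1, 1, one_pos,
    le_rfl, zero_le_one, fun y _ z _ => ?_⟩ hg hx (mapsTo_univ _ _)
  simpa using abs_abs_sub_abs_le_abs_sub y z

theorem rpow {γ : ℝ} (hγ : 0 < γ) (hg : LocallyHolderAt g s x) (hx : x ∈ s)
    (h0 : ∀ y ∈ s, 0 ≤ g y) : LocallyHolderAt (fun y => g y ^ γ) s x := by
  refine LocallyHolderAt.comp (F := fun y => y ^ γ) (u := Ici 0) ?_ hg hx h0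
  rcases le_total γ 1 with h1 | h1
  · exact ⟨Ici 0, self_mem_nhdsWithin, holderOn_rpow_of_le_one hγ h1⟩
  · refine of_contDiffWithinAt ?_ (convex_Ici 0)
    have := Real.contDiff_rpow_const_of_le (p := γ) (n := 1) (by simpa using h1)
    exact (by simpa using this : ContDiff ℝ 1 fun y : ℝ => y ^ γ).contDiffAt.contDiffWithinAt

theorem mul (hg : LocallyHolderAt g s x) (hk : LocallyHolderAt k s x) (hx : x ∈ s) :
    LocallyHolderAt (fun y => g y * k y) s x := by
  have hgb := ((hg.continuousWithinAt hx).abs).eventually (gt_mem_nhds (lt_add_one |g x|))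
  have hkb := ((hk.continuousWithinAt hx).abs).eventually (gt_mem_nhds (lt_add_one |k x|))
  obtain ⟨U, hU, C, α, h1, h2, h3, h⟩ := hg
  obtain ⟨V, hV, C', α', h1', h2', h3', h'⟩ := hk
  have hball : ball x (1 / 2) ∈ nhdsWithin x s :=
    mem_nhdsWithin_of_mem_nhds (ball_mem_nhds x one_half_pos)
  refine ⟨(U ∩ V) ∩ ball x (1 / 2) ∩ ({y | |g y| < |g x| + 1} ∩ {y | |k y| < |k x| + 1}),
    inter_mem (inter_mem (inter_mem hU hV) hball) (inter_mem hgb hkb),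
    (|g x| + 1) * C' + (|k x| + 1) * C, min α α', lt_min h1 h1', (min_le_left _ _).trans h2,
    by positivity, ?_⟩
  rintro y ⟨⟨⟨hyU, hyV⟩, hyb⟩, hyg, hyk⟩ z ⟨⟨⟨hzU, hzV⟩, hzb⟩, hzg, hzk⟩
  have hyz : |y - z| ≤ 1 := by
    have e1 := dist_triangle_right y z x
    rw [mem_ball] at hyb hzb
    rw [← Real.dist_eq]
    linarith
  have hle : ∀ β, min α α' ≤ β → |y - z| ^ β ≤ |y - z| ^ min α α' := fun β hβ =>
    Real.rpow_le_rpow_of_exponent_ge_of_imp (abs_nonneg _) hyz hβ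
      (fun _ hm => absurd hm ((lt_min h1 h1').trans_le hβ).ne')
  have e1 : |g y * (k y - k z)| ≤ (|g x| + 1) * (C' * |y - z| ^ min α α') := by
    rw [abs_mul]
    refine mul_le_mul hyg.le ((h' y hyV z hzV).trans ?_) (abs_nonneg _) (by positivity)
    exact mul_le_mul_of_nonneg_left (hle _ (min_le_right _ _)) h3'
  have e2 : |k z * (g y - g z)| ≤ (|k x| + 1) * (C * |y - z| ^ min α α') := by
    rw [abs_mul]
    refine mul_le_mul hzk.le ((h y hyU z hzU).trans ?_) (abs_nonneg _) (by positivity)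
    exact mul_le_mul_of_nonneg_left (hle _ (min_le_left _ _)) h3
  calc |g y * k y - g z * k z| = |g y * (k y - k z) + k z * (g y - g z)| := by ring_nf
    _ ≤ _ := (abs_add_le _ _).trans (add_le_add e1 e2)
    _ = _ := by ring

end LocallyHolderAt

/-- A locally Hölder function on a compact set is Hölder. -/
theorem IsCompact.holderOn_of_locallyHolderAt {g : ℝ → ℝ} {s : Set ℝ} (hs : IsCompact s)
    (hg : ∀ x ∈ s, LocallyHolderAt g s x) : HolderOn g s := by
  obtain ⟨M, hM⟩ := hs.exists_bound_of_continuousOn fun x hx => (hg x hx).continuousWithinAt hx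
  suffices ∃ C α : ℝ, 0 < α ∧ α ≤ 1 ∧ 0 ≤ C ∧
      ∀ x ∈ s, x ∈ s → ∀ y ∈ s, |g x - g y| ≤ C * (min 1 |x - y|) ^ α by
    obtain ⟨C, α, h1, h2, h3, h⟩ := this
    refine ⟨C, α, h1, h2, h3, fun x hx y hy => (h x hx hx y hy).trans ?_⟩
    gcongr
    exact min_le_right _ _
  refine hs.induction_on (p := fun u => ∃ C α : ℝ, 0 < α ∧ α ≤ 1 ∧ 0 ≤ C ∧
      ∀ x ∈ u, x ∈ s → ∀ y ∈ s, |g x - g y| ≤ C * (min 1 |x - y|) ^ α) ?_ ?_ ?_ ?_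
  · exact ⟨0, 1, one_pos, le_rfl, le_rfl, by simp⟩
  · rintro u v huv ⟨C, α, h1, h2, h3, h⟩
    exact ⟨C, α, h1, h2, h3, fun x hx => h x (huv hx)⟩
  · rintro u v ⟨C, α, h1, h2, h3, h⟩ ⟨C', α', h1', h2', h3', h'⟩
    refine ⟨C + C', min α α', lt_min h1 h1', (min_le_left _ _).trans h2, by positivity, ?_⟩
    intro x hx hxs y hy
    have hm0 : 0 ≤ min 1 |x - y| := le_min zero_le_one (abs_nonneg _)
    have hle : ∀ β, min α α' ≤ β → (min 1 |x - y|) ^ β ≤ (min 1 |x - y|) ^ min α α' :=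
      fun β hβ => Real.rpow_le_rpow_of_exponent_ge_of_imp hm0 (min_le_left _ _) hβ
        (fun _ hm => absurd hm ((lt_min h1 h1').trans_le hβ).ne')
    have hp : 0 ≤ (min 1 |x - y|) ^ min α α' := Real.rpow_nonneg hm0 _
    rcases hx with hx | hx
    · refine (h x hx hxs y hy).trans ((mul_le_mul_of_nonneg_left (hle _ (min_le_left _ _))
        h3).trans ?_)
      exact mul_le_mul_of_nonneg_right (by linarith) hp
    · refine (h' x hx hxs y hy).trans ((mul_le_mul_of_nonneg_left (hle _ (min_le_right _ _))
        h3').trans ?_)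
      exact mul_le_mul_of_nonneg_right (by linarith) hp
  · intro x hx
    obtain ⟨U, hU, C, α, h1, h2, h3, h⟩ := hg x hx
    obtain ⟨r, hr, hrU⟩ := Metric.mem_nhdsWithin_iff.1 hU
    set ρ := min r 1 / 2 with hρ
    have hρ0 : 0 < ρ := by positivity
    have hρr : 2 * ρ ≤ r := by rw [hρ]; linarith [min_le_left r 1]
    have hρ1 : 2 * ρ ≤ 1 := by rw [hρ]; linarith [min_le_right r 1]
    refine ⟨ball x ρ, mem_nhdsWithin_of_mem_nhds (ball_mem_nhds x hρ0),
      C + 2 * |M| / ρ ^ α, α, h1, h2, by positivity, fun y hy hys z hz => ?_⟩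
    have hm0 : 0 ≤ min 1 |y - z| := le_min zero_le_one (abs_nonneg _)
    by_cases hyz : |y - z| < ρ
    · rw [min_eq_right (by linarith)]
      have hyr : y ∈ ball x r := ball_subset_ball (by linarith) hy
      have hzr : z ∈ ball x r := by
        rw [mem_ball] at hy ⊢
        have := dist_triangle_left z x y
        rw [Real.dist_eq y z] at this
        linarith
      refine (h y (hrU ⟨hyr, hys⟩) z (hrU ⟨hzr, hz⟩)).trans ?_
      gcongr
      linarith [show 0 ≤ 2 * |M| / ρ ^ α by positivity]
    · have e1 : |g y - g z| ≤ 2 * |M| := by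
        have e2 := hM y hys
        have e3 := hM z hz
        rw [Real.norm_eq_abs] at e2 e3
        have := abs_sub (g y) (g z)
        linarith [le_abs_self M]
      have e4 : ρ ^ α ≤ (min 1 |y - z|) ^ α := by
        gcongr
        exact le_min (by linarith) (not_lt.1 hyz)
      have hp : 0 < ρ ^ α := by positivity
      calc |g y - g z| ≤ 2 * |M| / ρ ^ α * ρ ^ α := by rwa [div_mul_cancel₀ _ hp.ne']
        _ ≤ 2 * |M| / ρ ^ α * (min 1 |y - z|) ^ α := by gcongr
        _ ≤ _ := by
          gcongr
          linarith

theorem HasDerivWithinAt.abs_of_ne_zero {g : ℝ → ℝ} {g' x : ℝ} {s : Set ℝ}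
    (hg : HasDerivWithinAt g g' s x) (h0 : g x ≠ 0) :
    HasDerivWithinAt (fun y => |g y|) (SignType.sign (g x) * g') s x :=
  (hasDerivAt_abs h0).comp_hasDerivWithinAt x hg

theorem abs_sign_mul {x y : ℝ} (hx : x ≠ 0) : |(SignType.sign x : ℝ) * y| = |y| := by
  rcases hx.lt_or_gt with h | h <;> simp [h]

/-- Differentiating `|ψ ∘ f| = |φ| ^ ℓ`. -/
theorem abs_mul_eq_of_abs_eq_abs_rpow {s : Set ℝ} {x : ℝ} {F φ : ℝ → ℝ} {F' φ' ℓ : ℝ}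
    (hℓ : 0 < ℓ) (hs : UniqueDiffWithinAt ℝ s x) (hx : x ∈ s) (hF : HasDerivWithinAt F F' s x)
    (hφ : HasDerivWithinAt φ φ' s x) (h0 : φ x ≠ 0)
    (h : ∀ᶠ y in nhdsWithin x s, |F y| = |φ y| ^ ℓ) : |F'| = ℓ * |φ x| ^ (ℓ - 1) * |φ'| := by
  have hx' : |F x| = |φ x| ^ ℓ := h.self_of_nhdsWithin hx
  have hF0 : F x ≠ 0 := by
    rw [← abs_pos, hx']
    exact Real.rpow_pos_of_pos (abs_pos.2 h0) _
  have h1 := hF.abs_of_ne_zero hF0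
  have h2 := (hφ.abs_of_ne_zero h0).rpow_const (p := ℓ) (Or.inl (abs_ne_zero.2 h0))
  have h3 := hs.eq_deriv s h1 (h2.congr_of_eventuallyEq h hx')
  rw [← abs_sign_mul (y := F') hF0, h3, abs_mul, abs_mul, abs_sign_mul h0, abs_of_pos hℓ,
    abs_of_nonneg (Real.rpow_nonneg (abs_nonneg _) _)]
  ring

theorem IsC3Diffeo.contDiff_deriv {g : ℝ → ℝ} (hg : IsC3Diffeo g) :
    ContDiff ℝ 1 (deriv g) := by
  have h3 : ContDiff ℝ (1 + 1) g := hg.1.of_le (by norm_num)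
  exact (contDiff_succ_iff_deriv.1 h3).2.2

namespace IsC3NonflatIntervalMap

variable {f : ℝ → ℝ} {a b : ℝ}

theorem continuousOn (hf : IsC3NonflatIntervalMap f a b) : ContinuousOn f (Icc a b) :=
  fun x hx => (hf.diff x hx).continuousAt.continuousWithinAt

theorem locallyHolderAt_of_deriv_ne_zero (hf : IsC3NonflatIntervalMap f a b) {x : ℝ}
    (hx : x ∈ Icc a b) (h0 : deriv f x ≠ 0) :
    LocallyHolderAt (fun y => |deriv f y|) (Icc a b) x := by
  have hU := uniqueDiffOn_Icc hf.lt
  have hmem : Icc a b \ {x | deriv f x = 0} ∈ nhdsWithin x (Icc a b) := by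
    have h1 : {x | x ∈ Icc a b ∧ deriv f x = 0}ᶜ ∈ nhds x :=
      hf.critFinite.isClosed.isOpen_compl.mem_nhds fun h => h0 h.2
    filter_upwards [mem_nhdsWithin_of_mem_nhds h1, self_mem_nhdsWithin] with y hy hyI
    exact ⟨hyI, fun h => hy ⟨hyI, h⟩⟩
  have h3 : ContDiffWithinAt ℝ 3 f (Icc a b) x :=
    (hf.smooth x ⟨hx, h0⟩).mono_of_mem_nhdsWithin hmem
  have h1 : ContDiffWithinAt ℝ 1 (derivWithin f (Icc a b)) (Icc a b) x :=
    h3.derivWithin hU (by norm_num) hx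
  refine ((LocallyHolderAt.of_contDiffWithinAt h1 (convex_Icc a b)).abs hx).congr ?_
  filter_upwards [self_mem_nhdsWithin] with y hy
  rw [(hf.diff y hy).derivWithin (hU y hy)]

/-- The formula for `|f'|` near a non-flat critical point. -/
theorem exists_abs_deriv_eq (hf : IsC3NonflatIntervalMap f a b) {c : ℝ} (hc : c ∈ Icc a b)
    (h0 : deriv f c = 0) :
    ∃ ℓ : ℝ, 1 < ℓ ∧ ∃ φ ψ : ℝ → ℝ, IsC3Diffeo φ ∧ IsC3Diffeo ψ ∧
      (fun x => |deriv f x|) =ᶠ[nhdsWithin c (Icc a b)]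
        fun x => ℓ * |φ x| ^ (ℓ - 1) * |deriv φ x| * |deriv ψ (f x)|⁻¹ := by
  obtain ⟨ℓ, hℓ, φ, ψ, hφ, hψ, hφc, -, h⟩ := hf.nonflat c hc h0
  refine ⟨ℓ, hℓ, φ, ψ, hφ, hψ, ?_⟩
  filter_upwards [eventually_eventually_nhdsWithin.2 h, self_mem_nhdsWithin] with x hx hxI
  have hφ' := (hφ.1.differentiable (by norm_num) x).hasDerivAt
  have hψ' := (hψ.1.differentiable (by norm_num) (f x)).hasDerivAt
  by_cases hx0 : φ x = 0
  · obtain rfl : x = c := hφ.2.1.1 (hx0.trans hφc.symm)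
    simp [h0, hx0, Real.zero_rpow (sub_pos.2 hℓ).ne']
  · have := abs_mul_eq_of_abs_eq_abs_rpow (by linarith) (uniqueDiffOn_Icc hf.lt x hxI) hxI
      (hψ'.comp x (hf.diff x hxI).hasDerivAt).hasDerivWithinAt hφ'.hasDerivWithinAt hx0 hx
    rw [← this, abs_mul, mul_comm |deriv ψ (f x)|,
      mul_inv_cancel_right₀ (abs_ne_zero.2 (hψ.2.2 _))]

theorem continuousOn_abs_deriv (hf : IsC3NonflatIntervalMap f a b) :
    ContinuousOn (fun x => |deriv f x|) (Icc a b) := by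
  intro x hx
  by_cases h0 : deriv f x = 0
  · obtain ⟨ℓ, hℓ, φ, ψ, hφ, hψ, h⟩ := hf.exists_abs_deriv_eq hx h0
    refine ContinuousWithinAt.congr_of_eventuallyEq ?_ h (h.self_of_nhdsWithin hx)
    have c1 : Continuous fun x => ℓ * |φ x| ^ (ℓ - 1) * |deriv φ x| :=
      (continuous_const.mul (hφ.1.continuous.abs.rpow_const fun _ =>
        Or.inr (sub_pos.2 hℓ).le)).mul hφ.contDiff_deriv.continuous.abs
    have c2 : Continuous fun y => |deriv ψ y|⁻¹ :=
      hψ.contDiff_deriv.continuous.abs.inv₀ fun y => abs_ne_zero.2 (hψ.2.2 y)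
    exact c1.continuousWithinAt.mul (c2.continuousAt.comp_continuousWithinAt (hf.continuousOn x hx))
  · exact (hf.locallyHolderAt_of_deriv_ne_zero hx h0).continuousWithinAt hx

theorem locallyHolderAt (hf : IsC3NonflatIntervalMap f a b) (x : ℝ) :
    LocallyHolderAt f (Icc a b) x := by
  obtain ⟨M, hM⟩ := isCompact_Icc.exists_bound_of_continuousOn hf.continuousOn_abs_deriv
  have hL : LipschitzOnWith M.toNNReal f (Icc a b) := by
    refine Convex.lipschitzOnWith_of_nnnorm_deriv_le (𝕜 := ℝ) hf.diff (fun y hy => ?_)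
      (convex_Icc a b)
    rw [← NNReal.coe_le_coe, coe_nnnorm, Real.norm_eq_abs]
    have := hM y hy
    rw [Real.norm_eq_abs, abs_abs] at this
    exact this.trans (Real.le_coe_toNNReal M)
  exact ⟨_, self_mem_nhdsWithin, hL.holderOn⟩

/-- The absolute value of the derivative is Hölder continuous. -/
theorem holderOn_abs_deriv (hf : IsC3NonflatIntervalMap f a b) :
    HolderOn (fun x => |deriv f x|) (Icc a b) := by
  refine isCompact_Icc.holderOn_of_locallyHolderAt fun x hx => ?_
  by_cases h0 : deriv f x = 0
  · obtain ⟨ℓ, hℓ, φ, ψ, hφ, hψ, h⟩ := hf.exists_abs_deriv_eq hx h0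
    refine LocallyHolderAt.congr ?_ h
    have hconv := convex_Icc (𝕜 := ℝ) a b
    have l1 : LocallyHolderAt φ (Icc a b) x := .of_contDiffWithinAt
      (hφ.1.of_le (by norm_num)).contDiffAt.contDiffWithinAt hconv
    have l2 : LocallyHolderAt (deriv φ) (Icc a b) x := .of_contDiffWithinAt
      hφ.contDiff_deriv.contDiffAt.contDiffWithinAt hconv
    have l3 : LocallyHolderAt (fun _ => ℓ) (Icc a b) x := .of_contDiffWithinAt
      contDiffWithinAt_const hconv
    have l4 : LocallyHolderAt (fun y => (deriv ψ y)⁻¹) univ (f x) := .of_contDiffWithinAt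
      (hψ.contDiff_deriv.contDiffAt.inv (hψ.2.2 _)).contDiffWithinAt convex_univ
    have l5 := (l4.comp (hf.locallyHolderAt x) hx (mapsTo_univ _ _)).abs hx
    have l6 := (l3.mul ((l1.abs hx).rpow (sub_pos.2 hℓ) hx fun _ _ => abs_nonneg _) hx).mul
      (l2.abs hx) hx
    simpa only [Function.comp_apply, abs_inv] using l6.mul l5 hx
  · exact hf.locallyHolderAt_of_deriv_ne_zero hx h0

/-- The extension of `f` from `[a, b]` to the line, constant on both sides, has exactly controlled
slopes. -/
theorem exactSlopeMap (hf : IsC3NonflatIntervalMap f a b) (hex : TopExact f (Icc a b)) :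
    ExactSlopeMap (IccExtend hf.lt.le ((Icc a b).domRestrict f))
      (IccExtend hf.lt.le ((Icc a b).domRestrict fun x => |deriv f x|)) a b := by
  have hval : ∀ g : ℝ → ℝ, EqOn (IccExtend hf.lt.le ((Icc a b).domRestrict g)) g (Icc a b) :=
    fun g x hx => by rw [IccExtend_of_mem _ _ hx, domRestrict_apply]
  have hit : ∀ n, EqOn (IccExtend hf.lt.le ((Icc a b).domRestrict f))^[n] f^[n] (Icc a b) ∧
      MapsTo f^[n] (Icc a b) (Icc a b) := by
    intro n
    refine ⟨fun x hx => ?_, hf.mapsTo.iterate n⟩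
    induction n with
    | zero => rfl
    | succ n ih =>
      rw [Function.iterate_succ_apply', Function.iterate_succ_apply', ih,
        hval f (hf.mapsTo.iterate n hx)]
  refine ⟨hf.lt, (hf.continuousOn.domRestrict).Icc_extend', fun x => hf.mapsTo (projIcc a b _ x).2,
    fun x => abs_nonneg _, (hf.continuousOn_abs_deriv.domRestrict).Icc_extend', ?_, ?_, ?_, ?_⟩
  · have key : ∀ x ∈ Icc a b, ∀ y ∈ Icc a b, x < y →
        ∃ w ∈ Icc x y, |f x - f y| = |deriv f w| * |x - y| := by
      intro x hx y hy hxy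
      have hsub : Icc x y ⊆ Icc a b := Icc_subset_Icc hx.1 hy.2
      obtain ⟨w, hw, h⟩ := exists_deriv_eq_slope f hxy (hf.continuousOn.mono hsub)
        fun z hz => (hf.diff z (hsub (Ioo_subset_Icc_self hz))).differentiableWithinAt
      refine ⟨w, Ioo_subset_Icc_self hw, ?_⟩
      rw [h, abs_div, abs_sub_comm y x, div_mul_cancel₀ _ (abs_ne_zero.2 (sub_ne_zero.2 hxy.ne)),
        abs_sub_comm]
    intro x hx y hy
    rw [hval f hx, hval f hy]
    rcases lt_trichotomy x y with hxy | rfl | hxy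
    · obtain ⟨w, hw, h⟩ := key x hx y hy hxy
      refine ⟨w, Icc_subset_uIcc hw, ?_⟩
      rw [h, hval _ (Icc_subset_Icc hx.1 hy.2 hw)]
    · exact ⟨x, left_mem_uIcc, by simp⟩
    · obtain ⟨w, hw, h⟩ := key y hy x hx hxy
      refine ⟨w, Icc_subset_uIcc' hw, ?_⟩
      rw [abs_sub_comm, h, abs_sub_comm y, hval _ (Icc_subset_Icc hy.1 hx.2 hw)]
  · obtain ⟨C, α, h1, -, h3, h⟩ := hf.holderOn_abs_deriv
    refine ⟨C + 1, α, by positivity, h1, fun x hx y hy => ?_⟩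
    rw [hval _ hx, hval _ hy]
    refine (h x hx y hy).trans ?_
    gcongr
    linarith
  · refine hf.critFinite.subset ?_
    rintro x ⟨hx, h⟩
    rw [hval _ hx, abs_eq_zero] at h
    exact ⟨hx, h⟩
  · intro U hU hne
    obtain ⟨n, hn, h⟩ := hex U hU hne
    exact ⟨n, hn, (image_congr fun x hx => (hit n).1 hx.2).trans h⟩

end IsC3NonflatIntervalMap

theorem HolderOn.continuous_IccExtend {φ : ℝ → ℝ} {a b : ℝ} (hφ : HolderOn φ (Icc a b))
    (hab : a ≤ b) : Continuous (IccExtend hab ((Icc a b).domRestrict φ)) :=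
  hφ.continuousOn.domRestrict.Icc_extend'

theorem InvariantProb.ae_mem_Icc {f : ℝ → ℝ} {a b : ℝ} {ν : Measure ℝ}
    (hν : InvariantProb f (Icc a b) ν) : ∀ᵐ x ∂ν, x ∈ Icc a b := by
  have := hν.1
  exact (mem_ae_iff_prob_eq_one measurableSet_Icc).2 hν.2.1

theorem InvariantProb.measurePreserving_of_eqOn {f T : ℝ → ℝ} {a b : ℝ} {ν : Measure ℝ}
    (hν : InvariantProb f (Icc a b) ν) (hT : Measurable T) (hTf : EqOn T f (Icc a b)) :
    MeasurePreserving T ν ν := by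
  refine ⟨hT, Measure.ext fun A hA => ?_⟩
  rw [Measure.map_apply hT hA, ← hν.2.2 A hA]
  refine measure_congr ?_
  filter_upwards [hν.ae_mem_Icc] with x hx
  exact congrArg (· ∈ A) (hTf hx)

/-- **Proposition (construction of a free IMFS).** Let `f` be a topologically exact `C³`
interval map with non-flat critical points, `φ` Hölder continuous, `t ≥ 0`,
`ψ_t = φ − t ln|f'|`, and `ν` an invariant ergodic probability measure, not supported
on a periodic orbit, with strictly positive Lyapunov exponent. Then there is a full
measure set `X` such that for every `x₀ ∈ X` there are `D > 0`, a compact connected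
`B₀ ∋ x₀`, and a free IMFS on `B₀` with `S_{m_l}(ψ_t)(y) ≥ m_l ∫ ψ_t dν − D` for every
`l` and `y ∈ φ_l(B₀)`. -/
theorem constructing_free_IMFS
    (a b : ℝ) (f : ℝ → ℝ)
    (hf : IsC3NonflatIntervalMap f a b)
    (hex : TopExact f (Icc a b))
    (φ : ℝ → ℝ) (hφ : HolderOn φ (Icc a b)) (t : ℝ) (ht : 0 ≤ t)
    (ν : Measure ℝ) (hν : ErgodicProb f (Icc a b) ν)
    (hnotper : ¬ ∃ p ∈ Icc a b, ∃ N : ℕ, 1 ≤ N ∧ f^[N] p = p ∧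
      ν {y | ∃ i < N, f^[i] p = y} = 1)
    (hχ : 0 < ∫ x, Real.log |deriv f x| ∂ν) :
    ∃ X : Set ℝ, X ⊆ Icc a b ∧ ν X = 1 ∧ ∀ x₀ ∈ X,
      ∃ D : ℝ, 0 < D ∧
      ∃ B₀ : Set ℝ, IsCompact B₀ ∧ IsConnected B₀ ∧ B₀ ⊆ Icc a b ∧ x₀ ∈ B₀ ∧
      ∃ S : IMFS f (Icc a b) B₀, S.Free ∧
        ∀ l : ℕ, ∀ y ∈ S.apply l B₀,
          (S.m l : ℝ) * (∫ x, (φ x - t * Real.log |deriv f x|) ∂ν) - D ≤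
            birkhoffSum f (fun x => φ x - t * Real.log |deriv f x|) (S.m l) y := by
  have hab := hf.lt.le
  have hinv := hν.1
  have : IsProbabilityMeasure ν := hinv.1
  have hval : ∀ g : ℝ → ℝ, EqOn (IccExtend hab ((Icc a b).domRestrict g)) g (Icc a b) :=
    fun g x hx => by rw [IccExtend_of_mem _ _ hx, domRestrict_apply]
  set c := ∫ x, (φ x - t * Real.log |deriv f x|) ∂ν with hc
  have h := hf.exactSlopeMap hex
  set T := IccExtend hab ((Icc a b).domRestrict f) with hT
  set d := IccExtend hab ((Icc a b).domRestrict fun x => |deriv f x|) with hd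
  set Φ : ℝ → ℝ := fun x => IccExtend hab ((Icc a b).domRestrict φ) x - c with hΦ
  have hΦc : Continuous Φ := (hφ.continuous_IccExtend hab).sub continuous_const
  have hΦH : HolderOn Φ (Icc a b) := by
    obtain ⟨C, α, h1, h2, h3, h4⟩ := hφ
    refine ⟨C, α, h1, h2, h3, fun x hx y hy => ?_⟩
    simp only [hΦ, hval φ hx, hval φ hy, sub_sub_sub_cancel_right]
    exact h4 x hx y hy
  have hΦ' : ∀ x ∈ Icc a b,
      Φ x - t * Real.log (d x) = φ x - t * Real.log |deriv f x| - c := fun x hx => by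
    simp only [hΦ, hd, hval _ hx]
    ring
  have hI := hinv.ae_mem_Icc
  have hlog : (fun x => Real.log (d x)) =ᵐ[ν] fun x => Real.log |deriv f x| := by
    filter_upwards [hI] with x hx
    rw [hd, hval _ hx]
  have hχ' : 0 < ∫ x, Real.log (d x) ∂ν := by rwa [integral_congr_ae hlog]
  have hint : Integrable (fun x => Real.log (d x)) ν := by
    by_contra hn
    exact hχ'.ne' (integral_undef hn)
  have hΦint : Integrable Φ ν := by
    obtain ⟨M, hM⟩ := isCompact_Icc.exists_bound_of_continuousOn (s := Icc a b) hΦc.continuousOn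
    exact .of_bound hΦc.aestronglyMeasurable M (hI.mono hM)
  have hgint := hΦint.sub (hint.const_mul t)
  have hae : (fun x => Φ x - t * Real.log (d x)) =ᵐ[ν]
      fun x => φ x - t * Real.log |deriv f x| - c := hI.mono hΦ'
  have hψint : Integrable (fun x => φ x - t * Real.log |deriv f x|) ν := by
    refine ((hgint.congr hae).add (integrable_const c)).congr (Eventually.of_forall fun x => ?_)
    exact sub_add_cancel _ c
  have hg0 : ∫ x, (Φ x - t * Real.log (d x)) ∂ν = 0 := by
    rw [integral_congr_ae hae, integral_sub hψint (integrable_const c), ← hc]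
    simp
  obtain ⟨D, hD⟩ := h.exists_covering hΦc hΦH ht
    (hinv.measurePreserving_of_eqOn h.cont.measurable (hval f)) hI hχ' hgint hg0
  obtain ⟨A, -, hA⟩ := h.exists_potential_lower_bound hΦc ht
  refine ⟨Icc a b, Subset.rfl, hinv.2.1, fun x₀ hx₀ => ?_⟩
  obtain ⟨e, he, w, hw, hxe, D', m, W, hdis, hW⟩ := h.exists_interval_good_pullbacks hA hD hx₀
  have hsub : uIcc e w ⊆ Icc a b := uIcc_subset_Icc he hw
  obtain ⟨S, hS, hsum⟩ := exists_free_IMFS_of_good_pullbacks h.mem (hval f) hΦ' hsub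
    nonempty_uIcc hdis hW
  refine ⟨max D' 1, by positivity, uIcc e w, isCompact_uIcc,
    ⟨nonempty_uIcc, isPreconnected_uIcc⟩, hsub, hxe, S, hS, fun l y hy => ?_⟩
  have h1 := hsum l y hy
  have h2 : birkhoffSum f (fun x => φ x - t * Real.log |deriv f x| - c) (S.m l) y =
      birkhoffSum f (fun x => φ x - t * Real.log |deriv f x|) (S.m l) y - S.m l * c := by
    simp [birkhoffSum, Finset.sum_sub_distrib]
  linarith [le_max_left D' 1]

end
end

section
/- Let I be a compact interval of ℝ, let f: I → I be an interval map of class C^3 with non-flat critical points that is topologically exact, and let x₀ be an interior point of I. Then for every open interval U ⊆ I and every sufficiently large integer n ≥ 1, there exist two distinct points y₁, y₂ of f^{−n}(x₀) in U such that: (1) for every ε > 0 both sets f^n(B(y₁, ε)) and f^n(B(y₂, ε)) intersect (x₀, +∞); and (2) for every ε > 0 both sets f^n(B(y₁, ε)) and f^n(B(y₂, ε)) intersect (−∞, x₀). -/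
open MeasureTheory Filter Set Metric

noncomputable section

/-- If `g` is continuous on `[p, q]`, nowhere locally constant equal to `x`, and `g p < x < g q`,
then `g` takes the value `x` at some point of `(p, q)` near which it takes values on both sides
of `x`. -/
theorem exists_crossing_of_lt {g : ℝ → ℝ} {p q x : ℝ} (hpq : p < q)
    (hg : ContinuousOn g (Icc p q)) (hp : g p < x) (hq : x < g q)
    (hne : ∀ u v, p ≤ u → u < v → v ≤ q → ∃ z ∈ Ioo u v, g z ≠ x) :
    ∃ y ∈ Ioo p q, g y = x ∧ ∀ ε > 0,
      (∃ z ∈ ball y ε ∩ Icc p q, x < g z) ∧ ∃ z ∈ ball y ε ∩ Icc p q, g z < x := by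
  set S : Set ℝ := {t | t ∈ Icc p q ∧ x < g t}
  have hqS : q ∈ S := ⟨right_mem_Icc.2 hpq.le, hq⟩
  have hbdd : BddBelow S := ⟨p, fun t ht => ht.1.1⟩
  set y := sInf S
  have hpy : p ≤ y := le_csInf ⟨q, hqS⟩ fun t ht => ht.1.1
  have hyq : y ≤ q := csInf_le hbdd hqS
  have hge : x ≤ g y := by
    have hcl : IsClosed (Icc p q ∩ g ⁻¹' Ici x) :=
      hg.preimage_isClosed_of_isClosed isClosed_Icc isClosed_Ici
    have hSsub : S ⊆ Icc p q ∩ g ⁻¹' Ici x := fun t ht => ⟨ht.1, ht.2.le⟩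
    exact (closure_minimal hSsub hcl (csInf_mem_closure ⟨q, hqS⟩ hbdd)).2
  have hle : g y ≤ x := by
    by_contra! h
    obtain ⟨t, ht, hgt⟩ := intermediate_value_Icc hpy (hg.mono (Icc_subset_Icc_right hyq))
      (show (x + g y) / 2 ∈ Icc (g p) (g y) by constructor <;> linarith)
    have hyt : y ≤ t := csInf_le hbdd ⟨⟨ht.1, ht.2.trans hyq⟩, by linarith⟩
    rw [le_antisymm ht.2 hyt] at hgt
    linarith
  have hpy' : p < y := hpy.lt_of_ne fun h => by rw [← h] at hge; linarith
  have hyq' : y < q := hyq.lt_of_ne fun h => by rw [h] at hle; linarith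
  refine ⟨y, ⟨hpy', hyq'⟩, le_antisymm hle hge, fun ε hε => ⟨?_, ?_⟩⟩
  · obtain ⟨t, htS, ht⟩ := exists_lt_of_csInf_lt ⟨q, hqS⟩ (show sInf S < y + ε by linarith)
    have hyt : y ≤ t := csInf_le hbdd htS
    refine ⟨t, ⟨?_, htS.1⟩, htS.2⟩
    rw [mem_ball, Real.dist_eq, abs_lt]
    constructor <;> linarith
  · obtain ⟨z, hz, hzx⟩ := hne (max p (y - ε)) y (le_max_left _ _)
      (max_lt hpy' (by linarith)) hyq
    have hz₁ := (le_max_left p (y - ε)).trans_lt hz.1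
    have hz₂ := (le_max_right p (y - ε)).trans_lt hz.1
    have hzI : z ∈ Icc p q := ⟨hz₁.le, hz.2.le.trans hyq⟩
    refine ⟨z, ⟨?_, hzI⟩, lt_of_le_of_ne ?_ hzx⟩
    · rw [mem_ball, Real.dist_eq, abs_lt]
      constructor <;> linarith [hz.2]
    · by_contra! h
      exact hz.2.not_ge (csInf_le hbdd ⟨hzI, h⟩)

/-- A topologically exact map of `I` is onto. -/
theorem TopExact.image_eq {f : ℝ → ℝ} {I : Set ℝ} (hex : TopExact f I) (hI : I.Nonempty)
    (hf : MapsTo f I I) : f '' I = I := by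
  obtain ⟨n, hn, h⟩ := hex univ isOpen_univ (by simpa using hI)
  obtain ⟨m, rfl⟩ := Nat.exists_eq_add_of_le' hn
  rw [univ_inter, Function.iterate_succ', image_comp] at h
  exact hf.image_subset.antisymm (h.ge.trans (image_mono (hf.iterate m).image_subset))

/-- Under a topologically exact map of `I`, every sufficiently high iterate of a nonempty open
subset of `I` is the whole of `I`. -/
theorem TopExact.eventually_image_eq {f : ℝ → ℝ} {I U : Set ℝ} (hex : TopExact f I)
    (hf : MapsTo f I I) (hUo : IsOpen U) (hUI : U ⊆ I) (hU : U.Nonempty) :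
    ∀ᶠ n in atTop, f^[n] '' U = I := by
  obtain ⟨N, -, hN⟩ := hex U hUo (by rwa [inter_eq_left.2 hUI])
  rw [inter_eq_left.2 hUI] at hN
  filter_upwards [eventually_ge_atTop N] with n hn
  induction n, hn using Nat.le_induction with
  | base => exact hN
  | succ n _ ih =>
    rw [Function.iterate_succ', image_comp, ih, hex.image_eq (hU.mono hUI) hf]

/-- No iterate of a topologically exact map of a nontrivial set `I` is constant on a nonempty
open subset of `I`. -/
theorem TopExact.exists_iterate_ne {f : ℝ → ℝ} {I U : Set ℝ} (hex : TopExact f I)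
    (hf : MapsTo f I I) (hI : I.Nontrivial) (hUo : IsOpen U) (hUI : U ⊆ I) (hU : U.Nonempty)
    (n : ℕ) (x : ℝ) : ∃ z ∈ U, f^[n] z ≠ x := by
  by_contra! h
  obtain ⟨m, hm⟩ := eventually_atTop.1 (hex.eventually_image_eq hf hUo hUI hU)
  have hsing : f^[m + n] '' U ⊆ {f^[m] x} := by
    rintro _ ⟨z, hz, rfl⟩
    rw [Function.iterate_add_apply, h z hz, mem_singleton_iff]
  rw [hm _ (Nat.le_add_right m n)] at hsing
  exact hI.not_subset_singleton hsing

/-- Let `f` be a continuous topologically exact map of `[a, b]` and `x` an interior point. For all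
large `n`, every open subinterval contains a point of `f⁻ⁿ(x)` near which `fⁿ` takes values on
both sides of `x`. -/
theorem TopExact.eventually_exists_crossing {f : ℝ → ℝ} {a b x c d : ℝ}
    (hex : TopExact f (Icc a b)) (hf : MapsTo f (Icc a b) (Icc a b))
    (hfc : ContinuousOn f (Icc a b)) (hx : x ∈ Ioo a b) (hcd : c < d)
    (hU : Ioo c d ⊆ Icc a b) :
    ∀ᶠ n in atTop, ∃ y ∈ Ioo c d, f^[n] y = x ∧ ∀ ε > 0,
      (f^[n] '' (ball y ε ∩ Icc a b) ∩ Ioi x).Nonempty ∧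
      (f^[n] '' (ball y ε ∩ Icc a b) ∩ Iio x).Nonempty := by
  have hab : a < b := hx.1.trans hx.2
  have hI : (Icc a b).Nontrivial :=
    ⟨a, left_mem_Icc.2 hab.le, b, right_mem_Icc.2 hab.le, hab.ne⟩
  filter_upwards [hex.eventually_image_eq hf isOpen_Ioo hU (nonempty_Ioo.2 hcd)] with n hn
  have hgc : ContinuousOn f^[n] (Icc a b) := hfc.iterate hf n
  obtain ⟨p, hp, hpa⟩ := hn.ge (left_mem_Icc.2 hab.le)
  obtain ⟨q, hq, hqb⟩ := hn.ge (right_mem_Icc.2 hab.le)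
  have hpx : f^[n] p < x := hpa ▸ hx.1
  have hxq : x < f^[n] q := hqb ▸ hx.2
  have hne : ∀ u v, c < u → u < v → v < d → ∃ z ∈ Ioo u v, f^[n] z ≠ x :=
    fun u v hu huv hv => hex.exists_iterate_ne hf hI isOpen_Ioo
      ((Ioo_subset_Ioo hu.le hv.le).trans hU) (nonempty_Ioo.2 huv) n x
  rcases lt_trichotomy p q with h | h | h
  · have hsub : Icc p q ⊆ Icc a b := (Icc_subset_Ioo hp.1 hq.2).trans hU
    obtain ⟨y, hy, hyx, hy'⟩ := exists_crossing_of_lt h (hgc.mono hsub) hpx hxq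
      fun u v hu huv hv => hne u v (hp.1.trans_le hu) huv (hv.trans_lt hq.2)
    refine ⟨y, ⟨hp.1.trans hy.1, hy.2.trans hq.2⟩, hyx, fun ε hε => ?_⟩
    obtain ⟨⟨z, hz, hzx⟩, w, hw, hwx⟩ := hy' ε hε
    exact ⟨⟨_, mem_image_of_mem _ ⟨hz.1, hsub hz.2⟩, hzx⟩,
      _, mem_image_of_mem _ ⟨hw.1, hsub hw.2⟩, hwx⟩
  · rw [h] at hpx
    exact absurd hpx hxq.not_gt
  · have hsub : Icc q p ⊆ Icc a b := (Icc_subset_Ioo hq.1 hp.2).trans hU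
    obtain ⟨y, hy, hyx, hy'⟩ := exists_crossing_of_lt h (hgc.mono hsub).neg
      (neg_lt_neg hxq) (neg_lt_neg hpx) fun u v hu huv hv =>
        (hne u v (hq.1.trans_le hu) huv (hv.trans_lt hp.2)).imp
          fun z hz => ⟨hz.1, neg_injective.ne hz.2⟩
    refine ⟨y, ⟨hq.1.trans hy.1, hy.2.trans hp.2⟩, neg_injective hyx, fun ε hε => ?_⟩
    obtain ⟨⟨z, hz, hzx⟩, w, hw, hwx⟩ := hy' ε hε
    exact ⟨⟨_, mem_image_of_mem _ ⟨hw.1, hsub hw.2⟩, neg_lt_neg_iff.1 hwx⟩,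
      _, mem_image_of_mem _ ⟨hz.1, hsub hz.2⟩, neg_lt_neg_iff.1 hzx⟩

/-- **Lemma (one-sided covering).** Let `f` be a topologically exact `C³` interval map
with non-flat critical points and `x₀` an interior point of `I`. Then for every nonempty
open interval `U = (c, d) ⊆ I` and every sufficiently large `n ≥ 1` there are two
distinct points `y₁, y₂ ∈ f^{-n}(x₀) ∩ U` such that for every `ε > 0` the sets
`f^n(B(yᵢ, ε))` intersect both `(x₀, +∞)` and `(−∞, x₀)`. -/
theorem one_sided_covering
    (a b : ℝ) (f : ℝ → ℝ)
    (hf : IsC3NonflatIntervalMap f a b)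
    (hex : TopExact f (Icc a b))
    (x₀ : ℝ) (hx₀ : x₀ ∈ Ioo a b)
    (c d : ℝ) (hU : Ioo c d ⊆ Icc a b) (hUne : (Ioo c d).Nonempty) :
    ∃ N : ℕ, 1 ≤ N ∧ ∀ n : ℕ, N ≤ n →
      ∃ y₁ ∈ Ioo c d, ∃ y₂ ∈ Ioo c d, y₁ ≠ y₂ ∧
        f^[n] y₁ = x₀ ∧ f^[n] y₂ = x₀ ∧
        (∀ ε : ℝ, 0 < ε →
          (f^[n] '' (ball y₁ ε ∩ Icc a b) ∩ Ioi x₀).Nonempty ∧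
          (f^[n] '' (ball y₂ ε ∩ Icc a b) ∩ Ioi x₀).Nonempty) ∧
        (∀ ε : ℝ, 0 < ε →
          (f^[n] '' (ball y₁ ε ∩ Icc a b) ∩ Iio x₀).Nonempty ∧
          (f^[n] '' (ball y₂ ε ∩ Icc a b) ∩ Iio x₀).Nonempty) := by
  have hcd : c < d := nonempty_Ioo.1 hUne
  have hfc : ContinuousOn f (Icc a b) := fun x hx => (hf.diff x hx).continuousAt.continuousWithinAt
  obtain ⟨m, hcm, hmd⟩ := exists_between hcd
  obtain ⟨N, hN⟩ := eventually_atTop.1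
    ((hex.eventually_exists_crossing hf.mapsTo hfc hx₀ hcm
      ((Ioo_subset_Ioo_right hmd.le).trans hU)).and
    (hex.eventually_exists_crossing hf.mapsTo hfc hx₀ hmd
      ((Ioo_subset_Ioo_left hcm.le).trans hU)))
  refine ⟨N + 1, Nat.le_add_left 1 N, fun n hn => ?_⟩
  obtain ⟨⟨y₁, hy₁, h₁, h₁'⟩, y₂, hy₂, h₂, h₂'⟩ := hN n (Nat.le_of_succ_le hn)
  exact ⟨y₁, ⟨hy₁.1, hy₁.2.trans hmd⟩, y₂, ⟨hcm.trans hy₂.1, hy₂.2⟩, (hy₁.2.trans hy₂.1).ne,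
    h₁, h₂, fun ε hε => ⟨(h₁' ε hε).1, (h₂' ε hε).1⟩, fun ε hε => ⟨(h₁' ε hε).2, (h₂' ε hε).2⟩⟩

end
end

section
/- Let I be a compact interval of ℝ and let f: I → I be an interval map of class C^3 with non-flat critical points that is topologically exact. Then for every κ > 0 there is δ > 0 such that for every x in I, every integer n ≥ 1, and every pull-back W of B(x, δ) by f^n, we have |W| < κ. -/
open MeasureTheory Filter Set Metric

noncomputable section

theorem exists_pos_le_of_forall_pos (d : ℕ → ℝ) (hd : ∀ k, 0 < d k) (M : ℕ) :
    ∃ δ : ℝ, 0 < δ ∧ ∀ k ≤ M, δ ≤ d k := by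
  obtain ⟨m, -, hm⟩ := (Finset.range (M + 1)).exists_min_image d ⟨0, by simp⟩
  exact ⟨d m, hd m, fun k hk => hm k (by simp; omega)⟩

theorem TopExact.surjOn {f : ℝ → ℝ} {I : Set ℝ} (hex : TopExact f I) (hI : I.Nonempty)
    (hmaps : MapsTo f I I) : SurjOn f I I := by
  obtain ⟨n, hn, h⟩ := hex univ isOpen_univ (by simpa using hI)
  rw [univ_inter] at h
  intro z hz
  rw [← h] at hz
  obtain ⟨u, hu, rfl⟩ := hz
  obtain ⟨m, rfl⟩ := Nat.exists_eq_succ_of_ne_zero (by omega : n ≠ 0)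
  exact ⟨f^[m] u, hmaps.iterate m hu, (Function.iterate_succ_apply' f m u).symm⟩

/-- Under a topologically exact map, the iterates of a nonempty open set are not contained in
arbitrarily small balls. -/
theorem TopExact.exists_not_subset_ball {f : ℝ → ℝ} {I U : Set ℝ} (hex : TopExact f I)
    (hI : I.Nontrivial) (hmaps : MapsTo f I I) (hU : IsOpen U) (hne : (U ∩ I).Nonempty) :
    ∃ δ : ℝ, 0 < δ ∧ ∀ n x, ¬ f^[n] '' (U ∩ I) ⊆ ball x δ := by
  obtain ⟨N, -, hN⟩ := hex U hU hne
  have himage (n : ℕ) : f^[N + n] '' (U ∩ I) = I := by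
    rw [add_comm, Function.iterate_add, image_comp, hN]
    exact ((hex.surjOn hI.nonempty hmaps).iterate n).image_eq_of_mapsTo (hmaps.iterate n)
  have hnontriv (n : ℕ) : (f^[n] '' (U ∩ I)).Nontrivial := by
    refine nontrivial_of_image f^[N] _ ?_
    rw [← image_comp, ← Function.iterate_add, himage]
    exact hI
  choose p hp q hq hpq using hnontriv
  obtain ⟨δ, hδ, hle⟩ := exists_pos_le_of_forall_pos (fun n => dist (p n) (q n) / 2)
    (fun n => half_pos (dist_pos.2 (hpq n))) N
  refine ⟨δ, hδ, fun n x hsub => ?_⟩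
  have key (k : ℕ) (hk : k ≤ N) : ¬ f^[k] '' (U ∩ I) ⊆ ball x δ := fun h => by
    have h1 := mem_ball.1 (h (hp k))
    have h2 := mem_ball.1 (h (hq k))
    have h3 := dist_triangle_right (p k) (q k) x
    have h4 := hle k hk
    linarith
  rcases le_total n N with hn | hn
  · exact key n hn hsub
  · obtain ⟨m, rfl⟩ := Nat.exists_eq_add_of_le hn
    exact key N le_rfl (by rwa [hN, ← himage m])

theorem exists_nat_Ioo_grid_subset_Icc {a p q η : ℝ} (hη : 0 < η) (hap : a ≤ p)
    (hpq : p + 2 * η ≤ q) :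
    ∃ k : ℕ, (k : ℝ) ≤ (p - a) / η + 1 ∧
      Ioo (a + k * η) (a + (k + 1) * η) ⊆ Icc p q := by
  have h0 : 0 ≤ (p - a) / η := div_nonneg (sub_nonneg.2 hap) hη.le
  have h1 := Nat.le_ceil ((p - a) / η)
  have h2 := Nat.ceil_lt_add_one h0
  refine ⟨⌈(p - a) / η⌉₊, h2.le, fun z hz => ?_⟩
  rw [div_le_iff₀ hη] at h1
  rw [← sub_lt_iff_lt_add, lt_div_iff₀ hη] at h2
  constructor <;> nlinarith [hz.1, hz.2]

/-- **Lemma (uniformly small pull-backs).** For a topologically exact `C³` interval map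
with non-flat critical points: for every `κ > 0` there is `δ > 0` such that for every
`x ∈ I`, every `n ≥ 1`, and every pull-back `W` of `B(x, δ)` by `f^n`, `|W| < κ`. -/
theorem small_pullbacks
    (a b : ℝ) (f : ℝ → ℝ)
    (hf : IsC3NonflatIntervalMap f a b)
    (hex : TopExact f (Icc a b)) :
    ∀ κ : ℝ, 0 < κ → ∃ δ : ℝ, 0 < δ ∧
      ∀ x ∈ Icc a b, ∀ n : ℕ, 1 ≤ n → ∀ y : ℝ,
        Metric.diam (connectedComponentIn (f^[n] ⁻¹' (ball x δ ∩ Icc a b) ∩ Icc a b) y)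
          < κ := by
  intro κ hκ
  set η := κ / 4 with hη_def
  have hη : 0 < η := by positivity
  set J : ℕ → Set ℝ := fun k => Ioo (a + k * η) (a + (k + 1) * η) with hJ
  have hball (k : ℕ) : ∃ δ : ℝ, 0 < δ ∧ ((J k ∩ Icc a b).Nonempty →
      ∀ n x, ¬ f^[n] '' (J k ∩ Icc a b) ⊆ ball x δ) := by
    by_cases hne : (J k ∩ Icc a b).Nonempty
    · obtain ⟨δ, hδ, h⟩ := hex.exists_not_subset_ball
        (Set.nontrivial_of_lt (left_mem_Icc.2 hf.lt.le) (right_mem_Icc.2 hf.lt.le) hf.lt)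
        hf.mapsTo isOpen_Ioo hne
      exact ⟨δ, hδ, fun _ => h⟩
    · exact ⟨1, one_pos, fun h => absurd h hne⟩
  choose d hd hsub using hball
  obtain ⟨δ, hδ, hle⟩ := exists_pos_le_of_forall_pos d hd ⌈(b - a) / η + 1⌉₊
  refine ⟨δ, hδ, fun x _ n _ y => ?_⟩
  set S := f^[n] ⁻¹' (ball x δ ∩ Icc a b) ∩ Icc a b with hS
  set W := connectedComponentIn S y with hW
  have hWS : W ⊆ S := connectedComponentIn_subset S y
  have hconn : W.OrdConnected := isPreconnected_connectedComponentIn.ordConnected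
  have hshort : ∀ p ∈ W, ∀ q ∈ W, q ≤ p + 2 * η := by
    intro p hp q hq
    by_contra! hlt
    obtain ⟨k, hk, hkpq⟩ := exists_nat_Ioo_grid_subset_Icc hη (hWS hp).2.1 hlt.le
    have hJW : J k ⊆ W := hkpq.trans (hconn.out hp hq)
    have hne : (J k).Nonempty := nonempty_Ioo.2 (by nlinarith)
    have hkM : k ≤ ⌈(b - a) / η + 1⌉₊ := by
      have h : (p - a) / η ≤ (b - a) / η := by
        gcongr
        exact (hWS hp).2.2
      exact_mod_cast (hk.trans (by linarith)).trans (Nat.le_ceil ((b - a) / η + 1))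
    refine hsub k (hne.mono fun z hz => ⟨hz, (hWS (hJW hz)).2⟩) n x ?_
    rintro _ ⟨z, hz, rfl⟩
    exact ball_subset_ball (hle k hkM) (hWS (hJW hz.1)).1.1
  refine (Metric.diam_le_of_forall_dist_le (C := 2 * η) (by positivity) fun p hp q hq => ?_).trans_lt
    (by linarith)
  rw [Real.dist_eq, abs_le]
  constructor <;> linarith [hshort p hp q hq, hshort q hq p hp]

end
end

section
/- Let I be a compact interval of ℝ and let f: I → I be an interval map of class C^3 with non-flat critical points that is topologically exact. Then for every Hölder continuous function φ: I → ℝ and every hyperbolic repelling periodic point x₀ of f of period N, we have limsup_{n→∞} (1/n) log Σ_{y ∈ f^{−n}(x₀)} exp(S_n(φ)(y)) > (1/N) S_N(φ)(x₀). -/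
open MeasureTheory Filter Set Metric

noncomputable section

/-- `Σ_{y ∈ f^{-n}(x₀) ∩ I} exp(Sₙ(φ)(y))`, as a finite sum (`finsum`);
for interval maps in our class each preimage set is finite. -/
def preimSum (f φ : ℝ → ℝ) (I : Set ℝ) (n : ℕ) (x₀ : ℝ) : ℝ :=
  ∑ᶠ y ∈ {y | y ∈ I ∧ f^[n] y = x₀}, Real.exp (birkhoffSum f φ n y)

section Iterates

variable {a b : ℝ} {f : ℝ → ℝ}

theorem IsC3NonflatIntervalMap.iterate_mem (hf : IsC3NonflatIntervalMap f a b) (n : ℕ) {x : ℝ}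
    (hx : x ∈ Icc a b) : f^[n] x ∈ Icc a b :=
  hf.mapsTo.iterate n hx

theorem IsC3NonflatIntervalMap.continuousOn_iterate (hf : IsC3NonflatIntervalMap f a b) (n : ℕ) :
    ContinuousOn f^[n] (Icc a b) :=
  ContinuousOn.iterate (fun x hx => (hf.diff x hx).continuousAt.continuousWithinAt) hf.mapsTo n

theorem IsC3NonflatIntervalMap.hasDerivAt_iterate (hf : IsC3NonflatIntervalMap f a b) (n : ℕ)
    {x : ℝ} (hx : x ∈ Icc a b) :
    HasDerivAt f^[n] (∏ i ∈ Finset.range n, deriv f (f^[i] x)) x := by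
  induction n with
  | zero => simpa using hasDerivAt_id x
  | succ n ih =>
    rw [Finset.prod_range_succ, mul_comm, Function.iterate_succ']
    exact (hf.diff _ (hf.iterate_mem n hx)).hasDerivAt.comp x ih

/-- By Rolle's theorem, the fibres of `f` are finite, with a uniform bound on their size. -/
theorem IsC3NonflatIntervalMap.exists_finset_fibre (hf : IsC3NonflatIntervalMap f a b) (x : ℝ) :
    ∃ s : Finset ℝ, (∀ y, y ∈ s ↔ y ∈ Icc a b ∧ f y = x) ∧
      s.card ≤ hf.critFinite.toFinset.card + 1 := by
  have card_le : ∀ s : Finset ℝ, (∀ y ∈ s, y ∈ Icc a b ∧ f y = x) →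
      s.card ≤ hf.critFinite.toFinset.card + 1 := by
    intro s hs
    refine Finset.card_le_of_interleaved fun y hy z hz hyz _ => ?_
    obtain ⟨hyI, hfy⟩ := hs y hy
    obtain ⟨hzI, hfz⟩ := hs z hz
    have hsub : Icc y z ⊆ Icc a b := Icc_subset_Icc hyI.1 hzI.2
    obtain ⟨c, hc, hc'⟩ := exists_deriv_eq_zero hyz
      (fun w hw => (hf.diff w (hsub hw)).continuousAt.continuousWithinAt) (hfy.trans hfz.symm)
    exact ⟨c, by simpa [hc'] using hsub (Ioo_subset_Icc_self hc), hc.1, hc.2⟩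
  have hfin : {y | y ∈ Icc a b ∧ f y = x}.Finite := by
    by_contra hinf
    obtain ⟨t, ht, hcard⟩ := Set.Infinite.exists_subset_card_eq hinf
      (hf.critFinite.toFinset.card + 2)
    have := card_le t fun y hy => ht hy
    omega
  refine ⟨hfin.toFinset, fun y => by simp, card_le _ fun y hy => by simpa using hy⟩

theorem IsC3NonflatIntervalMap.exists_finset_iterate_fibre (hf : IsC3NonflatIntervalMap f a b)
    {x : ℝ} (hx : x ∈ Icc a b) (n : ℕ) :
    ∃ s : Finset ℝ, (∀ y, y ∈ s ↔ y ∈ Icc a b ∧ f^[n] y = x) ∧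
      s.card ≤ (hf.critFinite.toFinset.card + 1) ^ n := by
  classical
  induction n with
  | zero =>
    refine ⟨{x}, fun y => ?_, by simp⟩
    simp only [Finset.mem_singleton, Function.iterate_zero, id_eq]
    exact ⟨fun h => ⟨h ▸ hx, h⟩, fun h => h.2⟩
  | succ n ih =>
    obtain ⟨s, hs, hcard⟩ := ih
    choose t ht htcard using hf.exists_finset_fibre
    refine ⟨s.biUnion t, fun y => ?_, ?_⟩
    · simp only [Finset.mem_biUnion, ht, hs, Function.iterate_succ, Function.comp_apply]
      constructor
      · rintro ⟨z, ⟨-, hz⟩, hy, rfl⟩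
        exact ⟨hy, hz⟩
      · rintro ⟨hy, h⟩
        exact ⟨f y, ⟨hf.mapsTo hy, h⟩, hy, rfl⟩
    · calc (s.biUnion t).card ≤ s.card * (hf.critFinite.toFinset.card + 1) :=
            Finset.card_biUnion_le_card_mul _ _ _ fun z _ => htcard z
        _ ≤ _ := by rw [pow_succ]; gcongr

end Iterates

section Potential

variable {a b : ℝ} {f φ : ℝ → ℝ}

theorem HolderOn.exists_abs_le (hφ : HolderOn φ (Icc a b)) :
    ∃ B : ℝ, 0 ≤ B ∧ ∀ x ∈ Icc a b, |φ x| ≤ B := by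
  obtain ⟨C, α, hα, -, hC, h⟩ := hφ
  refine ⟨|φ a| + C * |b - a| ^ α, by positivity, fun x hx => ?_⟩
  have h1 := h x hx a ⟨le_rfl, hx.1.trans hx.2⟩
  have h2 : |x - a| ≤ |b - a| := by
    rw [abs_of_nonneg (by linarith [hx.1]), abs_of_nonneg (by linarith [hx.1, hx.2])]
    linarith [hx.2]
  have h3 : C * |x - a| ^ α ≤ C * |b - a| ^ α := by gcongr
  have h4 := abs_sub_abs_le_abs_sub (φ x) (φ a)
  linarith

theorem abs_birkhoffSum_le {I : Set ℝ} {B : ℝ} (hI : MapsTo f I I) (hB : ∀ x ∈ I, |φ x| ≤ B)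
    (n : ℕ) {x : ℝ} (hx : x ∈ I) : |birkhoffSum f φ n x| ≤ n * B := by
  refine (Finset.abs_sum_le_sum_abs _ _).trans ?_
  simpa using Finset.sum_le_card_nsmul (Finset.range n) (fun i => |φ (f^[i] x)|) B
    fun i _ => hB _ (hI.iterate i hx)

/-- Near a point, the Birkhoff sums of a Hölder potential are Hölder from below. -/
theorem IsC3NonflatIntervalMap.birkhoffSum_lower (hf : IsC3NonflatIntervalMap f a b)
    {C α x₀ : ℝ} (hα : 0 < α) (hC : 0 ≤ C)
    (hφ : ∀ x ∈ Icc a b, ∀ y ∈ Icc a b, |φ x - φ y| ≤ C * |x - y| ^ α)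
    (hx₀ : x₀ ∈ Icc a b) (n : ℕ) :
    ∃ E : ℝ, 0 ≤ E ∧ ∀ᶠ y in nhds x₀, y ∈ Icc a b →
      birkhoffSum f φ n x₀ - E * |y - x₀| ^ α ≤ birkhoffSum f φ n y := by
  induction n with
  | zero => exact ⟨0, le_rfl, by simp⟩
  | succ n ih =>
    obtain ⟨E, hE, h⟩ := ih
    obtain ⟨L, hL, hbig⟩ :=
      (hf.hasDerivAt_iterate n hx₀).differentiableAt.isBigO_sub.exists_pos
    refine ⟨E + C * L ^ α, by positivity, ?_⟩
    filter_upwards [h, hbig.bound] with y hy hLy hyI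
    have h1 := hy hyI
    have h2 := (abs_le.1 (hφ _ (hf.iterate_mem n hyI) _ (hf.iterate_mem n hx₀))).1
    have h3 : |f^[n] y - f^[n] x₀| ^ α ≤ L ^ α * |y - x₀| ^ α := by
      rw [← Real.mul_rpow hL.le (abs_nonneg _)]
      exact Real.rpow_le_rpow (abs_nonneg _) (by simpa using hLy) hα.le
    have h4 := mul_le_mul_of_nonneg_left h3 hC
    rw [birkhoffSum_succ, birkhoffSum_succ]
    nlinarith

theorem preimSum_isBoundedUnder (hf : IsC3NonflatIntervalMap f a b) (hφ : HolderOn φ (Icc a b))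
    {x₀ : ℝ} (hx₀ : x₀ ∈ Icc a b) :
    atTop.IsBoundedUnder (· ≤ ·)
      (fun n : ℕ => Real.log (preimSum f φ (Icc a b) n x₀) / n) := by
  obtain ⟨B, hB0, hB⟩ := hφ.exists_abs_le
  set d : ℕ := hf.critFinite.toFinset.card + 1
  have hd : (1 : ℝ) ≤ d := by simp [d]
  refine isBoundedUnder_of ⟨Real.log d + B, fun n => ?_⟩
  have hrhs : 0 ≤ Real.log d + B := add_nonneg (Real.log_nonneg hd) hB0
  refine div_le_of_le_mul₀ n.cast_nonneg hrhs ?_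
  obtain ⟨s, hs, hcard⟩ := hf.exists_finset_iterate_fibre hx₀ n
  have hsum : preimSum f φ (Icc a b) n x₀ = ∑ y ∈ s, Real.exp (birkhoffSum f φ n y) := by
    have : {y | y ∈ Icc a b ∧ f^[n] y = x₀} = (s : Set ℝ) := by ext y; simp [hs]
    rw [preimSum, this, finsum_mem_coe_finset]
  have hle : preimSum f φ (Icc a b) n x₀ ≤ (d * Real.exp B) ^ n := by
    rw [hsum]
    calc ∑ y ∈ s, Real.exp (birkhoffSum f φ n y) ≤ s.card • Real.exp (n * B) :=
          Finset.sum_le_card_nsmul _ _ _ fun y hy => Real.exp_le_exp.2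
            ((abs_le.1 (abs_birkhoffSum_le hf.mapsTo hB n ((hs y).1 hy).1)).2)
      _ ≤ (d : ℝ) ^ n * Real.exp (n * B) := by
          rw [nsmul_eq_mul]
          gcongr
          exact_mod_cast hcard
      _ = _ := by rw [mul_pow, Real.exp_nat_mul]
  have h0 : 0 ≤ preimSum f φ (Icc a b) n x₀ := by rw [hsum]; positivity
  rcases h0.eq_or_lt with h0 | h0
  · rw [← h0, Real.log_zero]; positivity
  · calc _ ≤ Real.log ((d * Real.exp B) ^ n) := Real.log_le_log h0 hle
      _ = _ := by
        rw [Real.log_pow, Real.log_mul (by positivity) (by positivity), Real.log_exp, mul_comm]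

end Potential

/-- If every point of `J` has two distinct `f^[n]`-preimages in `J`, one of weight at least `A` and
one of weight at least `A * η`, then `f^[n * m]`-preimages have total weight at least
`(A * (1 + η)) ^ m`. -/
theorem exists_finset_sum_exp_birkhoffSum_ge {f φ u : ℝ → ℝ} {J : Set ℝ} {n : ℕ} {A η : ℝ}
    (hA : 0 ≤ A) (hη : 0 ≤ η)
    (h : ∀ x ∈ J, ∃ y ∈ J, ∃ z ∈ J, y ≠ z ∧ f^[n] y = x ∧ f^[n] z = x ∧
      A * Real.exp (-u x) ≤ Real.exp (birkhoffSum f φ n y - u y) ∧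
      A * η * Real.exp (-u x) ≤ Real.exp (birkhoffSum f φ n z - u z)) (m : ℕ) :
    ∀ x ∈ J, ∃ s : Finset ℝ, (∀ y ∈ s, y ∈ J ∧ f^[n * m] y = x) ∧
      (A * (1 + η)) ^ m * Real.exp (-u x) ≤
        ∑ y ∈ s, Real.exp (birkhoffSum f φ (n * m) y - u y) := by
  classical
  induction m with
  | zero => exact fun x hx => ⟨{x}, by simpa using hx, by simp⟩
  | succ m ih =>
    intro x hx
    obtain ⟨y, hy, z, hz, hyz, hfy, hfz, hwy, hwz⟩ := h x hx
    obtain ⟨s, hs, hsum⟩ := ih y hy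
    obtain ⟨t, ht, htsum⟩ := ih z hz
    have key : ∀ (r : Finset ℝ) (w : ℝ), (∀ v ∈ r, v ∈ J ∧ f^[n * m] v = w) →
        ∑ v ∈ r, Real.exp (birkhoffSum f φ (n * (m + 1)) v - u v) =
          Real.exp (birkhoffSum f φ n w) *
            ∑ v ∈ r, Real.exp (birkhoffSum f φ (n * m) v - u v) := by
      intro r w hr
      rw [Finset.mul_sum]
      refine Finset.sum_congr rfl fun v hv => ?_
      rw [← Real.exp_add, mul_add, mul_one, birkhoffSum_add, (hr v hv).2]
      ring_nf
    have hiter : ∀ v w, f^[n * m] v = w → f^[n * (m + 1)] v = f^[n] w := by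
      rintro v w rfl
      rw [mul_add, mul_one, add_comm, Function.iterate_add_apply]
    refine ⟨s ∪ t, fun v hv => ?_, ?_⟩
    · rcases Finset.mem_union.1 hv with hv | hv
      · exact ⟨(hs v hv).1, (hiter v y (hs v hv).2).trans hfy⟩
      · exact ⟨(ht v hv).1, (hiter v z (ht v hv).2).trans hfz⟩
    · have hdisj : Disjoint s t := Finset.disjoint_left.2 fun v hv hv' =>
        hyz ((hs v hv).2.symm.trans (ht v hv').2)
      rw [Finset.sum_union hdisj, key s y hs, key t z ht]
      have hP : 0 ≤ (A * (1 + η)) ^ m := by positivity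
      have split : ∀ w, Real.exp (birkhoffSum f φ n w) * ((A * (1 + η)) ^ m * Real.exp (-u w)) =
          (A * (1 + η)) ^ m * Real.exp (birkhoffSum f φ n w - u w) := by
        intro w
        rw [sub_eq_add_neg, Real.exp_add]
        ring
      have h1 := mul_le_mul_of_nonneg_left hsum (Real.exp_pos (birkhoffSum f φ n y)).le
      have h2 := mul_le_mul_of_nonneg_left htsum (Real.exp_pos (birkhoffSum f φ n z)).le
      rw [split] at h1 h2
      have h3 := mul_le_mul_of_nonneg_left hwy hP
      have h4 := mul_le_mul_of_nonneg_left hwz hP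
      calc _ = (A * (1 + η)) ^ m * (A * Real.exp (-u x)) +
            (A * (1 + η)) ^ m * (A * η * Real.exp (-u x)) := by ring
        _ ≤ _ := by linarith

section LocalInverse

/-- A contracting local inverse branch that does not lose weight can be iterated. -/
theorem exists_iterate_preimage {f φ u : ℝ → ℝ} {J : Set ℝ} {N : ℕ} {x₀ θ S : ℝ} (hθ : 0 ≤ θ)
    (h : ∀ x ∈ J, ∃ y ∈ J, f^[N] y = x ∧ |y - x₀| ≤ θ * |x - x₀| ∧
      S - u x ≤ birkhoffSum f φ N y - u y) (k : ℕ) :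
    ∀ x ∈ J, ∃ y ∈ J, f^[N * k] y = x ∧ |y - x₀| ≤ θ ^ k * |x - x₀| ∧
      k * S - u x ≤ birkhoffSum f φ (N * k) y - u y := by
  induction k with
  | zero => exact fun x hx => ⟨x, hx, by simp⟩
  | succ k ih =>
    intro x hx
    obtain ⟨y, hy, hfy, hyd, hyS⟩ := h x hx
    obtain ⟨z, hz, hfz, hzd, hzS⟩ := ih y hy
    refine ⟨z, hz, ?_, ?_, ?_⟩
    · rw [mul_add, mul_one, add_comm, Function.iterate_add_apply, hfz, hfy]
    · calc |z - x₀| ≤ θ ^ k * (θ * |x - x₀|) := hzd.trans (by gcongr)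
        _ = _ := by ring
    · rw [mul_add, mul_one, birkhoffSum_add, hfz]
      push_cast
      linarith

/-- A continuous map that expands away from a fixed point `x₀`, preserving sides, has a
contracting inverse branch near `x₀`. -/
theorem exists_preimage_of_expanding {T : ℝ → ℝ} {a b x₀ δ μ : ℝ} (hx₀ : x₀ ∈ Icc a b)
    (hT : ContinuousOn T (Icc a b)) (hfix : T x₀ = x₀) (hμ : 1 < μ)
    (hexp : ∀ y, |y - x₀| < δ → μ * (y - x₀) ^ 2 ≤ (T y - x₀) * (y - x₀))
    {x : ℝ} (hx : x ∈ Icc a b) (hxδ : |x - x₀| < δ) :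
    ∃ y ∈ Icc a b, T y = x ∧ |y - x₀| ≤ μ⁻¹ * |x - x₀| := by
  have hμ0 : 0 < μ := by linarith
  have hsub : uIcc x₀ x ⊆ Icc a b := uIcc_subset_Icc hx₀ hx
  have hmem : x ∈ uIcc (T x₀) (T x) := by
    have hex := hexp x hxδ
    rw [hfix]
    rcases lt_trichotomy x x₀ with hlt | rfl | hlt
    · rw [mem_uIcc]; right; exact ⟨by nlinarith, hlt.le⟩
    · exact left_mem_uIcc
    · rw [mem_uIcc]; left; exact ⟨hlt.le, by nlinarith⟩
  obtain ⟨y, hy, rfl⟩ := intermediate_value_uIcc (hT.mono hsub) hmem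
  refine ⟨y, hsub hy, rfl, ?_⟩
  have hyδ : |y - x₀| < δ := lt_of_le_of_lt (abs_sub_left_of_mem_uIcc hy) hxδ
  have hex := hexp y hyδ
  rw [inv_mul_eq_div, le_div_iff₀ hμ0]
  rcases (abs_nonneg (y - x₀)).eq_or_lt with h0 | h0
  · rw [← h0, zero_mul]; positivity
  · have h1 : (T y - x₀) * (y - x₀) ≤ |T y - x₀| * |y - x₀| := by
      rw [← abs_mul]; exact le_abs_self _
    rw [← sq_abs] at hex
    refine le_of_mul_le_mul_right ?_ h0
    linarith [hex, h1, sq (|y - x₀|), mul_assoc (|y - x₀|) μ (|y - x₀|),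
      mul_comm (|y - x₀|) μ, mul_assoc μ (|y - x₀|) (|y - x₀|)]

theorem HasDerivAt.eventually_expanding {T : ℝ → ℝ} {x₀ D μ : ℝ} (hT : HasDerivAt T D x₀)
    (hfix : T x₀ = x₀) (hμ : μ < D) :
    ∀ᶠ y in nhds x₀, μ * (y - x₀) ^ 2 ≤ (T y - x₀) * (y - x₀) := by
  have hε : 0 < D - μ := by linarith
  filter_upwards [(hasDerivAt_iff_isLittleO.1 hT).def hε] with y hy
  rw [hfix, Real.norm_eq_abs, Real.norm_eq_abs, smul_eq_mul] at hy
  have h1 := mul_le_mul_of_nonneg_right hy (abs_nonneg (y - x₀))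
  rw [← abs_mul, mul_assoc, ← sq, sq_abs] at h1
  nlinarith [(abs_le.1 h1).1]

end LocalInverse

section Exact

variable {a b : ℝ} {f : ℝ → ℝ}

/-- In a topologically exact system, an open set meeting `I` covers `I` at all large times. -/
theorem TopExact.exists_forall_ge {I : Set ℝ} (hI : MapsTo f I I) (hex : TopExact f I)
    {U : Set ℝ} (hU : IsOpen U) (hUI : (U ∩ I).Nonempty) :
    ∃ n₀ : ℕ, ∀ n ≥ n₀, I ⊆ f^[n] '' (U ∩ I) := by
  obtain ⟨n₀, hn₀, himg⟩ := hex U hU hUI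
  have hsurj : SurjOn f I I := by
    intro x hx
    obtain ⟨y, hy, rfl⟩ := himg.superset hx
    refine ⟨f^[n₀ - 1] y, hI.iterate _ hy.2, ?_⟩
    rw [← Function.iterate_succ_apply' f, Nat.succ_eq_add_one, Nat.sub_add_cancel hn₀]
  refine ⟨n₀, fun n hn x hx => ?_⟩
  obtain ⟨z, hz, hzx⟩ := hsurj.iterate (n - n₀) hx
  obtain ⟨y, hy, rfl⟩ := himg.superset hz
  refine ⟨y, hy, ?_⟩
  rw [← hzx, ← Function.iterate_add_apply, Nat.sub_add_cancel hn]

theorem exists_mem_Icc_ne_abs_sub_lt {x₀ δ : ℝ} (hab : a < b) (hx₀ : x₀ ∈ Icc a b) (hδ : 0 < δ) :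
    ∃ p ∈ Icc a b, p ≠ x₀ ∧ |p - x₀| < δ := by
  rcases hx₀.2.lt_or_eq with h | h
  · obtain ⟨p, hp1, hp2⟩ := exists_between (lt_min h (lt_add_of_pos_right x₀ hδ))
    have := lt_min_iff.1 hp2
    refine ⟨p, ⟨hx₀.1.trans hp1.le, this.1.le⟩, hp1.ne', ?_⟩
    rw [abs_lt]; constructor <;> linarith
  · obtain ⟨p, hp1, hp2⟩ := exists_between
      (max_lt (h ▸ hab : a < x₀) (sub_lt_self x₀ hδ))
    have := max_lt_iff.1 hp1
    refine ⟨p, ⟨this.1.le, hp2.le.trans hx₀.2⟩, hp2.ne, ?_⟩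
    rw [abs_lt]; constructor <;> linarith

end Exact

/-- Near a repelling, orientation-preserving fixed point of `f^[N]`, exactness yields a horseshoe
whose weights beat the weight of the fixed point. -/
theorem exists_horseshoe {a b : ℝ} {f φ : ℝ → ℝ}
    (hf : IsC3NonflatIntervalMap f a b) (hex : TopExact f (Icc a b)) (hφ : HolderOn φ (Icc a b))
    {x₀ : ℝ} (hx₀ : x₀ ∈ Icc a b) {N : ℕ} (hN : 1 ≤ N) (hper : f^[N] x₀ = x₀)
    {D : ℝ} (hD : HasDerivAt f^[N] D x₀) (hD1 : 1 < D) :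
    ∃ k : ℕ, 1 ≤ k ∧ ∃ η : ℝ, 0 < η ∧ ∃ u : ℝ → ℝ, u x₀ = 0 ∧ (∀ x, 0 ≤ u x) ∧
      ∃ J ⊆ Icc a b, x₀ ∈ J ∧ ∀ x ∈ J, ∃ y ∈ J, ∃ z ∈ J, y ≠ z ∧
        f^[N * k] y = x ∧ f^[N * k] z = x ∧
        Real.exp (k * birkhoffSum f φ N x₀) * Real.exp (-u x) ≤
          Real.exp (birkhoffSum f φ (N * k) y - u y) ∧
        Real.exp (k * birkhoffSum f φ N x₀) * η * Real.exp (-u x) ≤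
          Real.exp (birkhoffSum f φ (N * k) z - u z) := by
  obtain ⟨B, hB0, hB⟩ := hφ.exists_abs_le
  obtain ⟨C, α, hα, -, hC, hHol⟩ := hφ
  obtain ⟨μ, hμ1, hμD⟩ := exists_between hD1
  obtain ⟨E, hE, hlow⟩ := hf.birkhoffSum_lower hα hC hHol hx₀ N
  obtain ⟨δ, hδ, hδ'⟩ := Metric.eventually_nhds_iff.1
    (hlow.and (hD.eventually_expanding hper hμD))
  simp only [Real.dist_eq] at hδ'
  have hμ0 : 0 < μ := by linarith
  have hθ0 : 0 ≤ μ⁻¹ := by positivity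
  have hθ1 : μ⁻¹ < 1 := inv_lt_one_of_one_lt₀ hμ1
  set q : ℝ := μ⁻¹ ^ α with hq
  have hq0 : 0 ≤ q := by positivity
  have hq1 : q < 1 := Real.rpow_lt_one hθ0 hθ1 hα
  set K : ℝ := E * q / (1 - q) with hK
  have hK0 : 0 ≤ K := div_nonneg (by positivity) (by linarith)
  have hKq : (E + K) * q = K := by
    have : (1 - q) ≠ 0 := by linarith
    rw [hK]; field_simp; ring
  set u : ℝ → ℝ := fun x => K * |x - x₀| ^ α with hu
  set S : ℝ := birkhoffSum f φ N x₀ with hS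
  set J : Set ℝ := {x | x ∈ Icc a b ∧ |x - x₀| < δ} with hJ
  have hstep : ∀ x ∈ J, ∃ y ∈ J, f^[N] y = x ∧ |y - x₀| ≤ μ⁻¹ * |x - x₀| ∧
      S - u x ≤ birkhoffSum f φ N y - u y := by
    rintro x ⟨hxI, hxδ⟩
    obtain ⟨y, hyI, hfy, hyd⟩ := exists_preimage_of_expanding hx₀ (hf.continuousOn_iterate N)
      hper hμ1 (fun y hy => (hδ' hy).2) hxI hxδ
    have hyδ : |y - x₀| < δ :=
      (hyd.trans (mul_le_of_le_one_left (abs_nonneg _) hθ1.le)).trans_lt hxδ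
    refine ⟨y, ⟨hyI, hyδ⟩, hfy, hyd, ?_⟩
    have h1 := (hδ' hyδ).1 hyI
    have h2 : |y - x₀| ^ α ≤ q * |x - x₀| ^ α := by
      rw [hq, ← Real.mul_rpow hθ0 (abs_nonneg _)]
      exact Real.rpow_le_rpow (abs_nonneg _) hyd hα.le
    have h3 : (E + K) * |y - x₀| ^ α ≤ K * |x - x₀| ^ α := by
      calc _ ≤ (E + K) * (q * |x - x₀| ^ α) := by gcongr
        _ = (E + K) * q * |x - x₀| ^ α := by ring
        _ = _ := by rw [hKq]
    simp only [hu]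
    linarith
  obtain ⟨p, hpI, hpne, hpδ⟩ := exists_mem_Icc_ne_abs_sub_lt hf.lt hx₀ hδ
  have hp0 : 0 < |p - x₀| := abs_pos.2 (sub_ne_zero.2 hpne)
  set U : Set ℝ := {x | |p - x₀| / 2 < |x - x₀| ∧ |x - x₀| < δ} with hU
  have hUo : IsOpen U :=
    isOpen_Ioo.preimage (f := fun x : ℝ => |x - x₀|) (by fun_prop)
  obtain ⟨n₀, hn₀⟩ := hex.exists_forall_ge hf.mapsTo hUo ⟨p, ⟨half_lt_self hp0, hpδ⟩, hpI⟩
  have hlim : Tendsto (fun k : ℕ => μ⁻¹ ^ k * δ) atTop (nhds 0) := by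
    simpa using (tendsto_pow_atTop_nhds_zero_of_lt_one hθ0 hθ1).mul_const δ
  obtain ⟨k, hkδ, hkn⟩ := ((hlim.eventually_lt_const (half_pos hp0)).and
    (eventually_ge_atTop (n₀ + 1))).exists
  have hkN : n₀ ≤ N * k := by nlinarith
  refine ⟨k, by omega, Real.exp (-(k * S + (N * k : ℕ) * B + K * δ ^ α)), Real.exp_pos _, u, ?_,
    fun x => by positivity, J, fun x hx => hx.1, ⟨hx₀, by simpa using hδ⟩, fun x hx => ?_⟩
  · simp [hu, Real.zero_rpow hα.ne']
  obtain ⟨y, hyJ, hfy, hyd, hyS⟩ := exists_iterate_preimage hθ0 hstep k x hx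
  obtain ⟨z, ⟨hzU, hzI⟩, hfz⟩ := hn₀ _ hkN hx.1
  refine ⟨y, hyJ, z, ⟨hzI, hzU.2⟩, ?_, hfy, hfz, ?_, ?_⟩
  · rintro rfl
    have : μ⁻¹ ^ k * |x - x₀| ≤ μ⁻¹ ^ k * δ := by
      gcongr
      exact hx.2.le
    linarith [hzU.1]
  · rw [← Real.exp_add]
    exact Real.exp_le_exp.2 (by linarith)
  · rw [← Real.exp_add, ← Real.exp_add]
    refine Real.exp_le_exp.2 ?_
    have h1 := (abs_le.1 (abs_birkhoffSum_le hf.mapsTo hB (N * k) hzI)).1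
    have h2 : u z ≤ K * δ ^ α :=
      mul_le_mul_of_nonneg_left (Real.rpow_le_rpow (abs_nonneg _) hzU.2.le hα.le) hK0
    have h3 : 0 ≤ u x := by positivity
    linarith

theorem lt_limsup_log_preimSum {a b : ℝ} {f φ : ℝ → ℝ}
    (hf : IsC3NonflatIntervalMap f a b) (hex : TopExact f (Icc a b)) (hφ : HolderOn φ (Icc a b))
    {x₀ : ℝ} (hx₀ : x₀ ∈ Icc a b) {N : ℕ} (hN : 1 ≤ N) (hper : f^[N] x₀ = x₀)
    {D : ℝ} (hD : HasDerivAt f^[N] D x₀) (hD1 : 1 < D) :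
    birkhoffSum f φ N x₀ / N <
      atTop.limsup (fun n : ℕ => Real.log (preimSum f φ (Icc a b) n x₀) / n) := by
  obtain ⟨k, hk, η, hη, u, hu0, hu, J, hJI, hJ, h⟩ :=
    exists_horseshoe hf hex hφ hx₀ hN hper hD hD1
  have hN' : (0 : ℝ) < N := by exact_mod_cast hN
  have hk' : (0 : ℝ) < k := by exact_mod_cast hk
  set S : ℝ := birkhoffSum f φ N x₀ with hS
  have hlog : 0 < Real.log (1 + η) := Real.log_pos (by linarith)
  suffices hfreq : ∃ᶠ n : ℕ in atTop, S / N + Real.log (1 + η) / (N * k) ≤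
      Real.log (preimSum f φ (Icc a b) n x₀) / n by
    refine lt_of_lt_of_le (lt_add_of_pos_right _ (by positivity))
      (le_limsup_of_frequently_le hfreq (preimSum_isBoundedUnder hf hφ hx₀))
  refine frequently_atTop.2 fun n => ⟨N * k * (n + 1), by nlinarith [Nat.mul_pos hN hk], ?_⟩
  generalize hm : n + 1 = m
  have hm' : (0 : ℝ) < m := by exact_mod_cast (by omega : 0 < m)
  obtain ⟨s, hs, hsum⟩ :=
    exists_finset_sum_exp_birkhoffSum_ge (Real.exp_pos _).le hη.le h m x₀ hJ
  obtain ⟨t, ht, -⟩ := hf.exists_finset_iterate_fibre hx₀ (N * k * m)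
  have hle : (Real.exp (k * S) * (1 + η)) ^ m ≤ preimSum f φ (Icc a b) (N * k * m) x₀ := by
    have hset : {y | y ∈ Icc a b ∧ f^[N * k * m] y = x₀} = (t : Set ℝ) := by ext y; simp [ht]
    rw [preimSum, hset, finsum_mem_coe_finset]
    calc _ ≤ ∑ y ∈ s, Real.exp (birkhoffSum f φ (N * k * m) y - u y) := by
          simpa [hu0] using hsum
      _ ≤ ∑ y ∈ s, Real.exp (birkhoffSum f φ (N * k * m) y) :=
          Finset.sum_le_sum fun y _ => Real.exp_le_exp.2 (sub_le_self _ (hu y))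
      _ ≤ _ := Finset.sum_le_sum_of_subset_of_nonneg
          (fun y hy => (ht y).2 ⟨hJI (hs y hy).1, (hs y hy).2⟩) fun _ _ _ => (Real.exp_pos _).le
  have hloglow := Real.log_le_log (by positivity) hle
  rw [Real.log_pow, Real.log_mul (by positivity) (by positivity), Real.log_exp] at hloglow
  push_cast
  rw [le_div_iff₀ (by positivity)]
  refine le_trans (le_of_eq ?_) hloglow
  field_simp

/-- **Lemma (hyperbolic repelling periodic points).** For a topologically exact `C³`
interval map with non-flat critical points, a Hölder continuous `φ`, and a hyperbolic
repelling periodic point `x₀` of period `N` (i.e. `|(f^N)'(x₀)| > 1`, expressed via the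
chain rule as a product of derivatives along the orbit),
`limsup (1/n) log Σ_{y ∈ f^{-n}(x₀)} exp(Sₙ(φ)(y)) > (1/N) S_N(φ)(x₀)`. -/
theorem periodic_case
    (a b : ℝ) (f : ℝ → ℝ)
    (hf : IsC3NonflatIntervalMap f a b)
    (hex : TopExact f (Icc a b))
    (φ : ℝ → ℝ) (hφ : HolderOn φ (Icc a b))
    (x₀ : ℝ) (hx₀ : x₀ ∈ Icc a b)
    (N : ℕ) (hN : 1 ≤ N) (hper : f^[N] x₀ = x₀)
    (hrep : 1 < |∏ i ∈ Finset.range N, deriv f (f^[i] x₀)|) :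
    birkhoffSum f φ N x₀ / N <
      atTop.limsup (fun n : ℕ => Real.log (preimSum f φ (Icc a b) n x₀) / n) := by
  have hD := hf.hasDerivAt_iterate N hx₀
  set D : ℝ := ∏ i ∈ Finset.range N, deriv f (f^[i] x₀)
  have hDD : HasDerivAt f^[N + N] (D * D) x₀ := by
    rw [Function.iterate_add]
    exact HasDerivAt.comp x₀ (by rwa [hper]) hD
  have hDD1 : 1 < D * D := by
    rw [← abs_mul_abs_self]
    exact one_lt_mul_of_lt_of_le hrep hrep.le
  have hper2 : f^[N + N] x₀ = x₀ := by rw [Function.iterate_add_apply, hper, hper]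
  have hN0 : (N : ℝ) ≠ 0 := by exact_mod_cast (by omega : N ≠ 0)
  have key := lt_limsup_log_preimSum hf hex hφ hx₀ (by omega) hper2 hDD hDD1
  rw [birkhoffSum_add, hper] at key
  convert key using 1
  push_cast
  field_simp

end
end
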